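/- Local existence with quantified time: for every d ≥ 2, γ ∈ (0,1) and positive reals Q, S, R there exists t₀ > 0 with the following property. Whenever D₀ ⊂ ℝ^d is a bounded C^{1+γ} domain possessing a defining function Φ₀ with ‖∇Φ₀‖_γ / |∇Φ₀|_inf ≤ Q, whose boundary has (d-1)-dimensional Hausdorff measure H^{d-1}(∂D₀) ≤ S and whose diameter is at most R, there exist a map X : ℝ^d × (-t₀,t₀) → ℝ^d and bounded C^{1+γ} domains D_t := X(D₀,t), |t| < t₀, with X(·,0) = id, X(·,t) a homeomorphism of ℝ^d for each t, and ∂_t X(α,t) = v(X(α,t),t) for every α, where v(x,t) = -∫_{D_t} ∇N(x-y) dy. -/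

import Mathlib

open MeasureTheory Metric Set
open scoped RealInnerProductSpace

noncomputable def sphereVol (d : ℕ) : ℝ :=
  d * (volume (Metric.ball (0 : EuclideanSpace ℝ (Fin d)) 1)).toReal

noncomputable def gradN (d : ℕ) (y : EuclideanSpace ℝ (Fin d)) : EuclideanSpace ℝ (Fin d) :=
  (sphereVol d * ‖y‖ ^ d)⁻¹ • y

noncomputable def hessN (d : ℕ) (z w : EuclideanSpace ℝ (Fin d)) : EuclideanSpace ℝ (Fin d) :=
  (sphereVol d)⁻¹ • ((‖z‖ ^ d)⁻¹ • w - ((d : ℝ) * (‖z‖ ^ (d + 2))⁻¹ * ⟪z, w⟫) • z)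

/-- `Φ` is a defining function of class `C^{1+γ}` for the set `D`. -/
def IsDefining (d : ℕ) (γ : ℝ) (D : Set (EuclideanSpace ℝ (Fin d)))
    (Φ : EuclideanSpace ℝ (Fin d) → ℝ) : Prop :=
  ContDiff ℝ 1 Φ ∧
  (∃ K : ℝ, ∀ x y, ‖gradient Φ x - gradient Φ y‖ ≤ K * ‖x - y‖ ^ γ) ∧
  D = {x | Φ x < 0} ∧
  frontier D = {x | Φ x = 0} ∧
  ∀ x ∈ frontier D, gradient Φ x ≠ 0

/-- `D` is a bounded domain of class `C^{1+γ}`. -/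
def IsC1Domain (d : ℕ) (γ : ℝ) (D : Set (EuclideanSpace ℝ (Fin d))) : Prop :=
  IsOpen D ∧ Bornology.IsBounded D ∧ ∃ Φ, IsDefining d γ D Φ

section part1

theorem pk_geom_sum (c q : ℝ) (hc : 0 ≤ c) (hq0 : 0 ≤ q) (hq : q < 1) :
    ∑' k : ℕ, ENNReal.ofReal (c * q ^ k) = ENNReal.ofReal (c * (1 - q)⁻¹) := by
  rw [← ENNReal.ofReal_tsum_of_nonneg (fun k => by positivity)
    ((summable_geometric_of_lt_one hq0 hq).mul_left c), tsum_mul_left,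
    tsum_geometric_of_lt_one hq0 hq]

theorem pk_shell_le {E : Type*} [NormedAddCommGroup E] [MeasurableSpace E] [BorelSpace E]
    (μ : Measure E) (p : E) (r s M b : ℝ) (hb : 0 ≤ b) (hr : 0 < r)
    (hM : μ (ball p s) ≤ ENNReal.ofReal M) (hM0 : 0 ≤ M) :
    ∫⁻ w in {w | r ≤ ‖w - p‖ ∧ ‖w - p‖ < s}, ENNReal.ofReal (‖w - p‖ ^ (-b)) ∂μ
      ≤ ENNReal.ofReal (M * r ^ (-b)) := by
  have hms : MeasurableSet {w : E | r ≤ ‖w - p‖ ∧ ‖w - p‖ < s} := by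
    have h1 : Continuous fun w : E => ‖w - p‖ := by fun_prop
    exact (measurableSet_le measurable_const h1.measurable).inter
      (measurableSet_lt h1.measurable measurable_const)
  calc ∫⁻ w in {w | r ≤ ‖w - p‖ ∧ ‖w - p‖ < s}, ENNReal.ofReal (‖w - p‖ ^ (-b)) ∂μ
      ≤ ∫⁻ w in {w | r ≤ ‖w - p‖ ∧ ‖w - p‖ < s}, ENNReal.ofReal (r ^ (-b)) ∂μ := by
        apply setLIntegral_mono' hms
        intro w hw
        apply ENNReal.ofReal_le_ofReal
        exact Real.rpow_le_rpow_of_nonpos hr hw.1 (by linarith)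
    _ = ENNReal.ofReal (r ^ (-b)) * μ {w | r ≤ ‖w - p‖ ∧ ‖w - p‖ < s} := by
        rw [setLIntegral_const]
    _ ≤ ENNReal.ofReal (r ^ (-b)) * ENNReal.ofReal M := by
        gcongr
        refine le_trans (measure_mono ?_) hM
        intro w hw
        simpa [mem_ball, dist_eq_norm] using hw.2
    _ = ENNReal.ofReal (M * r ^ (-b)) := by
        rw [mul_comm, ENNReal.ofReal_mul hM0]

theorem pk_far (a b : ℝ) (hab : a < b) (hb : 0 ≤ b) : ∃ K : ℝ, 0 < K ∧
    ∀ {E : Type} [NormedAddCommGroup E] [MeasurableSpace E] [BorelSpace E]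
    (μ : Measure E) (p : E) (C δ : ℝ), 0 ≤ C → 0 < δ →
    (∀ r, δ ≤ r → μ (ball p r) ≤ ENNReal.ofReal (C * r ^ a)) →
    ∫⁻ w in (ball p δ)ᶜ, ENNReal.ofReal (‖w - p‖ ^ (-b)) ∂μ
      ≤ ENNReal.ofReal (C * K * δ ^ (a - b)) := by
  have hq : (2:ℝ) ^ (a - b) < 1 := Real.rpow_lt_one_of_one_lt_of_neg (by norm_num) (by linarith)
  have hq0 : 0 < (2:ℝ) ^ (a - b) := by positivity
  refine ⟨2 ^ a * (1 - 2 ^ (a - b))⁻¹, mul_pos (by positivity) (inv_pos.2 (by linarith)), ?_⟩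
  intro E _ _ _ μ p C δ hC hδ hμ
  have hsub : (ball p δ)ᶜ ⊆ ⋃ k : ℕ, {w | 2 ^ k * δ ≤ ‖w - p‖ ∧ ‖w - p‖ < 2 ^ (k + 1) * δ} := by
    intro w hw
    have hw' : δ ≤ ‖w - p‖ := by simpa [mem_ball, dist_eq_norm] using hw
    obtain ⟨k, hk1, hk2⟩ := exists_nat_pow_near (x := ‖w - p‖ / δ) (y := (2:ℝ))
      ((one_le_div hδ).2 hw') (by norm_num)
    refine mem_iUnion.2 ⟨k, ?_, ?_⟩
    · exact (le_div_iff₀ hδ).1 hk1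
    · exact (div_lt_iff₀ hδ).1 hk2
  calc ∫⁻ w in (ball p δ)ᶜ, ENNReal.ofReal (‖w - p‖ ^ (-b)) ∂μ
      ≤ ∫⁻ w in ⋃ k : ℕ, {w | 2 ^ k * δ ≤ ‖w - p‖ ∧ ‖w - p‖ < 2 ^ (k + 1) * δ},
          ENNReal.ofReal (‖w - p‖ ^ (-b)) ∂μ := lintegral_mono_set hsub
    _ ≤ ∑' k : ℕ, ∫⁻ w in {w | 2 ^ k * δ ≤ ‖w - p‖ ∧ ‖w - p‖ < 2 ^ (k + 1) * δ},
          ENNReal.ofReal (‖w - p‖ ^ (-b)) ∂μ := lintegral_iUnion_le _ _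
    _ ≤ ∑' k : ℕ, ENNReal.ofReal ((C * 2 ^ a * δ ^ (a - b)) * (2 ^ (a - b)) ^ k) := by
        apply ENNReal.tsum_le_tsum
        intro k
        refine le_trans (pk_shell_le μ p (2 ^ k * δ) (2 ^ (k + 1) * δ)
          (C * (2 ^ (k + 1) * δ) ^ a) b hb (by positivity) (hμ _ ?_) (by positivity)) ?_
        · have : (1:ℝ) ≤ 2 ^ (k + 1) := one_le_pow₀ (by norm_num)
          nlinarith
        · apply ENNReal.ofReal_le_ofReal
          apply le_of_eq
          rw [pow_succ, mul_assoc, Real.mul_rpow (by positivity) (by positivity),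
            Real.mul_rpow (by positivity) (by positivity),
            Real.mul_rpow (by positivity) (by positivity), sub_eq_add_neg a b,
            Real.rpow_add hδ, Real.rpow_add (by norm_num : (0:ℝ) < 2), mul_pow,
            ← Real.rpow_natCast, ← Real.rpow_natCast, ← Real.rpow_natCast, ← Real.rpow_mul (by norm_num),
            ← Real.rpow_mul (by norm_num), ← Real.rpow_mul (by norm_num),
            ← Real.rpow_mul (by norm_num), mul_comm a, mul_comm (-b)]
          ring
    _ = _ := by
        rw [pk_geom_sum _ _ (by positivity) hq0.le hq]
        congr 1; ring

theorem pk_near (a b : ℝ) (hab : b < a) (hb : 0 < b) : ∃ K : ℝ, 0 < K ∧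
    ∀ {E : Type} [NormedAddCommGroup E] [MeasurableSpace E] [BorelSpace E]
    (μ : Measure E) (p : E) (C δ : ℝ), 0 ≤ C → 0 < δ →
    (∀ r, 0 < r → r ≤ δ → μ (ball p r) ≤ ENNReal.ofReal (C * r ^ a)) →
    ∫⁻ w in ball p δ, ENNReal.ofReal (‖w - p‖ ^ (-b)) ∂μ
      ≤ ENNReal.ofReal (C * K * δ ^ (a - b)) := by
  have hq : ((2:ℝ)⁻¹) ^ (a - b) < 1 := Real.rpow_lt_one (by norm_num) (by norm_num) (by linarith)
  have hq0 : 0 < ((2:ℝ)⁻¹) ^ (a - b) := by positivity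
  refine ⟨2 ^ b * (1 - (2⁻¹) ^ (a - b))⁻¹, mul_pos (by positivity) (inv_pos.2 (by linarith)), ?_⟩
  intro E _ _ _ μ p C δ hC hδ hμ
  set S : ℕ → Set E := fun k => {w | 2⁻¹ ^ (k + 1) * δ ≤ ‖w - p‖ ∧ ‖w - p‖ < 2⁻¹ ^ k * δ} with hS
  have hsub : ball p δ ⊆ {p} ∪ ⋃ k : ℕ, S k := by
    intro w hw
    by_cases hwp : w = p
    · left; simpa using hwp
    right
    have hw' : ‖w - p‖ < δ := by simpa [mem_ball, dist_eq_norm] using hw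
    have hw0 : 0 < ‖w - p‖ := by simpa [sub_eq_zero] using hwp
    obtain ⟨k, hk1, hk2⟩ := exists_nat_pow_near_of_lt_one (x := ‖w - p‖ / δ) (y := (2:ℝ)⁻¹)
      (by positivity) ((div_le_one hδ).2 hw'.le) (by norm_num) (by norm_num)
    rcases eq_or_lt_of_le hk2 with h | h
    · have hk : k ≠ 0 := by
        rintro rfl
        rw [pow_zero, div_eq_one_iff_eq hδ.ne'] at h
        linarith
      obtain ⟨j, rfl⟩ := Nat.exists_eq_succ_of_ne_zero hk
      refine mem_iUnion.2 ⟨j, ?_, ?_⟩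
      · exact ((div_eq_iff hδ.ne').1 h).ge
      · rw [(div_eq_iff hδ.ne').1 h, Nat.succ_eq_add_one, pow_succ]
        have : 0 < (2:ℝ)⁻¹ ^ j := by positivity
        nlinarith [mul_pos this hδ]
    · refine mem_iUnion.2 ⟨k, ?_, ?_⟩
      · exact ((lt_div_iff₀ hδ).1 hk1).le
      · exact (div_lt_iff₀ hδ).1 h
  calc ∫⁻ w in ball p δ, ENNReal.ofReal (‖w - p‖ ^ (-b)) ∂μ
      ≤ ∫⁻ w in {p} ∪ ⋃ k : ℕ, S k,
          ENNReal.ofReal (‖w - p‖ ^ (-b)) ∂μ := lintegral_mono_set hsub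
    _ ≤ ∫⁻ w in {p}, ENNReal.ofReal (‖w - p‖ ^ (-b)) ∂μ + ∫⁻ w in ⋃ k : ℕ, S k,
          ENNReal.ofReal (‖w - p‖ ^ (-b)) ∂μ := lintegral_union_le _ _ _
    _ = ∫⁻ w in ⋃ k : ℕ, S k, ENNReal.ofReal (‖w - p‖ ^ (-b)) ∂μ := by
        have : ∫⁻ w in {p}, ENNReal.ofReal (‖w - p‖ ^ (-b)) ∂μ = 0 := by
          have h0 : ∀ w ∈ ({p} : Set E), ENNReal.ofReal (‖w - p‖ ^ (-b)) = 0 := by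
            intro w hw
            rw [mem_singleton_iff.1 hw]
            simp [Real.zero_rpow (neg_ne_zero.2 hb.ne')]
          rw [setLIntegral_congr_fun (measurableSet_singleton p) h0]; simp
        rw [this, zero_add]
    _ ≤ ∑' k : ℕ, ∫⁻ w in S k,
          ENNReal.ofReal (‖w - p‖ ^ (-b)) ∂μ := lintegral_iUnion_le _ _
    _ ≤ ∑' k : ℕ, ENNReal.ofReal ((C * 2 ^ b * δ ^ (a - b)) * (2⁻¹ ^ (a - b)) ^ k) := by
        apply ENNReal.tsum_le_tsum
        intro k
        refine le_trans (pk_shell_le μ p (2⁻¹ ^ (k + 1) * δ) (2⁻¹ ^ k * δ)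
          (C * (2⁻¹ ^ k * δ) ^ a) b hb.le (by positivity) (hμ _ (by positivity) ?_)
            (by positivity)) ?_
        · have : (2:ℝ)⁻¹ ^ k ≤ 1 := pow_le_one₀ (by norm_num) (by norm_num)
          nlinarith
        · apply ENNReal.ofReal_le_ofReal
          apply le_of_eq
          have e2 : (2:ℝ) ^ b = (2⁻¹ : ℝ) ^ (-b) := by
            rw [Real.inv_rpow (by norm_num), Real.rpow_neg (by norm_num), inv_inv]
          rw [e2, pow_succ, Real.mul_rpow (by positivity) (by positivity),
            Real.mul_rpow (by positivity) (by positivity),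
            Real.mul_rpow (by positivity) (by positivity), sub_eq_add_neg a b,
            Real.rpow_add hδ, Real.rpow_add (by norm_num : (0:ℝ) < 2⁻¹), mul_pow,
            ← Real.rpow_natCast, ← Real.rpow_natCast, ← Real.rpow_natCast, ← Real.rpow_mul (by norm_num),
            ← Real.rpow_mul (by norm_num), ← Real.rpow_mul (by norm_num),
            ← Real.rpow_mul (by norm_num), mul_comm a, mul_comm (-b)]
          ring
    _ = _ := by
        rw [pk_geom_sum _ _ (by positivity) hq0.le hq]
        congr 1; ring

/-- Volume of a ball in Euclidean space. -/
theorem vol_ball_le (d : ℕ) : ∃ K : ℝ, 0 < K ∧ ∀ (p : EuclideanSpace ℝ (Fin d)) (r : ℝ), 0 < r →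
    volume (ball p r) = ENNReal.ofReal (K * r ^ d) := by
  refine ⟨(volume (ball (0 : EuclideanSpace ℝ (Fin d)) 1)).toReal,
    ENNReal.toReal_pos (measure_ball_pos _ _ one_pos).ne' measure_ball_lt_top.ne, ?_⟩
  intro p r hr
  rw [Measure.addHaar_ball_of_pos _ _ hr, mul_comm, ENNReal.ofReal_mul ENNReal.toReal_nonneg,
    ENNReal.ofReal_toReal measure_ball_lt_top.ne]
  simp

/-- Volume of a slab intersected with a ball. -/
theorem vol_slab_le (d : ℕ) : ∃ K : ℝ, 0 < K ∧ ∀ (p n : EuclideanSpace ℝ (Fin d)) (r τ : ℝ),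
    ‖n‖ = 1 → 0 < τ → τ ≤ r →
    volume ({w | |⟪w - p, n⟫| ≤ τ} ∩ ball p r) ≤ ENNReal.ofReal (K * (τ / r) * r ^ d) := by
  obtain ⟨K, hK, hball⟩ := vol_ball_le d
  refine ⟨K * 2 ^ d, by positivity, ?_⟩
  intro p n r τ hn hτ hτr
  have hr : 0 < r := hτ.trans_le hτr
  set f : Module.Dual ℝ (EuclideanSpace ℝ (Fin d)) := (innerSL ℝ n).toLinearMap with hf
  set T := LinearMap.transvection f ((r / τ - 1) • n) with hT
  have hdet : LinearMap.det T = r / τ := by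
    rw [hT, LinearMap.transvection.det]
    simp [hf, hn]
  have hdet0 : LinearMap.det T ≠ 0 := by rw [hdet]; positivity
  have himg : T '' ({w | |⟪w - p, n⟫| ≤ τ} ∩ ball p r) ⊆ ball (T p) (2 * r) := by
    rintro _ ⟨w, ⟨hw1, hw2⟩, rfl⟩
    rw [mem_ball, dist_eq_norm, ← map_sub, hT, LinearMap.transvection.apply]
    have h1 : ‖w - p‖ < r := by simpa [dist_eq_norm] using hw2
    have h2 : |⟪n, w - p⟫| ≤ τ := by rw [real_inner_comm]; exact hw1
    calc ‖w - p + f (w - p) • (r / τ - 1) • n‖ ≤ ‖w - p‖ + ‖f (w - p) • (r / τ - 1) • n‖ :=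
          norm_add_le _ _
      _ = ‖w - p‖ + |⟪n, w - p⟫| * (r / τ - 1) := by
          rw [norm_smul, norm_smul, hn, mul_one, Real.norm_eq_abs, Real.norm_eq_abs,
            abs_of_nonneg (a := r / τ - 1) (by rw [sub_nonneg, one_le_div hτ]; exact hτr)]
          rfl
      _ ≤ ‖w - p‖ + τ * (r / τ - 1) := by
          gcongr
          rw [sub_nonneg, one_le_div hτ]; exact hτr
      _ = ‖w - p‖ + r - τ := by field_simp; ring
      _ < 2 * r := by linarith
  have h3 := measure_mono (μ := volume) himg
  rw [Measure.addHaar_image_linearMap, hdet, hball _ _ (by positivity)] at h3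
  have h4 : ENNReal.ofReal |r / τ| = ENNReal.ofReal (r / τ) := by rw [abs_of_pos (by positivity)]
  rw [h4] at h3
  calc volume ({w | |⟪w - p, n⟫| ≤ τ} ∩ ball p r)
      = ENNReal.ofReal (τ / r) * (ENNReal.ofReal (r / τ) *
        volume ({w | |⟪w - p, n⟫| ≤ τ} ∩ ball p r)) := by
        rw [← mul_assoc, ← ENNReal.ofReal_mul (by positivity)]
        have : τ / r * (r / τ) = 1 := by field_simp
        rw [this]; simp
    _ ≤ ENNReal.ofReal (τ / r) * ENNReal.ofReal (K * (2 * r) ^ d) := by gcongr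
    _ = ENNReal.ofReal (K * 2 ^ d * (τ / r) * r ^ d) := by
        rw [← ENNReal.ofReal_mul (by positivity)]
        congr 1; rw [mul_pow]; ring

end part1

section part2

theorem sphereVol_pos (d : ℕ) (hd : 2 ≤ d) : 0 < sphereVol d := by
  unfold sphereVol
  have : 0 < (volume (Metric.ball (0 : EuclideanSpace ℝ (Fin d)) 1)).toReal :=
    ENNReal.toReal_pos (measure_ball_pos _ _ one_pos).ne' measure_ball_lt_top.ne
  have h2 : (0:ℝ) < d := by exact_mod_cast (by omega : 0 < d)
  positivity

theorem gradN_neg (d : ℕ) (y : EuclideanSpace ℝ (Fin d)) : gradN d (-y) = - gradN d y := by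
  simp [gradN]

theorem gradN_smul (d : ℕ) (l : ℝ) (hl : 0 < l) (z : EuclideanSpace ℝ (Fin d)) :
    gradN d (l • z) = (l * (l ^ d)⁻¹) • gradN d z := by
  simp only [gradN, norm_smul, Real.norm_eq_abs, abs_of_pos hl, smul_smul, mul_pow, mul_inv]
  congr 1; ring

theorem norm_gradN (d : ℕ) (hd : 2 ≤ d) (z : EuclideanSpace ℝ (Fin d)) :
    ‖gradN d z‖ = (sphereVol d)⁻¹ * ‖z‖ ^ (-((d:ℝ) - 1)) := by
  have h := sphereVol_pos d hd
  have hd1 : (1:ℝ) < d := by exact_mod_cast (by omega : 1 < d)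
  rw [gradN, norm_smul, norm_inv, norm_mul, norm_pow, norm_norm, Real.norm_eq_abs, abs_of_pos h,
    mul_inv, mul_assoc]
  congr 1
  by_cases hz : ‖z‖ = 0
  · rw [hz, Real.zero_rpow (by linarith)]; simp
  · have hz' : 0 < ‖z‖ := lt_of_le_of_ne (norm_nonneg _) (Ne.symm hz)
    rw [neg_sub, sub_eq_add_neg, Real.rpow_add hz', Real.rpow_neg hz'.le, Real.rpow_natCast,
      Real.rpow_one, mul_comm]

theorem measurable_gradN (d : ℕ) : Measurable (gradN d) := by
  unfold gradN
  fun_prop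

theorem contDiffAt_gradN (d : ℕ) (hd : 2 ≤ d) (z : EuclideanSpace ℝ (Fin d)) (hz : z ≠ 0) :
    ContDiffAt ℝ 3 (gradN d) z := by
  unfold gradN
  have h := sphereVol_pos d hd
  refine ContDiffAt.smul (ContDiffAt.inv (contDiffAt_const.mul ((contDiffAt_norm ℝ hz).pow d)) ?_)
    contDiffAt_id
  have : 0 < ‖z‖ := norm_pos_iff.2 hz
  positivity

theorem fderiv_gradN_smul (d : ℕ) (l : ℝ) (hl : 0 < l)
    (z : EuclideanSpace ℝ (Fin d)) :
    fderiv ℝ (gradN d) (l • z) = ((l ^ d)⁻¹) • fderiv ℝ (gradN d) z := by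
  have h1 : (fun w => gradN d (l • w)) = fun w => (l * (l ^ d)⁻¹) • gradN d w := by
    funext w; exact gradN_smul d l hl w
  have h2 : fderiv ℝ (fun w => gradN d (l • w)) z = l • fderiv ℝ (gradN d) (l • z) := by
    exact fderiv_comp_smul (f := gradN d) l
  have h3 : fderiv ℝ (fun w => (l * (l ^ d)⁻¹) • gradN d w) z
      = (l * (l ^ d)⁻¹) • fderiv ℝ (gradN d) z :=
    congrFun (fderiv_const_smul_field (𝕜 := ℝ) (f := gradN d) (l * (l ^ d)⁻¹)) z
  rw [h1, h3, mul_smul] at h2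
  exact (smul_right_injective _ hl.ne' h2).symm

theorem fderiv2_gradN_smul (d : ℕ) (l : ℝ) (hl : 0 < l)
    (z : EuclideanSpace ℝ (Fin d)) :
    fderiv ℝ (fderiv ℝ (gradN d)) (l • z)
      = ((l ^ (d + 1))⁻¹) • fderiv ℝ (fderiv ℝ (gradN d)) z := by
  have h1 : (fun w => fderiv ℝ (gradN d) (l • w)) = fun w => ((l ^ d)⁻¹) • fderiv ℝ (gradN d) w := by
    funext w; exact fderiv_gradN_smul d l hl w
  have h2 : fderiv ℝ (fun w => fderiv ℝ (gradN d) (l • w)) z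
      = l • fderiv ℝ (fderiv ℝ (gradN d)) (l • z) := by
    exact fderiv_comp_smul (f := fderiv ℝ (gradN d)) l
  have h3 : fderiv ℝ (fun w => ((l ^ d)⁻¹) • fderiv ℝ (gradN d) w) z
      = ((l ^ d)⁻¹) • fderiv ℝ (fderiv ℝ (gradN d)) z :=
    congrFun (fderiv_const_smul_field (𝕜 := ℝ) (f := fderiv ℝ (gradN d)) ((l ^ d)⁻¹)) z
  rw [h1, h3] at h2
  have h4 : l⁻¹ • (l • fderiv ℝ (fderiv ℝ (gradN d)) (l • z)) = l⁻¹ • ((l ^ d)⁻¹) • fderiv ℝ (fderiv ℝ (gradN d)) z := by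
    rw [h2]
  rw [inv_smul_smul₀ hl.ne', smul_smul] at h4
  rw [h4]; congr 1; rw [pow_succ, mul_inv, mul_comm]

theorem contDiffAt_fderiv_gradN (d : ℕ) (hd : 2 ≤ d) (z : EuclideanSpace ℝ (Fin d)) (hz : z ≠ 0) :
    ContDiffAt ℝ 2 (fderiv ℝ (gradN d)) z :=
  (contDiffAt_gradN d hd z hz).fderiv_right (by norm_num)

theorem homog_bound {d : ℕ} {G : Type*} [NormedAddCommGroup G] [NormedSpace ℝ G]
    (F : EuclideanSpace ℝ (Fin d) → G) (m : ℕ)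
    (hF : ∀ z, z ≠ 0 → ContinuousAt F z)
    (hom : ∀ (l : ℝ), 0 < l → ∀ z, F (l • z) = ((l ^ m)⁻¹) • F z) :
    ∃ C : ℝ, 0 < C ∧ ∀ z, z ≠ 0 → ‖F z‖ ≤ C * ‖z‖ ^ (-(m:ℝ)) := by
  have hc : ContinuousOn F (sphere 0 1) := by
    intro z hz
    refine (hF z ?_).continuousWithinAt
    rintro rfl
    simp at hz
  obtain ⟨C, hC⟩ := (isCompact_sphere (0 : EuclideanSpace ℝ (Fin d)) 1).exists_bound_of_continuousOn hc
  refine ⟨max C 1, by positivity, ?_⟩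
  intro z hz
  have hz0 : 0 < ‖z‖ := norm_pos_iff.2 hz
  have h1 : F z = ((‖z‖ ^ m)⁻¹) • F (‖z‖⁻¹ • z) := by
    rw [← hom _ hz0, smul_inv_smul₀ hz0.ne']
  rw [h1, norm_smul, norm_inv, norm_pow, norm_norm, Real.rpow_neg hz0.le, Real.rpow_natCast, mul_comm]
  gcongr
  refine (hC _ ?_).trans (le_max_left _ _)
  simp [norm_smul, hz0.ne']

theorem kernel_bounds (d : ℕ) (hd : 2 ≤ d) : ∃ C : ℝ, 0 < C ∧
    (∀ z, ‖gradN d z‖ ≤ C * ‖z‖ ^ (-((d:ℝ) - 1))) ∧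
    (∀ z, z ≠ 0 → DifferentiableAt ℝ (gradN d) z) ∧
    (∀ z, z ≠ 0 → ‖fderiv ℝ (gradN d) z‖ ≤ C * ‖z‖ ^ (-(d:ℝ))) ∧
    (∀ z, z ≠ 0 → ∀ z', ‖z' - z‖ ≤ ‖z‖ / 2 →
      ‖gradN d z' - gradN d z‖ ≤ C * ‖z' - z‖ * ‖z‖ ^ (-(d:ℝ))) ∧
    (∀ z, z ≠ 0 → ∀ z', ‖z' - z‖ ≤ ‖z‖ / 2 →
      ‖fderiv ℝ (gradN d) z' - fderiv ℝ (gradN d) z‖ ≤ C * ‖z' - z‖ * ‖z‖ ^ (-((d:ℝ) + 1))) := by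
  have hs := sphereVol_pos d hd
  obtain ⟨C1, hC1, h1⟩ := homog_bound (fderiv ℝ (gradN d)) d
    (fun z hz => (contDiffAt_fderiv_gradN d hd z hz).continuousAt)
    (fun l hl z => fderiv_gradN_smul d l hl z)
  obtain ⟨C2, hC2, h2⟩ := homog_bound (fderiv ℝ (fderiv ℝ (gradN d))) (d + 1)
    (fun z hz => ((contDiffAt_fderiv_gradN d hd z hz).fderiv_right
      (m := 1) (by norm_num)).continuousAt)
    (fun l hl z => fderiv2_gradN_smul d l hl z)
  have hdiff : ∀ z, z ≠ 0 → DifferentiableAt ℝ (gradN d) z := fun z hz =>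
    (contDiffAt_gradN d hd z hz).differentiableAt (by norm_num)
  have hdiff2 : ∀ z, z ≠ 0 → DifferentiableAt ℝ (fderiv ℝ (gradN d)) z := fun z hz =>
    (contDiffAt_fderiv_gradN d hd z hz).differentiableAt (by norm_num)
  have hball : ∀ z : EuclideanSpace ℝ (Fin d), z ≠ 0 → ∀ w ∈ closedBall z (‖z‖ / 2),
      ‖z‖ / 2 ≤ ‖w‖ ∧ w ≠ 0 := by
    intro z hz w hw
    have hz0 : 0 < ‖z‖ := norm_pos_iff.2 hz
    rw [mem_closedBall, dist_eq_norm] at hw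
    have h3 : ‖z‖ / 2 ≤ ‖w‖ := by
      have : ‖z‖ ≤ ‖w‖ + ‖w - z‖ := by
        calc ‖z‖ = ‖w - (w - z)‖ := by congr 1; abel
          _ ≤ _ := norm_sub_le _ _
      linarith
    exact ⟨h3, by rintro rfl; rw [norm_zero] at h3; linarith⟩
  have hpow : ∀ (z w : EuclideanSpace ℝ (Fin d)) (m : ℕ), z ≠ 0 → ‖z‖ / 2 ≤ ‖w‖ →
      ‖w‖ ^ (-(m:ℝ)) ≤ 2 ^ m * ‖z‖ ^ (-(m:ℝ)) := by
    intro z w m hz hw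
    have hz0 : 0 < ‖z‖ := norm_pos_iff.2 hz
    calc ‖w‖ ^ (-(m:ℝ)) ≤ (‖z‖ / 2) ^ (-(m:ℝ)) :=
          Real.rpow_le_rpow_of_nonpos (by positivity) hw (by simp)
      _ = 2 ^ m * ‖z‖ ^ (-(m:ℝ)) := by
          rw [Real.rpow_neg (by positivity), Real.rpow_neg (by positivity), Real.rpow_natCast,
            Real.rpow_natCast, div_pow, inv_div, div_eq_mul_inv]
  set C := max (sphereVol d)⁻¹ (max (C1 * 2 ^ d) (C2 * 2 ^ (d + 1)))
  have hCa : (sphereVol d)⁻¹ ≤ C := le_max_left _ _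
  have hCb : C1 * 2 ^ d ≤ C := (le_max_left _ _).trans (le_max_right _ _)
  have hCc : C2 * 2 ^ (d + 1) ≤ C := (le_max_right _ _).trans (le_max_right _ _)
  have hCb' : C1 ≤ C := by
    have : (1:ℝ) ≤ 2 ^ d := one_le_pow₀ (by norm_num)
    nlinarith
  refine ⟨C, lt_of_lt_of_le (inv_pos.2 hs) hCa, ?_, hdiff, ?_, ?_, ?_⟩
  · intro z
    rw [norm_gradN d hd]
    gcongr
  · intro z hz
    exact (h1 z hz).trans (by gcongr)
  · intro z hz z' hz'
    have := Convex.norm_image_sub_le_of_norm_fderiv_le (𝕜 := ℝ) (f := gradN d)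
      (C := C * ‖z‖ ^ (-(d:ℝ))) (s := closedBall z (‖z‖ / 2))
      (fun w hw => hdiff w (hball z hz w hw).2) ?_ (convex_closedBall _ _)
      (mem_closedBall_self (by positivity)) (y := z') (by simpa [dist_eq_norm] using hz')
    · linarith
    · intro w hw
      calc _ ≤ C1 * ‖w‖ ^ (-(d:ℝ)) := h1 w (hball z hz w hw).2
        _ ≤ C1 * (2 ^ d * ‖z‖ ^ (-(d:ℝ))) := by
          gcongr; exact hpow z w d hz (hball z hz w hw).1
        _ ≤ _ := by rw [← mul_assoc]; gcongr
  · intro z hz z' hz'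
    have := Convex.norm_image_sub_le_of_norm_fderiv_le (𝕜 := ℝ) (f := fderiv ℝ (gradN d))
      (C := C * ‖z‖ ^ (-((d:ℝ) + 1))) (s := closedBall z (‖z‖ / 2))
      (fun w hw => hdiff2 w (hball z hz w hw).2) ?_ (convex_closedBall _ _)
      (mem_closedBall_self (by positivity)) (y := z') (by simpa [dist_eq_norm] using hz')
    · linarith
    · intro w hw
      have e : ((d + 1 : ℕ) : ℝ) = (d:ℝ) + 1 := by push_cast; ring
      rw [← e]
      calc _ ≤ C2 * ‖w‖ ^ (-((d + 1 : ℕ):ℝ)) := h2 w (hball z hz w hw).2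
        _ ≤ C2 * (2 ^ (d + 1) * ‖z‖ ^ (-((d + 1 : ℕ):ℝ))) := by
          gcongr; exact hpow z w (d + 1) hz (hball z hz w hw).1
        _ ≤ _ := by rw [← mul_assoc]; gcongr

end part2

section part3

theorem lint_gradN_ball (d : ℕ) (hd : 2 ≤ d) : ∃ C : ℝ, 0 < C ∧
    ∀ (x : EuclideanSpace ℝ (Fin d)) (r : ℝ), 0 < r →
    ∫⁻ w in ball x r, ENNReal.ofReal ‖gradN d (x - w)‖ ≤ ENNReal.ofReal (C * r) := by
  obtain ⟨C0, hC0, hk, -⟩ := kernel_bounds d hd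
  have hd1 : (1:ℝ) < d := by exact_mod_cast (by omega : 1 < d)
  obtain ⟨K, hK, hnear⟩ := pk_near d (d - 1) (by linarith) (by linarith)
  obtain ⟨Kb, hKb, hb⟩ := vol_ball_le d
  refine ⟨C0 * (Kb * K), by positivity, ?_⟩
  intro x r hr
  calc ∫⁻ w in ball x r, ENNReal.ofReal ‖gradN d (x - w)‖
      ≤ ∫⁻ w in ball x r, ENNReal.ofReal C0 * ENNReal.ofReal (‖w - x‖ ^ (-((d:ℝ) - 1))) := by
        apply lintegral_mono
        intro w
        simp only
        rw [← ENNReal.ofReal_mul hC0.le]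
        apply ENNReal.ofReal_le_ofReal
        rw [← norm_neg (w - x), neg_sub]
        exact hk _
    _ = ENNReal.ofReal C0 * ∫⁻ w in ball x r, ENNReal.ofReal (‖w - x‖ ^ (-((d:ℝ) - 1))) := by
        rw [lintegral_const_mul' _ _ ENNReal.ofReal_ne_top]
    _ ≤ ENNReal.ofReal C0 * ENNReal.ofReal (Kb * K * r ^ ((d:ℝ) - (d - 1))) := by
        gcongr
        apply hnear _ _ _ _ hKb.le hr
        intro s hs _
        rw [hb x s hs, Real.rpow_natCast]
    _ = _ := by
        rw [← ENNReal.ofReal_mul hC0.le]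
        congr 1
        have : (d:ℝ) - (d - 1) = 1 := by ring
        rw [this, Real.rpow_one]; ring

theorem integrableOn_gradN_ball (d : ℕ) (hd : 2 ≤ d) (x : EuclideanSpace ℝ (Fin d)) (r : ℝ) :
    IntegrableOn (fun w => gradN d (x - w)) (ball x r) := by
  rcases le_or_gt r 0 with h | h
  · rw [ball_eq_empty.2 h]; exact integrableOn_empty
  obtain ⟨C, hC, hl⟩ := lint_gradN_ball d hd
  refine ⟨((measurable_gradN d).comp (by fun_prop)).aestronglyMeasurable, ?_⟩
  rw [hasFiniteIntegral_iff_norm]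
  exact (hl x r h).trans_lt ENNReal.ofReal_lt_top

theorem integrableOn_gradN (d : ℕ) (hd : 2 ≤ d) (x : EuclideanSpace ℝ (Fin d))
    (D : Set (EuclideanSpace ℝ (Fin d))) (hD : Bornology.IsBounded D) :
    IntegrableOn (fun w => gradN d (x - w)) D := by
  obtain ⟨r, hr⟩ := hD.subset_ball x
  exact (integrableOn_gradN_ball d hd x r).mono_set hr

theorem integral_polar {E F : Type*} [NormedAddCommGroup E] [NormedSpace ℝ E] [MeasurableSpace E]
    [BorelSpace E] [FiniteDimensional ℝ E] (μ : Measure E)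
    [μ.IsAddHaarMeasure] [Nontrivial E]
    [NormedAddCommGroup F] [NormedSpace ℝ F] (f : E → F) (hf : Integrable f μ) :
    ∫ x, f x ∂μ = ∫ ω : sphere (0:E) 1, (∫ r in Ioi (0:ℝ),
      r ^ (Module.finrank ℝ E - 1) • f (r • (ω : E))) ∂μ.toSphere := by
  have hmp := μ.measurePreserving_homeomorphUnitSphereProd
  set g : sphere (0:E) 1 × Ioi (0:ℝ) → F := fun q => f (q.2.1 • (q.1 : E)) with hg
  have hgc : ∀ x : ({0}ᶜ : Set E), g (homeomorphUnitSphereProd E x) = f x.1 := by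
    intro x
    have hx : ‖(x:E)‖ ≠ 0 := norm_ne_zero_iff.2 x.2
    simp [hg, smul_smul, hx]
  have h1 : ∫ x, f x ∂μ = ∫ x : ({(0)}ᶜ : Set E), f x.1 ∂(μ.comap (↑)) := by
      rw [integral_subtype_comap (measurableSet_singleton _).compl fun x ↦ f x,
        restrict_compl_singleton]
  have h2 : ∫ x : ({(0)}ᶜ : Set E), f x.1 ∂(μ.comap (↑)) =
      ∫ q, g q ∂μ.toSphere.prod (.volumeIoiPow (Module.finrank ℝ E - 1)) := by
    rw [← hmp.integral_comp (Homeomorph.measurableEmbedding _) g]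
    simp_rw [hgc]
  have hintg : Integrable g (μ.toSphere.prod (.volumeIoiPow (Module.finrank ℝ E - 1))) := by
    rw [← hmp.integrable_comp_emb (Homeomorph.measurableEmbedding _)]
    have : g ∘ (homeomorphUnitSphereProd E) = f ∘ Subtype.val := by
      funext x; exact hgc x
    rw [this, ← integrableOn_iff_comap_subtypeVal (measurableSet_singleton _).compl]
    exact hf.integrableOn
  rw [h1, h2, integral_prod _ hintg]
  congr 1
  funext ω
  simp only [Measure.volumeIoiPow, ENNReal.ofReal]
  rw [integral_withDensity_eq_integral_smul,
    integral_subtype_comap measurableSet_Ioi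
      fun a ↦ Real.toNNReal (a ^ (Module.finrank ℝ E - 1)) • f (a • (ω:E)),
    setIntegral_congr_fun measurableSet_Ioi fun x hx ↦ ?_]
  · rw [NNReal.smul_def, Real.coe_toNNReal _ (pow_nonneg (le_of_lt hx) _)]
  · exact (measurable_subtype_coe.pow_const _).real_toNNReal

theorem ray_mem_ball_iff {E : Type*} [NormedAddCommGroup E] [InnerProductSpace ℝ E]
    (a ω : E) (hω : ‖ω‖ = 1) (ρ : ℝ) (ha : ‖a‖ < ρ) (r : ℝ) (hr : 0 < r) :
    r • ω ∈ ball a ρ ↔ r < ⟪a, ω⟫ + Real.sqrt (⟪a, ω⟫ ^ 2 + (ρ ^ 2 - ‖a‖ ^ 2)) := by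
  have hρ : 0 < ρ := (norm_nonneg a).trans_lt ha
  have hpos : 0 < ρ ^ 2 - ‖a‖ ^ 2 := by nlinarith [norm_nonneg a]
  set b := ⟪a, ω⟫ with hb
  set q := Real.sqrt (b ^ 2 + (ρ ^ 2 - ‖a‖ ^ 2)) with hq
  have hq2 : q ^ 2 = b ^ 2 + (ρ ^ 2 - ‖a‖ ^ 2) := Real.sq_sqrt (by positivity)
  have hq0 : 0 ≤ q := Real.sqrt_nonneg _
  have hqb : |b| < q := by
    apply abs_lt_of_sq_lt_sq _ hq0
    nlinarith
  obtain ⟨h1, h2⟩ := abs_lt.1 hqb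
  have hn : ‖r • ω - a‖ ^ 2 = r ^ 2 - 2 * (r * b) + ‖a‖ ^ 2 := by
    rw [norm_sub_sq_real, norm_smul, hω, inner_smul_left, real_inner_comm, ← hb]
    simp
  rw [mem_ball, dist_eq_norm, ← sq_lt_sq₀ (norm_nonneg _) hρ.le, hn]
  constructor
  · intro h
    by_contra hcon
    push Not at hcon
    nlinarith
  · intro h
    nlinarith

theorem newton_origin (d : ℕ) (hd : 2 ≤ d) : ∃ L : EuclideanSpace ℝ (Fin d) →ₗ[ℝ] EuclideanSpace ℝ (Fin d),
    ∀ (a : EuclideanSpace ℝ (Fin d)) (ρ : ℝ), ‖a‖ < ρ → ∫ z in ball a ρ, gradN d z = L a := by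
  have : Nonempty (Fin d) := ⟨⟨0, by omega⟩⟩
  set σ := (volume : Measure (EuclideanSpace ℝ (Fin d))).toSphere with hσ
  have hcont : ∀ a : EuclideanSpace ℝ (Fin d), Integrable (fun ω : sphere (0:EuclideanSpace ℝ (Fin d)) 1 =>
      (⟪a, (ω:EuclideanSpace ℝ (Fin d))⟫) • (ω:EuclideanSpace ℝ (Fin d))) σ := by
    intro a
    refine Integrable.of_bound (C := ‖a‖) (Continuous.aestronglyMeasurable (by fun_prop)) ?_
    refine Filter.Eventually.of_forall fun ω => ?_
    have hω : ‖(ω : EuclideanSpace ℝ (Fin d))‖ = 1 := by simp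
    rw [norm_smul, hω, mul_one]
    calc _ ≤ ‖a‖ * ‖(ω : EuclideanSpace ℝ (Fin d))‖ := norm_inner_le_norm _ _
      _ = ‖a‖ := by rw [hω, mul_one]
  refine ⟨{ toFun := fun a => (sphereVol d)⁻¹ • ∫ ω : sphere (0:EuclideanSpace ℝ (Fin d)) 1,
      (⟪a, (ω:EuclideanSpace ℝ (Fin d))⟫) • (ω:EuclideanSpace ℝ (Fin d)) ∂σ
            map_add' := ?_, map_smul' := ?_ }, ?_⟩
  · intro a b
    simp_rw [inner_add_left, add_smul]
    rw [integral_add (hcont a) (hcont b), smul_add]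
  · intro m a
    simp_rw [inner_smul_left, mul_smul]
    rw [integral_smul]
    simp [smul_comm m]
  · intro a ρ ha
    simp only [LinearMap.coe_mk, AddHom.coe_mk]
    have hi0 : IntegrableOn (gradN d) (ball a ρ) := by
      have := integrableOn_gradN d hd 0 (ball (-a) ρ) isBounded_ball
      rw [← integrable_indicator_iff measurableSet_ball] at this ⊢
      have h := this.comp_neg
      refine h.congr (Filter.Eventually.of_forall fun z => ?_)
      simp only [indicator]
      have : (-z ∈ ball (-a) ρ) ↔ z ∈ ball a ρ := by
        simp only [mem_ball, dist_eq_norm]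
        rw [← norm_neg (z - a)]
        have : -z - -a = -(z - a) := by abel
        rw [this]
      simp [this]
    set F := indicator (ball a ρ) (gradN d) with hF
    have hFi : Integrable F := (integrable_indicator_iff measurableSet_ball).2 hi0
    have hFn : Integrable (fun z => F (-z)) := hFi.comp_neg
    have h1 : ∫ z in ball a ρ, gradN d z = (2:ℝ)⁻¹ • ∫ z, (F z + F (-z)) := by
      rw [integral_add hFi hFn, integral_neg_eq_self F volume, ← two_smul ℝ, smul_smul,
        integral_indicator measurableSet_ball]
      norm_num
    rw [h1, integral_polar volume _ (show Integrable (fun z => F z + F (-z)) from hFi.add hFn)]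
    have h2 : ∀ ω : sphere (0:EuclideanSpace ℝ (Fin d)) 1, (∫ r in Ioi (0:ℝ),
      r ^ (Module.finrank ℝ (EuclideanSpace ℝ (Fin d)) - 1) •
        (F (r • (ω : EuclideanSpace ℝ (Fin d))) + F (-(r • (ω : EuclideanSpace ℝ (Fin d))))))
        = (2 * (sphereVol d)⁻¹) • ((⟪a, (ω:EuclideanSpace ℝ (Fin d))⟫) • (ω:EuclideanSpace ℝ (Fin d))) := by
      intro ω
      have hω : ‖(ω : EuclideanSpace ℝ (Fin d))‖ = 1 := by simp
      generalize (ω : EuclideanSpace ℝ (Fin d)) = w at hω ⊢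
      set b := ⟪a, w⟫ with hb
      set q := Real.sqrt (b ^ 2 + (ρ ^ 2 - ‖a‖ ^ 2)) with hq
      have hρ : 0 < ρ := (norm_nonneg a).trans_lt ha
      have hpos : 0 < ρ ^ 2 - ‖a‖ ^ 2 := by nlinarith [norm_nonneg a]
      have hq2 : q ^ 2 = b ^ 2 + (ρ ^ 2 - ‖a‖ ^ 2) := Real.sq_sqrt (by positivity)
      have hq0 : 0 ≤ q := Real.sqrt_nonneg _
      have hqb : |b| < q := by
        apply abs_lt_of_sq_lt_sq _ hq0
        nlinarith
      obtain ⟨hqb1, hqb2⟩ := abs_lt.1 hqb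
      have e1 : ∀ r ∈ Ioi (0:ℝ), r ^ (Module.finrank ℝ (EuclideanSpace ℝ (Fin d)) - 1) •
          (F (r • w) + F (-(r • w))) =
          ((Ioo 0 (b + q)).indicator (fun _ => (1:ℝ)) r - (Ioo 0 (-b + q)).indicator (fun _ => (1:ℝ)) r) •
            ((sphereVol d)⁻¹ • w) := by
        intro r hr
        have hr0 : 0 < r := hr
        have m1 := ray_mem_ball_iff a w hω ρ ha r hr
        have m2 := ray_mem_ball_iff a (-w) (by rw [norm_neg, hω]) ρ ha r hr
        rw [smul_neg, inner_neg_right, neg_sq, ← hb, ← hq] at m2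
        rw [← hb, ← hq] at m1
        have hk : r ^ (Module.finrank ℝ (EuclideanSpace ℝ (Fin d)) - 1) • gradN d (r • w)
            = (sphereVol d)⁻¹ • w := by
          rw [gradN_smul d r hr, smul_smul, finrank_euclideanSpace_fin, gradN, hω, one_pow, mul_one]
          have : r ^ (d - 1) * (r * (r ^ d)⁻¹) = 1 := by
            have : r ^ d = r ^ (d - 1) * r := by rw [← pow_succ]; congr 1; omega
            rw [this]; field_simp
          rw [this, one_smul]
        rw [smul_add]
        have p1 : r ^ (Module.finrank ℝ (EuclideanSpace ℝ (Fin d)) - 1) • F (r • w) =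
            (Ioo 0 (b + q)).indicator (fun _ => (1:ℝ)) r • ((sphereVol d)⁻¹ • w) := by
          by_cases h : r < b + q
          · rw [hF, indicator_of_mem (m1.2 h), indicator_of_mem (show r ∈ Ioo 0 (b+q) from ⟨hr, h⟩), hk,
              one_smul]
          · rw [hF, indicator_of_notMem (fun h' => h (m1.1 h')),
              indicator_of_notMem (fun h' : r ∈ Ioo 0 (b+q) => h h'.2)]
            simp
        have p2 : r ^ (Module.finrank ℝ (EuclideanSpace ℝ (Fin d)) - 1) • F (-(r • w)) =
            - ((Ioo 0 (-b + q)).indicator (fun _ => (1:ℝ)) r • ((sphereVol d)⁻¹ • w)) := by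
          by_cases h : r < -b + q
          · rw [hF, indicator_of_mem (m2.2 h), indicator_of_mem (show r ∈ Ioo 0 (-b+q) from ⟨hr, h⟩),
              gradN_neg, smul_neg, hk, one_smul]
          · rw [hF, indicator_of_notMem (fun h' => h (m2.1 h')),
              indicator_of_notMem (fun h' : r ∈ Ioo 0 (-b+q) => h h'.2)]
            simp
        rw [p1, p2, sub_smul, sub_eq_add_neg]
      have hind : ∀ t : ℝ, 0 ≤ t → Integrable ((Ioo 0 t).indicator (fun _ => (1:ℝ))) ∧
          ∫ r in Ioi (0:ℝ), (Ioo 0 t).indicator (fun _ => (1:ℝ)) r = t := by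
        intro t ht
        refine ⟨(integrable_indicator_iff measurableSet_Ioo).2 (by simp), ?_⟩
        rw [setIntegral_indicator measurableSet_Ioo]
        have : Ioi (0:ℝ) ∩ Ioo 0 t = Ioo 0 t := by
          ext r; simp only [mem_inter_iff, mem_Ioi, mem_Ioo]; tauto
        rw [this]; simp [ht]
      have i1 := hind (b + q) (by linarith)
      have i2 := hind (-b + q) (by linarith)
      rw [setIntegral_congr_fun measurableSet_Ioi e1, integral_smul_const,
        integral_sub i1.1.integrableOn i2.1.integrableOn, i1.2, i2.2, smul_smul, smul_smul]
      congr 1; ring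
    simp_rw [h2]
    rw [integral_smul, smul_smul]
    congr 1
    ring

theorem newton_ball (d : ℕ) (hd : 2 ≤ d) : ∃ L : EuclideanSpace ℝ (Fin d) →L[ℝ] EuclideanSpace ℝ (Fin d),
    ∀ (c x : EuclideanSpace ℝ (Fin d)) (ρ : ℝ), x ∈ ball c ρ →
      ∫ w in ball c ρ, gradN d (x - w) = L (x - c) := by
  obtain ⟨L, hL⟩ := newton_origin d hd
  refine ⟨LinearMap.toContinuousLinearMap L, ?_⟩
  intro c x ρ hx
  rw [mem_ball, dist_eq_norm] at hx
  simp only [LinearMap.coe_toContinuousLinearMap']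
  rw [← hL (x - c) ρ hx, ← integral_indicator measurableSet_ball, ← integral_indicator measurableSet_ball,
    ← integral_sub_left_eq_self _ volume x]
  congr 1
  funext w
  have : (x - w ∈ ball c ρ) ↔ w ∈ ball (x - c) ρ := by
    simp only [mem_ball, dist_eq_norm]
    rw [← norm_neg]
    have : -(x - w - c) = w - (x - c) := by abel
    rw [this]
  by_cases h : x - w ∈ ball c ρ
  · rw [indicator_of_mem h, indicator_of_mem (this.1 h), sub_sub_cancel]
  · rw [indicator_of_notMem h, indicator_of_notMem (fun h' => h (this.2 h'))]

end part3

section part4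

/-- Quantitative two-sided cusp condition at every boundary point, with normal field `n`. -/
def PN {E : Type*} [NormedAddCommGroup E] [InnerProductSpace ℝ E] (γ A : ℝ) (G : Set E)
    (n : E → E) : Prop :=
  ∀ p ∈ frontier G, ‖n p‖ = 1 ∧ ∀ y, (⟪y - p, n p⟫ < -(A * ‖y - p‖ ^ (1 + γ)) → y ∈ G) ∧
    (A * ‖y - p‖ ^ (1 + γ) < ⟪y - p, n p⟫ → y ∉ G)

section geom
variable {E : Type*} [NormedAddCommGroup E] [InnerProductSpace ℝ E] {γ A : ℝ} {G : Set E} {n : E → E}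

theorem rpow_one_add_le {γ a b : ℝ} (hγ : 0 < γ) (ha : 0 ≤ a) (hab : a ≤ b) :
    a ^ (1 + γ) ≤ b * b ^ γ := by
  rcases ha.eq_or_lt with h | h
  · rw [← h, Real.zero_rpow (by linarith)]
    have hb : 0 ≤ b := ha.trans hab
    positivity
  · rw [← Real.rpow_one_add' (h.le.trans hab) (by linarith)]
    exact Real.rpow_le_rpow ha hab (by linarith)

theorem PN.normals_close (hG : PN γ A G n) (hγ : 0 < γ) (hA : 0 ≤ A) {r0 : ℝ} (hr0 : A * (17 * r0) ^ γ ≤ 1 / 6)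
    {p q : E} (hp : p ∈ frontier G) (hq : q ∈ frontier G) (hpq : ‖p - q‖ ≤ r0) :
    1 / 2 ≤ ⟪n p, n q⟫ := by
  obtain ⟨hnp, hp'⟩ := hG p hp
  obtain ⟨hnq, hq'⟩ := hG q hq
  by_contra hc
  push Not at hc
  rcases (norm_nonneg (p - q)).eq_or_lt with h0 | h0
  · have : p = q := by rw [← sub_eq_zero, ← norm_eq_zero]; exact h0.symm
    subst this
    rw [real_inner_self_eq_norm_sq, hnp] at hc
    norm_num at hc
  set r := ‖p - q‖ with hr
  set c := ⟪n p, n q⟫ with hcdef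
  have hAr : A * (17 * r) ^ γ ≤ 1 / 6 := by
    refine le_trans ?_ hr0
    gcongr
  set y := p + (8 * r) • (n q - n p) with hy
  have e1 : y - p = (8 * r) • (n q - n p) := by rw [hy]; abel
  have e2 : y - q = (p - q) + (8 * r) • (n q - n p) := by rw [hy]; abel
  have b0 : ‖n q - n p‖ ≤ 2 := by
    calc _ ≤ ‖n q‖ + ‖n p‖ := norm_sub_le _ _
      _ = 2 := by rw [hnp, hnq]; norm_num
  have b1 : ‖(8 * r) • (n q - n p)‖ ≤ 16 * r := by
    rw [norm_smul, Real.norm_of_nonneg (by positivity)]; nlinarith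
  have b2 : ‖y - p‖ ≤ 17 * r := by rw [e1]; linarith
  have b3 : ‖y - q‖ ≤ 17 * r := by
    rw [e2]; calc _ ≤ ‖p - q‖ + ‖(8 * r) • (n q - n p)‖ := norm_add_le _ _
      _ ≤ _ := by linarith
  have key : ∀ t : ℝ, 0 ≤ t → t ≤ 17 * r → A * t ^ (1 + γ) ≤ 17 / 6 * r := by
    intro t ht ht'
    calc A * t ^ (1 + γ) ≤ A * (17 * r * (17 * r) ^ γ) := by
          gcongr; exact rpow_one_add_le hγ ht ht'
      _ = 17 * r * (A * (17 * r) ^ γ) := by ring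
      _ ≤ 17 * r * (1 / 6) := by gcongr
      _ = _ := by ring
  have hin : y ∈ G := by
    apply (hp' y).1
    have := key _ (norm_nonneg _) b2
    have e : ⟪y - p, n p⟫ = 8 * r * (c - 1) := by
      rw [e1, inner_smul_left, inner_sub_left, real_inner_self_eq_norm_sq, hnp, real_inner_comm]
      simp [hcdef]
    rw [e]; nlinarith
  have hout : y ∉ G := by
    apply (hq' y).2
    have := key _ (norm_nonneg _) b3
    have e : ⟪y - q, n q⟫ = ⟪p - q, n q⟫ + 8 * r * (1 - c) := by
      rw [e2, inner_add_left, inner_smul_left, inner_sub_left (n q), real_inner_self_eq_norm_sq, hnq]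
      simp [hcdef]
    have h3 : -r ≤ ⟪p - q, n q⟫ := by
      have := abs_real_inner_le_norm (p - q) (n q)
      rw [hnq, mul_one] at this
      exact (abs_le.1 this).1
    rw [e]; nlinarith
  exact hout hin

/-- Segments leaving a point of `G` in a uniformly inward direction stay in `G`. -/
theorem PN.ray_mem (hG : PN γ A G n) (hGo : IsOpen G) (hγ : 0 < γ) {x v : E} (hx : x ∈ G)
    (hv : ∀ s ∈ Icc (0:ℝ) 1, x + s • v ∈ frontier G → ⟪v, n (x + s • v)⟫ < 0) :
    ∀ s ∈ Icc (0:ℝ) 1, x + s • v ∈ G := by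
  by_contra hcon
  push Not at hcon
  obtain ⟨s1, hs1, hs1'⟩ := hcon
  have hcont : Continuous (fun s : ℝ => x + s • v) := by fun_prop
  set S : Set ℝ := Icc 0 1 ∩ (fun s : ℝ => x + s • v) ⁻¹' Gᶜ with hS
  have hSc : IsCompact S := isCompact_Icc.inter_right (hGo.isClosed_compl.preimage hcont)
  obtain ⟨s, hs, hmin⟩ := hSc.exists_isLeast ⟨s1, hs1, hs1'⟩
  have hsG : x + s • v ∉ G := hs.2
  have hs0 : 0 < s := by
    rcases hs.1.1.eq_or_lt with h | h
    · exfalso; apply hsG; rw [← h]; simpa using hx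
    · exact h
  have hbelow : ∀ t ∈ Ico (0:ℝ) s, x + t • v ∈ G := by
    intro t ht
    by_contra h
    have : t ∈ S := ⟨⟨ht.1, ht.2.le.trans hs.1.2⟩, h⟩
    exact absurd (hmin this) (not_le.2 ht.2)
  have hfr : x + s • v ∈ frontier G := by
    rw [hGo.frontier_eq]
    refine ⟨?_, hsG⟩
    have h1 : s ∈ closure (Ico (0:ℝ) s) := by
      rw [closure_Ico hs0.ne]; exact ⟨hs0.le, le_rfl⟩
    exact map_mem_closure (f := fun s : ℝ => x + s • v) hcont h1 hbelow
  have hneg := hv s hs.1 hfr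
  set q := x + s • v with hq
  set c := -⟪v, n q⟫ with hc
  have hc0 : 0 < c := by rw [hc]; linarith
  have hv0 : 0 < ‖v‖ := by
    rw [norm_pos_iff]; rintro rfl; simp at hneg
  have hlim : Filter.Tendsto (fun τ : ℝ => A * ‖v‖ ^ (1 + γ) * τ ^ γ) (nhdsWithin 0 (Ioi 0)) (nhds 0) := by
    have : Filter.Tendsto (fun τ : ℝ => A * ‖v‖ ^ (1 + γ) * τ ^ γ) (nhds 0) (nhds (A * ‖v‖ ^ (1 + γ) * 0 ^ γ)) := by
      apply Filter.Tendsto.const_mul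
      exact (Real.continuousAt_rpow_const _ _ (Or.inr hγ.le)).tendsto
    rw [Real.zero_rpow hγ.ne', mul_zero] at this
    exact this.mono_left nhdsWithin_le_nhds
  have h1 : ∀ᶠ τ in nhdsWithin (0:ℝ) (Ioi 0), A * ‖v‖ ^ (1 + γ) * τ ^ γ < c := hlim.eventually (gt_mem_nhds hc0)
  have h2 : ∀ᶠ τ in nhdsWithin (0:ℝ) (Ioi 0), τ ∈ Ioo 0 s := Ioo_mem_nhdsGT hs0
  obtain ⟨τ, hτ1, hτ2, hτ3⟩ := (h1.and h2).exists
  have hmem := hbelow (s - τ) ⟨by linarith, by linarith⟩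
  have hd : x + (s - τ) • v - q = (-τ) • v := by rw [hq]; module
  refine ((hG q hfr).2 (x + (s - τ) • v)).2 ?_ hmem
  rw [hd, norm_smul, inner_smul_left, Real.norm_eq_abs, abs_neg, abs_of_pos hτ2, Real.mul_rpow hτ2.le hv0.le,
    Real.rpow_one_add' hτ2.le (by linarith)]
  simp only [conj_trivial]
  calc A * (τ * τ ^ γ * ‖v‖ ^ (1 + γ)) = τ * (A * ‖v‖ ^ (1 + γ) * τ ^ γ) := by ring
    _ < τ * c := by gcongr
    _ = -τ * ⟪v, n q⟫ := by rw [hc]; ring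

theorem precon_frontier {X : Type*} [TopologicalSpace X] {s G : Set X} (hs : IsPreconnected s)
    (h1 : (s ∩ G).Nonempty) (h2 : (s ∩ Gᶜ).Nonempty) : (s ∩ frontier G).Nonempty := by
  by_contra hcon
  rw [not_nonempty_iff_eq_empty] at hcon
  have hnf : ∀ z ∈ s, z ∉ frontier G := fun z hz hz' => by
    have : z ∈ s ∩ frontier G := ⟨hz, hz'⟩
    rw [hcon] at this; exact this
  have hcov : ∀ z ∈ s, z ∈ interior G ∨ z ∈ (closure G)ᶜ := by
    intro z hz
    by_cases hc : z ∈ closure G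
    · left
      by_contra hi
      exact hnf z hz ⟨hc, hi⟩
    · right; exact hc
  obtain ⟨x, hx, hxG⟩ := h1
  obtain ⟨y, hy, hyG⟩ := h2
  obtain ⟨z, -, hz1, hz2⟩ := hs _ _ isOpen_interior isClosed_closure.isOpen_compl hcov
    ⟨x, hx, (hcov x hx).resolve_right (fun h => h (subset_closure hxG))⟩
    ⟨y, hy, (hcov y hy).resolve_left (fun h => hyG (interior_subset h))⟩
  exact hz2 (subset_closure (interior_subset hz1))

theorem ball_infDist_subset {E : Type*} [NormedAddCommGroup E] [NormedSpace ℝ E] {G : Set E} {x : E} (hx : x ∈ G)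
    {r : ℝ} (hr : r ≤ infDist x (frontier G)) : ball x r ⊆ G := by
  rcases le_or_gt r 0 with h | h
  · rw [ball_eq_empty.2 h]; exact empty_subset _
  intro y hy
  by_contra hyG
  have hpc : IsPreconnected (ball x r) := (convex_ball x r).isPreconnected
  obtain ⟨z, hz1, hz2⟩ := precon_frontier hpc ⟨x, mem_ball_self h, hx⟩ ⟨y, hy, hyG⟩
  have := infDist_le_dist_of_mem (x := x) hz2
  rw [mem_ball, dist_comm] at hz1
  linarith

theorem le_infDist_frontier {E : Type*} [NormedAddCommGroup E] [NormedSpace ℝ E] {G : Set E} {x : E}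
    (hGo : IsOpen G) (hne : (frontier G).Nonempty)
    {r : ℝ} (hr : ball x r ⊆ G) : r ≤ infDist x (frontier G) := by
  rw [le_infDist hne]
  intro y hy
  by_contra h
  push Not at h
  have : y ∈ G := hr (by rwa [mem_ball, dist_comm])
  rw [hGo.frontier_eq] at hy
  exact hy.2 this

/-- Uniform-domain property. -/
theorem PN.cone (hG : PN γ A G n) (hGo : IsOpen G) (hγ : 0 < γ) (hA : 0 ≤ A) [ProperSpace E]
    (hne : (frontier G).Nonempty) {r0 h : ℝ}
    (hr0 : A * (17 * r0) ^ γ ≤ 1 / 6) (h0 : 0 < h) (hh : 13 * h ≤ r0) {x y : E} (hx : x ∈ G) (hy : y ∈ G)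
    (hxy : ‖x - y‖ ≤ h) :
    ∃ z, ‖z - x‖ ≤ 9 * h ∧ ‖z - y‖ ≤ 9 * h ∧ (∀ s ∈ Icc (0:ℝ) 1, ball (x + s • (z - x)) (s * h) ⊆ G) ∧
      (∀ s ∈ Icc (0:ℝ) 1, ball (y + s • (z - y)) (s * h) ⊆ G) := by
  have hyx : ‖y - x‖ ≤ h := by rw [norm_sub_rev]; exact hxy
  rcases le_or_gt (2 * h) (infDist y (frontier G)) with hdeep | hsh
  · have hb := ball_infDist_subset hy hdeep
    refine ⟨y, by linarith, by simp; positivity, ?_, ?_⟩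
    · intro s hs w hw
      apply hb
      rw [mem_ball, dist_eq_norm] at hw ⊢
      have e : w - y = (w - (x + s • (y - x))) + (1 - s) • (x - y) := by module
      rw [e]
      calc _ ≤ ‖w - (x + s • (y - x))‖ + ‖(1 - s) • (x - y)‖ := norm_add_le _ _
        _ < s * h + (1 - s) * h := by
            rw [norm_smul, Real.norm_of_nonneg (by linarith [hs.2])]
            have : (1 - s) * ‖x - y‖ ≤ (1 - s) * h := by gcongr; linarith [hs.2]
            linarith
        _ ≤ 2 * h := by linarith
    · intro s hs w hw
      apply hb
      rw [mem_ball, dist_eq_norm] at hw ⊢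
      simp only [sub_self, smul_zero, add_zero] at hw
      nlinarith [hs.2]
  · obtain ⟨p, hp, hpd⟩ := isClosed_frontier.exists_infDist_eq_dist hne y
    rw [hpd, dist_eq_norm] at hsh
    have hnp := (hG p hp).1
    have main : ∀ x' u : E, x' ∈ G → ‖x' - p‖ ≤ 3 * h → ‖u‖ < 2 * h → ∀ s ∈ Icc (0:ℝ) 1,
        x' + s • (-((8 * h) • n p) + u) ∈ G := by
      intro x' u hx' hxp hu
      apply hG.ray_mem hGo hγ hx'
      intro s hs hfr
      have hv : ‖-((8 * h) • n p) + u‖ ≤ 10 * h := by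
        calc _ ≤ ‖-((8 * h) • n p)‖ + ‖u‖ := norm_add_le _ _
          _ ≤ _ := by
            rw [norm_neg, norm_smul, hnp, Real.norm_of_nonneg (by positivity)]; linarith
      have hd : ‖p - (x' + s • (-((8 * h) • n p) + u))‖ ≤ r0 := by
        have e : p - (x' + s • (-((8 * h) • n p) + u)) = -(x' - p) - s • (-((8 * h) • n p) + u) := by abel
        rw [e]
        calc _ ≤ ‖-(x' - p)‖ + ‖s • (-((8 * h) • n p) + u)‖ := norm_sub_le _ _
          _ ≤ 3 * h + 10 * h := by
            rw [norm_neg, norm_smul, Real.norm_of_nonneg hs.1]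
            have : s * ‖-((8 * h) • n p) + u‖ ≤ 1 * (10 * h) := by gcongr; exact hs.2
            linarith
          _ ≤ r0 := by linarith
      have hc := hG.normals_close hγ hA hr0 hp hfr hd
      have hnq := (hG _ hfr).1
      set q := x' + s • (-((8 * h) • n p) + u)
      rw [inner_add_left, inner_neg_left, inner_smul_left]
      simp only [conj_trivial]
      have : ⟪u, n q⟫ ≤ ‖u‖ := by
        have := real_inner_le_norm u (n q)
        rwa [hnq, mul_one] at this
      nlinarith
    have hxp : ‖x - p‖ ≤ 3 * h := by
      calc ‖x - p‖ = ‖(x - y) + (y - p)‖ := by congr 1; abel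
        _ ≤ ‖x - y‖ + ‖y - p‖ := norm_add_le _ _
        _ ≤ _ := by linarith
    have cone : ∀ x' : E, x' ∈ G → ‖x' - p‖ ≤ 3 * h → ‖y - x'‖ ≤ h → ∀ s ∈ Icc (0:ℝ) 1,
        ball (x' + s • ((y - (8 * h) • n p) - x')) (s * h) ⊆ G := by
      intro x' hx' hxp' hyx' s hs w hw
      rcases hs.1.eq_or_lt with h' | h'
      · rw [← h', zero_mul, ball_zero] at hw; exact hw.elim
      rw [mem_ball, dist_eq_norm] at hw
      set v := s⁻¹ • (w - (x' + s • ((y - (8 * h) • n p) - x'))) with hvdef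
      have hv : ‖v‖ < h := by
        rw [hvdef, norm_smul, norm_inv, Real.norm_of_nonneg h'.le, inv_mul_lt_iff₀ h']; exact hw
      have := main x' ((y - x') + v) hx' hxp' (by
        calc _ ≤ ‖y - x'‖ + ‖v‖ := norm_add_le _ _
          _ < _ := by linarith) s hs
      convert this using 1
      have : w = x' + s • ((y - (8 * h) • n p) - x') + s • v := by
        rw [hvdef, smul_smul, mul_inv_cancel₀ h'.ne', one_smul]; abel
      rw [this]; module
    refine ⟨y - (8 * h) • n p, ?_, ?_, cone x hx hxp hyx, cone y hy (by linarith) (by simp [h0.le])⟩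
    · have e : y - (8 * h) • n p - x = (y - x) - (8 * h) • n p := by abel
      rw [e]
      calc _ ≤ ‖y - x‖ + ‖(8 * h) • n p‖ := norm_sub_le _ _
        _ ≤ _ := by rw [norm_smul, hnp, Real.norm_of_nonneg (by positivity)]; linarith
    · have e : y - (8 * h) • n p - y = - ((8 * h) • n p) := by abel
      rw [e, norm_neg, norm_smul, hnp, Real.norm_of_nonneg (by positivity)]; linarith

/-- The nearest boundary point lies in the direction of the normal. -/
theorem PN.nearest (hG : PN γ A G n) (hγ : 0 < γ) {x p : E} {δ : ℝ} (hδ : 0 < δ)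
    (hb : ball x δ ⊆ G) (hp : p ∈ frontier G) (hxp : ‖x - p‖ = δ) : x = p - δ • n p := by
  obtain ⟨hnp, hp'⟩ := hG p hp
  by_contra hne
  set a := x - p with ha
  set u := a + δ • n p with hu
  have hu0 : 0 < ‖u‖ := by
    rw [norm_pos_iff]
    intro h
    apply hne
    rw [hu, ha] at h
    rw [eq_sub_iff_add_eq, ← sub_eq_zero, ← h]; abel
  have e1 : ‖u‖ ^ 2 = 2 * δ ^ 2 + 2 * δ * ⟪a, n p⟫ := by
    rw [hu, norm_add_sq_real, hxp, norm_smul, hnp, inner_smul_right, Real.norm_of_nonneg hδ.le]; ring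
  have e2 : ⟪u, a⟫ = ‖u‖ ^ 2 / 2 := by
    rw [e1, hu, inner_add_left, real_inner_self_eq_norm_sq, hxp, inner_smul_left, real_inner_comm]
    simp only [conj_trivial]; ring
  have e3 : δ * ⟪u, n p⟫ = ‖u‖ ^ 2 / 2 := by
    rw [e1, hu, inner_add_left, inner_smul_left, real_inner_self_eq_norm_sq, hnp]
    simp only [conj_trivial]; ring
  have hc0 : 0 < ⟪u, n p⟫ := by
    by_contra h
    push Not at h
    nlinarith [pow_pos hu0 2]
  have hlim : Filter.Tendsto (fun τ : ℝ => A * ‖u‖ ^ (1 + γ) * τ ^ γ) (nhdsWithin 0 (Ioi 0)) (nhds 0) := by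
    have : Filter.Tendsto (fun τ : ℝ => A * ‖u‖ ^ (1 + γ) * τ ^ γ) (nhds 0) (nhds (A * ‖u‖ ^ (1 + γ) * 0 ^ γ)) := by
      apply Filter.Tendsto.const_mul
      exact (Real.continuousAt_rpow_const _ _ (Or.inr hγ.le)).tendsto
    rw [Real.zero_rpow hγ.ne', mul_zero] at this
    exact this.mono_left nhdsWithin_le_nhds
  have h1 : ∀ᶠ τ in nhdsWithin (0:ℝ) (Ioi 0), A * ‖u‖ ^ (1 + γ) * τ ^ γ < ⟪u, n p⟫ := hlim.eventually (gt_mem_nhds hc0)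
  have h2 : ∀ᶠ τ in nhdsWithin (0:ℝ) (Ioi 0), τ ∈ Ioo 0 (1:ℝ) := Ioo_mem_nhdsGT one_pos
  obtain ⟨τ, hτ1, hτ2, hτ3⟩ := (h1.and h2).exists
  have hmem : p + τ • u ∈ G := by
    apply hb
    rw [mem_ball, dist_eq_norm, ← sq_lt_sq₀ (norm_nonneg _) hδ.le]
    have : p + τ • u - x = τ • u - a := by rw [ha]; abel
    rw [this, norm_sub_sq_real, norm_smul, inner_smul_left, e2, hxp, Real.norm_of_nonneg hτ2.le]
    simp only [conj_trivial]
    have : 0 < ‖u‖ ^ 2 * τ := by positivity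
    nlinarith
  refine (hp' (p + τ • u)).2 ?_ hmem
  rw [add_sub_cancel_left, norm_smul, inner_smul_left, Real.norm_of_nonneg hτ2.le, Real.mul_rpow hτ2.le hu0.le,
    Real.rpow_one_add' hτ2.le (by linarith)]
  simp only [conj_trivial]
  calc A * (τ * τ ^ γ * ‖u‖ ^ (1 + γ)) = τ * (A * ‖u‖ ^ (1 + γ) * τ ^ γ) := by ring
    _ < τ * ⟪u, n p⟫ := by gcongr

/-- The symmetric difference with the tangent ball lies in a thin slab. -/
theorem PN.slab (hG : PN γ A G n) (hγ : γ ∈ Ioo (0:ℝ) 1) (hA : 0 ≤ A) {p w : E} (hp : p ∈ frontier G) {r : ℝ}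
    (hw : ‖w - p‖ ≤ r) (hr : r ≤ 1) (hdiff : (w ∈ G ∧ w ∉ ball (p - n p) 1) ∨ (w ∉ G ∧ w ∈ ball (p - n p) 1)) :
    |⟪w - p, n p⟫| ≤ (A + 1) * r ^ (1 + γ) := by
  obtain ⟨hnp, hp'⟩ := hG p hp
  have h0 : 0 ≤ ‖w - p‖ := norm_nonneg _
  have hball : w ∈ ball (p - n p) 1 ↔ ‖w - p‖ ^ 2 + 2 * ⟪w - p, n p⟫ < 0 := by
    rw [mem_ball, dist_eq_norm, ← sq_lt_sq₀ (norm_nonneg _) zero_le_one]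
    have : w - (p - n p) = (w - p) + n p := by abel
    rw [this, norm_add_sq_real, hnp]
    constructor <;> intro h <;> linarith
  have h1 : ‖w - p‖ ^ (1 + γ) ≤ r ^ (1 + γ) := Real.rpow_le_rpow h0 hw (by linarith [hγ.1])
  have h2 : ‖w - p‖ ^ 2 ≤ r ^ (1 + γ) := by
    have : ‖w - p‖ ^ (2:ℝ) ≤ ‖w - p‖ ^ (1 + γ) :=
      Real.rpow_le_rpow_of_exponent_ge' h0 (hw.trans hr) (by linarith [hγ.1]) (by linarith [hγ.2])
    rw [Real.rpow_two] at this
    exact this.trans h1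
  have hr0 : 0 ≤ r ^ (1 + γ) := Real.rpow_nonneg (h0.trans hw) _
  have h3 : A * ‖w - p‖ ^ (1 + γ) ≤ A * r ^ (1 + γ) := by gcongr
  have h4 : 0 ≤ A * r ^ (1 + γ) := by positivity
  have h5 : 0 ≤ A * ‖w - p‖ ^ (1 + γ) := by positivity
  rw [hball] at hdiff
  by_contra hcon
  push Not at hcon
  rcases lt_abs.1 hcon with h | h
  · have hnot := (hp' w).2 (by linarith)
    rcases hdiff with h' | h'
    · exact hnot h'.1
    · nlinarith [h'.2, sq_nonneg ‖w - p‖]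
  · have hin := (hp' w).1 (by linarith)
    rcases hdiff with h' | h'
    · apply h'.2; linarith
    · exact h'.1 hin

end geom

end part4

section part5

/-- Whitney-type `C^{1,γ}` control of `f` with derivative `A` on the set `S`. -/
def WW {E F : Type*} [NormedAddCommGroup E] [NormedSpace ℝ E] [NormedAddCommGroup F] [NormedSpace ℝ F]
    (γ M : ℝ) (S : Set E) (f : E → F) (A : E → E →L[ℝ] F) : Prop :=
  ∀ x ∈ S, ‖f x‖ ≤ M ∧ ‖A x‖ ≤ M ∧ ∀ y ∈ S, ‖A x - A y‖ ≤ M * ‖x - y‖ ^ γ ∧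
    ‖f x - f y - A y (x - y)‖ ≤ M * ‖x - y‖ ^ (1 + γ)

section chain
variable {E F : Type*} [NormedAddCommGroup E] [InnerProductSpace ℝ E] [NormedAddCommGroup F] [NormedSpace ℝ F]
  {γ A M R2 : ℝ} {G : Set E} {n : E → E} {f : E → F} {c : E}

/-- interior regularity with blow-up at the boundary -/
def IntReg (γ M : ℝ) (G : Set E) (c : E) (R2 : ℝ) (f : E → F) : Prop :=
  ∀ x ∈ G ∩ ball c R2, ∀ z, ‖z - x‖ ≤ min (infDist x (frontier G)) 1 / 2 →
    DifferentiableAt ℝ f z ∧ ‖fderiv ℝ f z‖ ≤ M ∧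
    ‖fderiv ℝ f z - fderiv ℝ f x‖ ≤ M * (min (infDist x (frontier G)) 1) ^ (γ - 1) * ‖z - x‖

theorem chain_const_pos (hγ : γ ∈ Ioo (0:ℝ) 1) : 0 < 1 - (17 / 18 : ℝ) ^ γ := by
  have := Real.rpow_lt_one (by norm_num : (0:ℝ) ≤ 17 / 18) (by norm_num) hγ.1
  linarith

theorem IntReg.chain (hf : IntReg γ M G c R2 f) (hγ : γ ∈ Ioo (0:ℝ) 1) (hM : 0 ≤ M) (hGo : IsOpen G)
    (hne : (frontier G).Nonempty) {x v : E} {h : ℝ} (hx : x ∈ G) (h0 : 0 < h) (h1 : h ≤ 1)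
    (hv : ‖v‖ ≤ 9 * h) (hin : ∀ s ∈ Icc (0:ℝ) 1, ball (x + s • v) (s * h) ⊆ G)
    (hc : ∀ s ∈ Icc (0:ℝ) 1, x + s • v ∈ ball c R2) :
    ∀ s ∈ Icc (0:ℝ) 1, ‖fderiv ℝ f (x + s • v) - fderiv ℝ f x‖ ≤ M / 2 / (1 - (17 / 18 : ℝ) ^ γ) * h ^ γ := by
  intro s hs
  have hθ := chain_const_pos hγ
  rcases hs.1.eq_or_lt with hs0 | hs0
  · rw [← hs0, zero_smul, add_zero, sub_self, norm_zero]; positivity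
  set θ : ℝ := 17 / 18 with hθdef
  have hθ0 : 0 < θ := by norm_num [hθdef]
  set t : ℕ → ℝ := fun k => θ ^ k * s with ht
  have ht0 : ∀ k, 0 < t k := fun k => by positivity
  have ht1 : ∀ k, t k ≤ 1 := fun k => by
    have : θ ^ k ≤ 1 := pow_le_one₀ hθ0.le (by norm_num [hθdef])
    have := mul_le_mul this hs.2 hs0.le zero_le_one
    simpa [ht] using this
  have htm : ∀ k, t k ∈ Icc (0:ℝ) 1 := fun k => ⟨(ht0 k).le, ht1 k⟩
  set a : ℕ → E →L[ℝ] F := fun k => fderiv ℝ f (x + t k • v) with ha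
  have hstep : ∀ k, dist (a k) (a (k + 1)) ≤ (M / 2 * h ^ γ) * (θ ^ γ) ^ k := by
    intro k
    have hp : 0 < t k * h := mul_pos (ht0 k) h0
    have hpG : x + t k • v ∈ G := hin _ (htm k) (mem_ball_self hp)
    set δ := min (infDist (x + t k • v) (frontier G)) 1 with hδ
    have hδ1 : t k * h ≤ δ := by
      apply le_min (le_infDist_frontier hGo hne (hin _ (htm k)))
      calc t k * h ≤ 1 * 1 := by gcongr; exact ht1 k
        _ = 1 := one_mul 1
    have hd : x + t (k + 1) • v - (x + t k • v) = (-(t k / 18)) • v := by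
      have : t (k + 1) = t k - t k / 18 := by simp only [ht, hθdef, pow_succ]; ring
      rw [this]; module
    have hdn : ‖x + t (k + 1) • v - (x + t k • v)‖ ≤ t k * h / 2 := by
      rw [hd, norm_smul, norm_neg, Real.norm_of_nonneg (by have := (ht0 k).le; positivity)]
      have := mul_le_mul_of_nonneg_left hv (ht0 k).le
      linarith
    have := (hf _ ⟨hpG, hc _ (htm k)⟩ (x + t (k + 1) • v) (by rw [← hδ]; linarith)).2.2
    rw [dist_comm, dist_eq_norm]
    refine this.trans ?_
    rw [← hδ]
    have hδp : δ ^ (γ - 1) ≤ (t k * h) ^ (γ - 1) :=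
      Real.rpow_le_rpow_of_nonpos hp hδ1 (by linarith [hγ.2])
    calc M * δ ^ (γ - 1) * ‖x + t (k + 1) • v - (x + t k • v)‖
        ≤ M * (t k * h) ^ (γ - 1) * (t k * h / 2) := by gcongr
      _ = M / 2 * ((t k * h) ^ (γ - 1) * (t k * h)) := by ring
      _ = M / 2 * (t k * h) ^ γ := by
          rw [← Real.rpow_add_one hp.ne']; congr 2; ring
      _ ≤ M / 2 * (θ ^ k * h) ^ γ := by
          gcongr
          · exact hγ.1.le
          · simp only [ht]
            have : 0 < θ ^ k := by positivity
            nlinarith [hs.2]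
      _ = _ := by
          rw [Real.mul_rpow (by positivity) h0.le, ← Real.rpow_natCast, ← Real.rpow_mul hθ0.le,
            ← Real.rpow_natCast, ← Real.rpow_mul hθ0.le, mul_comm (k:ℝ)]; ring
  have hxc : x ∈ ball c R2 := by simpa using hc 0 ⟨le_rfl, zero_le_one⟩
  have hlimt : Filter.Tendsto t Filter.atTop (nhds 0) := by
    have := (tendsto_pow_atTop_nhds_zero_of_lt_one hθ0.le (by norm_num [hθdef] : θ < 1)).mul_const s
    simpa [ht] using this
  have hlim : Filter.Tendsto a Filter.atTop (nhds (fderiv ℝ f x)) := by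
    set δ := min (infDist x (frontier G)) 1 with hδ
    have hδ0 : 0 < δ := by
      apply lt_min _ one_pos
      obtain ⟨r, hr, hr'⟩ := Metric.isOpen_iff.1 hGo x hx
      exact hr.trans_le (le_infDist_frontier hGo hne hr')
    have hn : Filter.Tendsto (fun k => ‖t k • v‖) Filter.atTop (nhds 0) := by
      have := (hlimt.smul_const v).norm
      simpa using this
    rw [tendsto_iff_norm_sub_tendsto_zero]
    have hup : Filter.Tendsto (fun k => M * δ ^ (γ - 1) * ‖t k • v‖) Filter.atTop (nhds 0) := by
      simpa using hn.const_mul (M * δ ^ (γ - 1))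
    refine squeeze_zero' (Filter.Eventually.of_forall fun k => norm_nonneg _) ?_ hup
    filter_upwards [hn.eventually (gt_mem_nhds (by positivity : 0 < δ / 2))] with k hk
    have := (hf x ⟨hx, hxc⟩ (x + t k • v) (by rw [add_sub_cancel_left]; exact hk.le)).2.2
    rwa [add_sub_cancel_left] at this
  have hr : θ ^ γ < 1 := by linarith
  have := dist_le_of_le_geometric_of_tendsto₀ (θ ^ γ) _ hr hstep hlim
  rw [dist_eq_norm] at this
  simp only [ha, ht, pow_zero, one_mul] at this
  refine this.trans (le_of_eq ?_)
  ring

theorem IntReg.whitney (hf : IntReg γ M G c R2 f) (hγ : γ ∈ Ioo (0:ℝ) 1) (hM : 0 ≤ M) (hGo : IsOpen G)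
    (hne : (frontier G).Nonempty) (hG : PN γ A G n) (hA : 0 ≤ A) [ProperSpace E] {r0 h0 R1 : ℝ}
    (hr0 : A * (17 * r0) ^ γ ≤ 1 / 6) (hh : 13 * h0 ≤ r0) (hh1 : h0 ≤ 1) (hR : R1 + 9 * h0 ≤ R2)
    {x y : E} (hx : x ∈ G ∩ ball c R1) (hy : y ∈ G ∩ ball c R1) (hxy : ‖x - y‖ ≤ h0) :
    ‖fderiv ℝ f x‖ ≤ M ∧ ‖f x - f y‖ ≤ 18 * M * ‖x - y‖ ∧
    ‖fderiv ℝ f x - fderiv ℝ f y‖ ≤ 40 * M / (1 - (17 / 18 : ℝ) ^ γ) * ‖x - y‖ ^ γ ∧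
    ‖f x - f y - fderiv ℝ f y (x - y)‖ ≤ 40 * M / (1 - (17 / 18 : ℝ) ^ γ) * ‖x - y‖ ^ (1 + γ) := by
  have hθ := chain_const_pos hγ
  have hxM : x ∈ ball c R2 → ‖fderiv ℝ f x‖ ≤ M := fun h =>
    (hf x ⟨hx.1, h⟩ x (by rw [sub_self, norm_zero]; have : 0 ≤ infDist x (frontier G) := infDist_nonneg; positivity)).2.1
  rcases (norm_nonneg (x - y)).eq_or_lt with h | hpos
  · have : x = y := by rw [← sub_eq_zero, ← norm_eq_zero]; exact h.symm
    subst this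
    have := norm_nonneg (x - x)
    refine ⟨hxM (ball_subset_ball (by linarith) hx.2), ?_⟩
    simp only [sub_self, map_zero, norm_zero, mul_zero, le_refl, true_and]
    constructor <;> positivity
  set h := ‖x - y‖ with hdef
  obtain ⟨z, hzx, hzy, hcx, hcy⟩ := hG.cone hGo hγ.1 hA hne hr0 hpos (by linarith : 13 * h ≤ r0) hx.1 hy.1 le_rfl
  have hball : ∀ x' ∈ ball c R1, ‖z - x'‖ ≤ 9 * h → ∀ s ∈ Icc (0:ℝ) 1, x' + s • (z - x') ∈ ball c R2 := by
    intro x' hx' hzx' s hs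
    rw [mem_ball, dist_eq_norm] at hx' ⊢
    have : x' + s • (z - x') - c = (x' - c) + s • (z - x') := by abel
    rw [this]
    calc _ ≤ ‖x' - c‖ + ‖s • (z - x')‖ := norm_add_le _ _
      _ ≤ ‖x' - c‖ + 1 * (9 * h) := by
          rw [norm_smul, Real.norm_of_nonneg hs.1]; gcongr; exact hs.2
      _ < R2 := by linarith
  set K := M / 2 / (1 - (17 / 18 : ℝ) ^ γ) with hK
  have hK0 : 0 ≤ K := by positivity
  have seg : ∀ x' ∈ G ∩ ball c R1, ‖z - x'‖ ≤ 9 * h → (∀ s ∈ Icc (0:ℝ) 1, ball (x' + s • (z - x')) (s * h) ⊆ G) →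
      ‖fderiv ℝ f z - fderiv ℝ f x'‖ ≤ K * h ^ γ ∧ ‖f z - f x' - fderiv ℝ f x' (z - x')‖ ≤ K * h ^ γ * (9 * h) ∧
      ‖f z - f x'‖ ≤ M * (9 * h) := by
    intro x' hx' hzx' hcone
    have hb := hball x' hx'.2 hzx'
    have hch := hf.chain hγ hM hGo hne hx'.1 hpos (by linarith) hzx' hcone hb
    have hd : ∀ w ∈ segment ℝ x' z, DifferentiableAt ℝ f w ∧ ‖fderiv ℝ f w‖ ≤ M ∧
        ‖fderiv ℝ f w - fderiv ℝ f x'‖ ≤ K * h ^ γ := by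
      intro w hw
      rw [segment_eq_image'] at hw
      obtain ⟨s, hs, rfl⟩ := hw
      have hG' : x' + s • (z - x') ∈ G := by
        rcases hs.1.eq_or_lt with h' | h'
        · rw [← h']; simpa using hx'.1
        · exact hcone s hs (mem_ball_self (by positivity))
      have := hf _ ⟨hG', hb s hs⟩ (x' + s • (z - x')) (by
        rw [sub_self, norm_zero]
        have : 0 ≤ infDist (x' + s • (z - x')) (frontier G) := infDist_nonneg
        positivity)
      exact ⟨this.1, this.2.1, hch s hs⟩
    refine ⟨?_, ?_, ?_⟩
    · exact (hd z (right_mem_segment ℝ _ _)).2.2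
    · refine ((convex_segment x' z).norm_image_sub_le_of_norm_hasFDerivWithin_le' (f := f)
        (f' := fderiv ℝ f) (φ := fderiv ℝ f x') (C := K * h ^ γ)
        (fun w hw => (hd w hw).1.hasFDerivAt.hasFDerivWithinAt) (fun w hw => (hd w hw).2.2)
        (left_mem_segment ℝ _ _) (right_mem_segment ℝ _ _)).trans ?_
      gcongr
    · refine ((convex_segment x' z).norm_image_sub_le_of_norm_hasFDerivWithin_le (f := f)
        (f' := fderiv ℝ f) (C := M)
        (fun w hw => (hd w hw).1.hasFDerivAt.hasFDerivWithinAt) (fun w hw => (hd w hw).2.1)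
        (left_mem_segment ℝ _ _) (right_mem_segment ℝ _ _)).trans ?_
      gcongr
  obtain ⟨a1, a2, a3⟩ := seg x hx hzx hcx
  obtain ⟨b1, b2, b3⟩ := seg y hy hzy hcy
  have hA : ‖fderiv ℝ f x - fderiv ℝ f y‖ ≤ 2 * (K * h ^ γ) := by
    calc _ = ‖(fderiv ℝ f z - fderiv ℝ f y) - (fderiv ℝ f z - fderiv ℝ f x)‖ := by congr 1; abel
      _ ≤ _ := norm_sub_le _ _
      _ ≤ _ := by linarith
  have hKh : 0 ≤ K * h ^ γ := by positivity
  refine ⟨hxM (ball_subset_ball (by linarith) hx.2), ?_, ?_, ?_⟩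
  · calc ‖f x - f y‖ = ‖(f z - f y) - (f z - f x)‖ := by congr 1; abel
      _ ≤ _ := norm_sub_le _ _
      _ ≤ _ := by linarith
  · refine hA.trans ?_
    have : 40 * M / (1 - (17 / 18 : ℝ) ^ γ) = 80 * K := by rw [hK]; ring
    rw [this]; nlinarith
  · have e : f x - f y - fderiv ℝ f y (x - y) = (f z - f y - fderiv ℝ f y (z - y))
        - (f z - f x - fderiv ℝ f x (z - x)) - (fderiv ℝ f x - fderiv ℝ f y) (z - x) := by
      have : x - y = (z - y) - (z - x) := by abel
      rw [this, map_sub, _root_.sub_apply]; abel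
    have h3 : ‖(fderiv ℝ f x - fderiv ℝ f y) (z - x)‖ ≤ 2 * (K * h ^ γ) * (9 * h) := by
      refine (ContinuousLinearMap.le_opNorm _ _).trans ?_
      gcongr
    have : 40 * M / (1 - (17 / 18 : ℝ) ^ γ) = 80 * K := by rw [hK]; ring
    rw [this, e, Real.rpow_one_add' (by positivity) (by linarith [hγ.1])]
    calc _ ≤ ‖(f z - f y - fderiv ℝ f y (z - y)) - (f z - f x - fderiv ℝ f x (z - x))‖
          + ‖(fderiv ℝ f x - fderiv ℝ f y) (z - x)‖ := norm_sub_le _ _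
      _ ≤ (‖f z - f y - fderiv ℝ f y (z - y)‖ + ‖f z - f x - fderiv ℝ f x (z - x)‖)
          + ‖(fderiv ℝ f x - fderiv ℝ f y) (z - x)‖ := by gcongr; exact norm_sub_le _ _
      _ ≤ K * h ^ γ * (9 * h) + K * h ^ γ * (9 * h) + 2 * (K * h ^ γ) * (9 * h) := by gcongr
      _ = 36 * (K * h ^ γ * h) := by ring
      _ ≤ 80 * (K * h ^ γ * h) := by gcongr; norm_num
      _ = _ := by ring
end chain

end part5

section part6

theorem norm_integral_le_of_lint {X F : Type*} [MeasurableSpace X] {μ : Measure X} [NormedAddCommGroup F]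
    [NormedSpace ℝ F] {f : X → F} {B : ℝ} (hB : 0 ≤ B)
    (h : ∫⁻ w, ENNReal.ofReal ‖f w‖ ∂μ ≤ ENNReal.ofReal B) : ‖∫ w, f w ∂μ‖ ≤ B := by
  refine (norm_integral_le_lintegral_norm f).trans ?_
  exact ENNReal.toReal_le_of_le_ofReal hB h

theorem lint_const_mul_le {X : Type*} [MeasurableSpace X] {μ : Measure X} {g : X → ℝ} {c B : ℝ} (hc : 0 ≤ c)
    (h : ∫⁻ w, ENNReal.ofReal (g w) ∂μ ≤ ENNReal.ofReal B) :
    ∫⁻ w, ENNReal.ofReal (c * g w) ∂μ ≤ ENNReal.ofReal (c * B) := by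
  simp_rw [ENNReal.ofReal_mul hc]
  rw [lintegral_const_mul' _ _ ENNReal.ofReal_ne_top]
  gcongr

theorem U_est (d : ℕ) (hd : 2 ≤ d) (γ : ℝ) (hγ : γ ∈ Ioo (0:ℝ) 1) (C R1 : ℝ) (hC : 0 < C) (hR1 : 0 < R1) :
    ∃ M : ℝ, 0 < M ∧ ∀ (T : Set (EuclideanSpace ℝ (Fin d))) (x p : EuclideanSpace ℝ (Fin d)) (δ : ℝ),
      MeasurableSet T → 0 < δ → ‖x - p‖ ≤ δ → p ∉ T → (∀ w ∈ T, δ ≤ ‖w - x‖) → T ⊆ ball p R1 →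
      (∀ r, 0 < r → volume (T ∩ ball p r) ≤ ENNReal.ofReal (C * r ^ ((d:ℝ) + γ))) →
      ∀ z, ‖z - x‖ ≤ δ / 2 →
        HasFDerivAt (fun z => ∫ w in T, gradN d (z - w)) (∫ w in T, fderiv ℝ (gradN d) (z - w)) z ∧
        ‖∫ w in T, fderiv ℝ (gradN d) (z - w)‖ ≤ M ∧
        ‖(∫ w in T, fderiv ℝ (gradN d) (z - w)) - ∫ w in T, fderiv ℝ (gradN d) (x - w)‖
          ≤ M * δ ^ (γ - 1) * ‖z - x‖ := by
  obtain ⟨C0, hC0, -, hdiff, hk1, -, hk2⟩ := kernel_bounds d hd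
  have hd0 : (0:ℝ) < d := by exact_mod_cast (by omega : 0 < d)
  obtain ⟨K1, hK1, hnear⟩ := pk_near (d + γ) d (by linarith [hγ.1]) hd0
  obtain ⟨K2, hK2, hfar⟩ := pk_far (d + γ) (d + 1) (by linarith [hγ.2]) (by linarith)
  set M1 := C0 * 8 ^ (d:ℝ) * (C * K1 * R1 ^ γ) with hM1
  set M2 := C0 * (C + 2 ^ ((d:ℝ) + 1) * (C * K2)) with hM2
  have hM1p : 0 < M1 := by positivity
  have hM2p : 0 < M2 := by positivity
  refine ⟨M1 + M2, by positivity, ?_⟩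
  intro T x p δ hT hδ hxp hpT hTx hTR hvol
  set μ := volume.restrict T with hμ
  have hμball : ∀ r, 0 < r → μ (ball p r) ≤ ENNReal.ofReal (C * r ^ ((d:ℝ) + γ)) := by
    intro r hr
    rw [hμ, Measure.restrict_apply measurableSet_ball, inter_comm]
    exact hvol r hr
  have hae : ∀ᵐ w ∂μ, w ∈ T := ae_restrict_mem hT
  have hL1 : ∫⁻ w, ENNReal.ofReal (‖w - p‖ ^ (-(d:ℝ))) ∂μ ≤ ENNReal.ofReal (C * K1 * R1 ^ γ) := by
    have := hnear μ p C R1 hC.le hR1 (fun r hr _ => hμball r hr)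
    rw [add_sub_cancel_left] at this
    have e : μ.restrict (ball p R1) = μ := by
      rw [hμ, Measure.restrict_restrict measurableSet_ball, inter_eq_self_of_subset_right hTR]
    rwa [e] at this
  have hwp : ∀ w ∈ T, ‖w - p‖ ≤ 2 * ‖w - x‖ := by
    intro w hw
    have h1 := hTx w hw
    calc ‖w - p‖ = ‖(w - x) + (x - p)‖ := by congr 1; abel
      _ ≤ ‖w - x‖ + ‖x - p‖ := norm_add_le _ _
      _ ≤ _ := by linarith
  have hwp0 : ∀ w ∈ T, 0 < ‖w - p‖ := by
    intro w hw
    rw [norm_pos_iff, sub_ne_zero]; rintro rfl; exact hpT hw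
  have hzw : ∀ w ∈ T, ∀ z, ‖z - x‖ ≤ 3 * δ / 4 → ‖w - p‖ / 8 ≤ ‖z - w‖ := by
    intro w hw z hz
    have h1 := hTx w hw
    have h2 := hwp w hw
    have : ‖w - x‖ ≤ ‖z - w‖ + ‖z - x‖ := by
      calc ‖w - x‖ = ‖-(z - w) + (z - x)‖ := by congr 1; abel
        _ ≤ ‖-(z - w)‖ + ‖z - x‖ := norm_add_le _ _
        _ = _ := by rw [norm_neg]
    linarith
  have hne : ∀ w ∈ T, ∀ z, ‖z - x‖ ≤ 3 * δ / 4 → z - w ≠ 0 := by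
    intro w hw z hz
    rw [← norm_pos_iff]
    have := hzw w hw z hz; have := hwp0 w hw
    linarith
  have hbd : ∀ w ∈ T, ∀ z, ‖z - x‖ ≤ 3 * δ / 4 →
      ‖fderiv ℝ (gradN d) (z - w)‖ ≤ C0 * 8 ^ (d:ℝ) * ‖w - p‖ ^ (-(d:ℝ)) := by
    intro w hw z hz
    have h0 := hwp0 w hw
    refine (hk1 _ (hne w hw z hz)).trans ?_
    rw [mul_assoc]
    gcongr
    calc ‖z - w‖ ^ (-(d:ℝ)) ≤ (‖w - p‖ / 8) ^ (-(d:ℝ)) :=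
          Real.rpow_le_rpow_of_nonpos (by positivity) (hzw w hw z hz) (by linarith)
      _ = _ := by
          rw [Real.div_rpow h0.le (by norm_num), Real.rpow_neg (by norm_num : (0:ℝ) ≤ 8), div_inv_eq_mul, mul_comm]
  have hmeasd : ∀ z, AEStronglyMeasurable (fun w => fderiv ℝ (gradN d) (z - w)) μ := by
    intro z
    exact ((measurable_fderiv ℝ (gradN d)).comp (by fun_prop)).aestronglyMeasurable
  have hbint : Integrable (fun w => C0 * 8 ^ (d:ℝ) * ‖w - p‖ ^ (-(d:ℝ))) μ := by
    apply Integrable.const_mul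
    refine ⟨Measurable.aestronglyMeasurable (by fun_prop), ?_⟩
    rw [hasFiniteIntegral_iff_norm]
    refine lt_of_le_of_lt (le_trans (lintegral_mono fun w => ?_) hL1) ENNReal.ofReal_lt_top
    rw [Real.norm_of_nonneg (by positivity)]
  have hintg' : ∀ z, ‖z - x‖ ≤ 3 * δ / 4 → Integrable (fun w => fderiv ℝ (gradN d) (z - w)) μ := by
    intro z hz
    refine hbint.mono' (hmeasd z) ?_
    filter_upwards [hae] with w hw
    exact hbd w hw z hz
  intro z hz
  have hTbd : Bornology.IsBounded T := isBounded_ball.subset hTR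
  refine ⟨?_, ?_, ?_⟩
  · refine hasFDerivAt_integral_of_dominated_of_fderiv_le (ball_mem_nhds z (by positivity : 0 < δ / 4)) ?_ ?_ (hmeasd z)
      (bound := fun w => C0 * 8 ^ (d:ℝ) * ‖w - p‖ ^ (-(d:ℝ))) ?_ hbint ?_ (F := fun z w => gradN d (z - w))
      (F' := fun z w => fderiv ℝ (gradN d) (z - w))
    · exact Filter.Eventually.of_forall fun z' => ((measurable_gradN d).comp (by fun_prop)).aestronglyMeasurable
    · exact integrableOn_gradN d hd z T hTbd
    · filter_upwards [hae] with w hw z' hz'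
      apply hbd w hw
      rw [mem_ball, dist_eq_norm] at hz'
      calc ‖z' - x‖ = ‖(z' - z) + (z - x)‖ := by congr 1; abel
        _ ≤ ‖z' - z‖ + ‖z - x‖ := norm_add_le _ _
        _ ≤ _ := by linarith
    · filter_upwards [hae] with w hw z' hz'
      have hn : z' - w ≠ 0 := by
        apply hne w hw
        rw [mem_ball, dist_eq_norm] at hz'
        calc ‖z' - x‖ = ‖(z' - z) + (z - x)‖ := by congr 1; abel
          _ ≤ ‖z' - z‖ + ‖z - x‖ := norm_add_le _ _
          _ ≤ _ := by linarith
      have := (hdiff _ hn).hasFDerivAt.comp z' ((hasFDerivAt_id z').sub_const w)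
      simpa [Function.comp_def] using this
  · have : ‖∫ w in T, fderiv ℝ (gradN d) (z - w)‖ ≤ M1 := by
      apply norm_integral_le_of_lint hM1p.le
      refine le_trans ?_ (lint_const_mul_le (by positivity : 0 ≤ C0 * 8 ^ (d:ℝ)) hL1)
      apply lintegral_mono_ae
      filter_upwards [hae] with w hw
      exact ENNReal.ofReal_le_ofReal (hbd w hw z (by linarith))
    linarith
  · rw [← integral_sub (hintg' z (by linarith)) (hintg' x (by simp; positivity))]
    have hL2 : ∫⁻ w, ENNReal.ofReal (‖w - x‖ ^ (-((d:ℝ) + 1))) ∂μ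
        ≤ ENNReal.ofReal ((C + 2 ^ ((d:ℝ) + 1) * (C * K2)) * δ ^ (γ - 1)) := by
      rw [← lintegral_add_compl _ (measurableSet_ball : MeasurableSet (ball p δ)), add_mul,
        ENNReal.ofReal_add (by positivity) (by positivity)]
      gcongr
      · have hcst : ∀ᵐ w ∂(μ.restrict (ball p δ)), ENNReal.ofReal (‖w - x‖ ^ (-((d:ℝ) + 1)))
            ≤ ENNReal.ofReal (δ ^ (-((d:ℝ) + 1))) := by
          filter_upwards [ae_restrict_of_ae hae] with w hw
          apply ENNReal.ofReal_le_ofReal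
          exact Real.rpow_le_rpow_of_nonpos hδ (hTx w hw) (by linarith)
        refine (lintegral_mono_ae hcst).trans ?_
        rw [lintegral_const, Measure.restrict_apply_univ]
        calc _ ≤ ENNReal.ofReal (δ ^ (-((d:ℝ) + 1))) * ENNReal.ofReal (C * δ ^ ((d:ℝ) + γ)) := by
              gcongr; exact hμball δ hδ
          _ = _ := by
              rw [← ENNReal.ofReal_mul (by positivity)]
              congr 1
              rw [mul_comm, mul_assoc, ← Real.rpow_add hδ]
              congr 2; ring
      · have h1 := hfar μ p C δ hC.le hδ (fun r hr => hμball r (hδ.trans_le hr))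
        have h2 := lint_const_mul_le (by positivity : (0:ℝ) ≤ 2 ^ ((d:ℝ) + 1)) h1
        refine le_trans ?_ (h2.trans (le_of_eq ?_))
        · apply lintegral_mono_ae
          filter_upwards [ae_restrict_of_ae hae] with w hw
          apply ENNReal.ofReal_le_ofReal
          have h0 := hwp0 w hw
          calc ‖w - x‖ ^ (-((d:ℝ) + 1)) ≤ (‖w - p‖ / 2) ^ (-((d:ℝ) + 1)) :=
                Real.rpow_le_rpow_of_nonpos (by positivity) (by linarith [hwp w hw]) (by linarith)
            _ = _ := by
                rw [Real.div_rpow h0.le (by norm_num), Real.rpow_neg (by norm_num : (0:ℝ) ≤ 2), div_inv_eq_mul, mul_comm]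
        · congr 1
          have : (d:ℝ) + γ - (d + 1) = γ - 1 := by ring
          rw [this]; ring
    have : ‖∫ w in T, (fderiv ℝ (gradN d) (z - w) - fderiv ℝ (gradN d) (x - w))‖ ≤
        C0 * ‖z - x‖ * ((C + 2 ^ ((d:ℝ) + 1) * (C * K2)) * δ ^ (γ - 1)) := by
      apply norm_integral_le_of_lint (by positivity)
      refine le_trans ?_ (lint_const_mul_le (by positivity : 0 ≤ C0 * ‖z - x‖) hL2)
      apply lintegral_mono_ae
      filter_upwards [hae] with w hw
      apply ENNReal.ofReal_le_ofReal
      have h1 := hTx w hw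
      have h2 := hk2 (x - w) (hne w hw x (by simp; positivity)) (z - w) (by
        have : z - w - (x - w) = z - x := by abel
        rw [this, norm_sub_rev x w]; linarith)
      have e : z - w - (x - w) = z - x := by abel
      rw [e, norm_sub_rev x w] at h2
      exact h2
    refine this.trans ?_
    calc _ = M2 * δ ^ (γ - 1) * ‖z - x‖ := by rw [hM2]; ring
      _ ≤ _ := by gcongr; linarith

end part6

section part7

theorem local_rep (d : ℕ) (γ : ℝ) (hγ : γ ∈ Ioo (0:ℝ) 1) (A : ℝ) (hA : 0 ≤ A) (R0 : ℝ) (hR0 : 0 < R0) :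
    ∃ C : ℝ, 0 < C ∧ ∀ (G : Set (EuclideanSpace ℝ (Fin d))) (n : EuclideanSpace ℝ (Fin d) → EuclideanSpace ℝ (Fin d))
      (c : EuclideanSpace ℝ (Fin d)), IsOpen G → (frontier G).Nonempty → PN γ A G n → frontier G ⊆ ball c R0 →
      ∀ x ∈ G ∩ ball c (R0 + 2), ∃ p q : EuclideanSpace ℝ (Fin d),
        ball x (min (infDist x (frontier G)) 1) ⊆ G ∩ ball q 1 ∧ ‖x - p‖ ≤ min (infDist x (frontier G)) 1 ∧
        ball q 1 ⊆ ball c (R0 + 3) ∧ p ∈ ball c (R0 + 2) ∧ (p ∈ G ↔ p ∈ ball q 1) ∧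
        ∀ T, T ⊆ {w | (w ∈ G ∧ w ∉ ball q 1) ∨ (w ∉ G ∧ w ∈ ball q 1)} → ∀ r, 0 < r →
          volume (T ∩ ball p r) ≤ ENNReal.ofReal (C * r ^ ((d:ℝ) + γ)) := by
  obtain ⟨Kb, hKb, hball⟩ := vol_ball_le d
  obtain ⟨Ks, hKs, hslab⟩ := vol_slab_le d
  refine ⟨(Kb + Ks) * (A + 1), by positivity, ?_⟩
  intro G n c hGo hne hG hfr x hx
  set δ := infDist x (frontier G) with hδ
  have hδ0 : 0 < δ := by
    obtain ⟨r, hr, hr'⟩ := Metric.isOpen_iff.1 hGo x hx.1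
    exact hr.trans_le (le_infDist_frontier hGo hne hr')
  have hbG : ball x δ ⊆ G := ball_infDist_subset hx.1 le_rfl
  have hrpow : ∀ r : ℝ, 0 < r → r ^ ((d:ℝ) + γ) = r ^ d * r ^ γ := by
    intro r hr
    rw [Real.rpow_add hr, Real.rpow_natCast]
  have hxc := hx.2
  rw [mem_ball, dist_eq_norm] at hxc
  have hbig : ∀ (T : Set (EuclideanSpace ℝ (Fin d))) p r, 0 < r → 1 ≤ (A + 1) * r ^ γ →
      volume (T ∩ ball p r) ≤ ENNReal.ofReal ((Kb + Ks) * (A + 1) * r ^ ((d:ℝ) + γ)) := by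
    intro T p r hr h1
    refine (measure_mono inter_subset_right).trans ?_
    rw [hball p r hr]
    apply ENNReal.ofReal_le_ofReal
    rw [hrpow r hr]
    calc Kb * r ^ d ≤ (Kb + Ks) * r ^ d * 1 := by rw [mul_one]; gcongr; linarith
      _ ≤ (Kb + Ks) * r ^ d * ((A + 1) * r ^ γ) := by gcongr
      _ = _ := by ring
  rcases le_or_gt 1 δ with hdeep | hsh
  · refine ⟨x, x, ?_, ?_, ?_, hx.2, ?_, ?_⟩
    · rw [min_eq_right hdeep]
      exact subset_inter ((ball_subset_ball hdeep).trans hbG) le_rfl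
    · rw [sub_self, norm_zero]; positivity
    · apply ball_subset_ball'
      rw [dist_eq_norm]; linarith
    · simp [hx.1]
    · intro T hT r hr
      rcases lt_or_ge r 1 with hr1 | hr1
      · have : T ∩ ball x r = ∅ := by
          rw [← not_nonempty_iff_eq_empty]
          rintro ⟨w, hw, hwr⟩
          have hw1 : w ∈ ball x 1 := ball_subset_ball hr1.le hwr
          rcases hT hw with h | h
          · exact h.2 hw1
          · exact h.1 (hbG (ball_subset_ball hdeep hw1))
        rw [this, measure_empty]; exact zero_le
      · apply hbig T x r hr
        have : 1 ≤ r ^ γ := Real.one_le_rpow hr1 hγ.1.le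
        nlinarith
  · obtain ⟨p, hp, hpd⟩ := isClosed_frontier.exists_infDist_eq_dist hne x
    rw [← hδ, dist_eq_norm] at hpd
    have hnp := (hG p hp).1
    have hxp := hG.nearest hγ.1 hδ0 hbG hp hpd.symm
    have hpc := hfr hp
    rw [mem_ball, dist_eq_norm] at hpc
    refine ⟨p, p - n p, ?_, ?_, ?_, ?_, ?_, ?_⟩
    · rw [min_eq_left hsh.le]
      refine subset_inter hbG (ball_subset_ball' ?_)
      have : x - (p - n p) = (1 - δ) • n p := by
        conv_lhs => rw [hxp]
        module
      rw [dist_eq_norm, this, norm_smul, hnp, Real.norm_of_nonneg (by linarith)]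
      linarith
    · rw [min_eq_left hsh.le, hpd]
    · apply ball_subset_ball'
      rw [dist_eq_norm]
      have : p - n p - c = (p - c) - n p := by abel
      rw [this]
      have := norm_sub_le (p - c) (n p)
      linarith
    · rw [mem_ball, dist_eq_norm]; linarith
    · rw [hGo.frontier_eq] at hp
      constructor
      · intro h; exact absurd h hp.2
      · intro h
        rw [mem_ball, dist_eq_norm, sub_sub_cancel, hnp] at h
        exact absurd h (lt_irrefl _)
    · intro T hT r hr
      rcases le_or_gt 1 ((A + 1) * r ^ γ) with h1 | h1
      · exact hbig T p r hr h1
      have hr1 : r ≤ 1 := by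
        by_contra h
        push Not at h
        have : 1 ≤ r ^ γ := Real.one_le_rpow h.le hγ.1.le
        nlinarith
      set τ := (A + 1) * r ^ (1 + γ) with hτ
      have e1 : r ^ (1 + γ) = r * r ^ γ := Real.rpow_one_add' hr.le (by linarith [hγ.1])
      have hτ0 : 0 < τ := by positivity
      have hτr : τ ≤ r := by
        rw [hτ, e1]; nlinarith
      have hsub : T ∩ ball p r ⊆ {w | |⟪w - p, n p⟫| ≤ τ} ∩ ball p r := by
        rintro w ⟨hw, hwr⟩
        refine ⟨?_, hwr⟩
        rw [mem_ball, dist_eq_norm] at hwr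
        exact hG.slab hγ hA hp hwr.le hr1 (hT hw)
      refine (measure_mono hsub).trans ((hslab p (n p) r τ hnp hτ0 hτr).trans ?_)
      apply ENNReal.ofReal_le_ofReal
      rw [hrpow r hr, hτ, e1]
      have : (A + 1) * (r * r ^ γ) / r = (A + 1) * r ^ γ := by field_simp
      rw [this]
      calc Ks * ((A + 1) * r ^ γ) * r ^ d ≤ (Kb + Ks) * ((A + 1) * r ^ γ) * r ^ d := by gcongr; linarith
        _ = _ := by ring

theorem V_intReg (d : ℕ) (hd : 2 ≤ d) (γ : ℝ) (hγ : γ ∈ Ioo (0:ℝ) 1) (A : ℝ) (hA : 0 ≤ A) (R0 : ℝ) (hR0 : 0 < R0) :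
    ∃ M : ℝ, 0 < M ∧ ∀ (G : Set (EuclideanSpace ℝ (Fin d))) (n : EuclideanSpace ℝ (Fin d) → EuclideanSpace ℝ (Fin d))
      (c : EuclideanSpace ℝ (Fin d)), IsOpen G → (frontier G).Nonempty → PN γ A G n → frontier G ⊆ ball c R0 →
      IntReg γ M G c (R0 + 2) (fun z => ∫ w in G ∩ ball c (R0 + 4), gradN d (z - w)) := by
  obtain ⟨C, hC, hrep⟩ := local_rep d γ hγ A hA R0 hR0
  obtain ⟨MU, hMU, hU⟩ := U_est d hd γ hγ C (2 * R0 + 6) hC (by positivity)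
  obtain ⟨L, hL⟩ := newton_ball d hd
  refine ⟨‖L‖ + 2 * MU, by positivity, ?_⟩
  intro G n c hGo hne hG hfr x hx
  obtain ⟨p, q, hb, hxp, hqc, hpc, hpG, hvol⟩ := hrep G n c hGo hne hG hfr x hx
  set δ := min (infDist x (frontier G)) 1 with hδ
  have hδ0 : 0 < δ := by
    apply lt_min _ one_pos
    obtain ⟨r, hr, hr'⟩ := Metric.isOpen_iff.1 hGo x hx.1
    exact hr.trans_le (le_infDist_frontier hGo hne hr')
  set G' := G ∩ ball c (R0 + 4) with hG'
  have hqc' : ball q 1 ⊆ ball c (R0 + 4) := hqc.trans (ball_subset_ball (by linarith))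
  set T1 := G' \ ball q 1 with hT1
  set T2 := ball q 1 \ G' with hT2
  have hG'm : MeasurableSet G' := hGo.measurableSet.inter measurableSet_ball
  have hT1m : MeasurableSet T1 := hG'm.diff measurableSet_ball
  have hT2m : MeasurableSet T2 := measurableSet_ball.diff hG'm
  have hT1s : T1 ⊆ {w | (w ∈ G ∧ w ∉ ball q 1) ∨ (w ∉ G ∧ w ∈ ball q 1)} := by
    rintro w ⟨hw, hw'⟩; exact Or.inl ⟨hw.1, hw'⟩
  have hT2s : T2 ⊆ {w | (w ∈ G ∧ w ∉ ball q 1) ∨ (w ∉ G ∧ w ∈ ball q 1)} := by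
    rintro w ⟨hw, hw'⟩; exact Or.inr ⟨fun h => hw' ⟨h, hqc' hw⟩, hw⟩
  have hbigp : ball c (R0 + 4) ⊆ ball p (2 * R0 + 6) := by
    apply ball_subset_ball'
    rw [mem_ball, dist_comm] at hpc
    linarith
  have hsep : ∀ T, T ⊆ {w | (w ∈ G ∧ w ∉ ball q 1) ∨ (w ∉ G ∧ w ∈ ball q 1)} → p ∉ T ∧ ∀ w ∈ T, δ ≤ ‖w - x‖ := by
    intro T hT
    constructor
    · intro h
      rcases hT h with h' | h'
      · exact h'.2 (hpG.1 h'.1)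
      · exact h'.1 (hpG.2 h'.2)
    · intro w hw
      by_contra hcon
      push Not at hcon
      have := hb (by rwa [mem_ball, dist_eq_norm])
      rcases hT hw with h' | h'
      · exact h'.2 this.2
      · exact h'.1 this.1
  have U1 := hU T1 x p δ hT1m hδ0 hxp (hsep T1 hT1s).1 (hsep T1 hT1s).2
    ((sdiff_subset.trans inter_subset_right).trans hbigp) (hvol T1 hT1s)
  have U2 := hU T2 x p δ hT2m hδ0 hxp (hsep T2 hT2s).1 (hsep T2 hT2s).2
    ((sdiff_subset.trans hqc').trans hbigp) (hvol T2 hT2s)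
  have hGb : Bornology.IsBounded G' := isBounded_ball.subset inter_subset_right
  have hdecomp : ∀ z ∈ ball q 1, ∫ w in G', gradN d (z - w) =
      L (z - q) + (∫ w in T1, gradN d (z - w)) - ∫ w in T2, gradN d (z - w) := by
    intro z hz
    have i1 : ∫ w in G', gradN d (z - w) = (∫ w in G' ∩ ball q 1, gradN d (z - w)) + ∫ w in T1, gradN d (z - w) :=
      (integral_inter_add_sdiff measurableSet_ball (integrableOn_gradN d hd z G' hGb)).symm
    have i2 : ∫ w in ball q 1, gradN d (z - w) = (∫ w in ball q 1 ∩ G', gradN d (z - w)) + ∫ w in T2, gradN d (z - w) :=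
      (integral_inter_add_sdiff hG'm (integrableOn_gradN d hd z _ isBounded_ball)).symm
    rw [← hL q z 1 hz, i1, i2, inter_comm]
    abel
  have hderiv : ∀ z, ‖z - x‖ ≤ δ / 2 → HasFDerivAt (fun z => ∫ w in G', gradN d (z - w))
      (L + (∫ w in T1, fderiv ℝ (gradN d) (z - w)) - ∫ w in T2, fderiv ℝ (gradN d) (z - w)) z := by
    intro z hz
    have hzb : z ∈ ball q 1 := (hb (by rw [mem_ball, dist_eq_norm]; linarith)).2
    have hLd : HasFDerivAt (fun z => L (z - q)) L z := by
      have := L.hasFDerivAt.comp z ((hasFDerivAt_id z).sub_const q)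
      simpa [Function.comp_def] using this
    have h := (hLd.add (U1 z hz).1).sub (U2 z hz).1
    refine h.congr_of_eventuallyEq ?_
    filter_upwards [isOpen_ball.mem_nhds hzb] with z' hz'
    exact hdecomp z' hz'
  intro z hz
  have hx0 : ‖x - x‖ ≤ δ / 2 := by simp; positivity
  refine ⟨(hderiv z hz).differentiableAt, ?_, ?_⟩
  · rw [(hderiv z hz).fderiv]
    have h1 := (U1 z hz).2.1
    have h2 := (U2 z hz).2.1
    refine (norm_sub_le _ _).trans ?_
    have := norm_add_le L (∫ w in T1, fderiv ℝ (gradN d) (z - w))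
    linarith
  · rw [(hderiv z hz).fderiv, (hderiv x hx0).fderiv]
    have h1 := (U1 z hz).2.2
    have h2 := (U2 z hz).2.2
    set a1 := ∫ w in T1, fderiv ℝ (gradN d) (z - w)
    set a2 := ∫ w in T2, fderiv ℝ (gradN d) (z - w)
    set b1 := ∫ w in T1, fderiv ℝ (gradN d) (x - w)
    set b2 := ∫ w in T2, fderiv ℝ (gradN d) (x - w)
    have e : L + a1 - a2 - (L + b1 - b2) = (a1 - b1) - (a2 - b2) := by abel
    rw [e]
    have hpos : 0 ≤ δ ^ (γ - 1) * ‖z - x‖ := by positivity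
    calc ‖(a1 - b1) - (a2 - b2)‖ ≤ ‖a1 - b1‖ + ‖a2 - b2‖ := norm_sub_le _ _
      _ ≤ MU * δ ^ (γ - 1) * ‖z - x‖ + MU * δ ^ (γ - 1) * ‖z - x‖ := add_le_add h1 h2
      _ = 2 * MU * (δ ^ (γ - 1) * ‖z - x‖) := by ring
      _ ≤ (‖L‖ + 2 * MU) * (δ ^ (γ - 1) * ‖z - x‖) := by gcongr; linarith [norm_nonneg L]
      _ = _ := by ring

end part7

section part8

section wwbasic
variable {E F : Type*} [NormedAddCommGroup E] [NormedSpace ℝ E] [NormedAddCommGroup F] [NormedSpace ℝ F]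
  {γ M : ℝ} {S : Set E} {f : E → F} {A : E → E →L[ℝ] F}

theorem WW.lip (h : WW γ M S f A) (hγ : 0 < γ) {x y : E} (hx : x ∈ S) (hy : y ∈ S) :
    ‖f x - f y‖ ≤ 2 * M * ‖x - y‖ := by
  obtain ⟨h1, -, h2⟩ := h x hx
  obtain ⟨h3, h3', -⟩ := h y hy
  have hM : 0 ≤ M := (norm_nonneg _).trans h1
  have h4 := (h2 y hy).2
  have h0 := norm_nonneg (x - y)
  rcases le_or_gt ‖x - y‖ 1 with ht | ht
  · have h5 : ‖A y (x - y)‖ ≤ M * ‖x - y‖ := ((A y).le_opNorm _).trans (by gcongr)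
    have h6 : ‖x - y‖ ^ (1 + γ) ≤ ‖x - y‖ := by
      rw [Real.rpow_one_add' h0 (by linarith)]
      have : ‖x - y‖ ^ γ ≤ 1 := Real.rpow_le_one h0 ht hγ.le
      nlinarith
    calc ‖f x - f y‖ = ‖(f x - f y - A y (x - y)) + A y (x - y)‖ := by congr 1; abel
      _ ≤ ‖f x - f y - A y (x - y)‖ + ‖A y (x - y)‖ := norm_add_le _ _
      _ ≤ M * ‖x - y‖ + M * ‖x - y‖ := by
        refine add_le_add (h4.trans ?_) h5
        gcongr
      _ = _ := by ring
  · calc ‖f x - f y‖ ≤ ‖f x‖ + ‖f y‖ := norm_sub_le _ _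
      _ ≤ 2 * M * 1 := by linarith
      _ ≤ _ := by gcongr

theorem WW.of_local {h0 : ℝ} (hγ : 0 < γ) (hh : 0 < h0) (hh1 : h0 ≤ 1)
    (h : ∀ x ∈ S, ‖f x‖ ≤ M ∧ ‖A x‖ ≤ M ∧ ∀ y ∈ S, ‖x - y‖ ≤ h0 → ‖A x - A y‖ ≤ M * ‖x - y‖ ^ γ ∧
    ‖f x - f y - A y (x - y)‖ ≤ M * ‖x - y‖ ^ (1 + γ)) : WW γ (3 * M * h0 ^ (-(1 + γ))) S f A := by
  intro x hx
  obtain ⟨h1, h1', h2⟩ := h x hx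
  have hM : 0 ≤ M := (norm_nonneg _).trans h1
  have hp : 1 ≤ h0 ^ (-(1 + γ)) := Real.one_le_rpow_of_pos_of_le_one_of_nonpos hh hh1 (by linarith)
  have hM3 : M ≤ 3 * M * h0 ^ (-(1 + γ)) := by nlinarith
  refine ⟨h1.trans hM3, h1'.trans hM3, fun y hy => ?_⟩
  obtain ⟨h3, h3', -⟩ := h y hy
  have h0' := norm_nonneg (x - y)
  set t := ‖x - y‖ with ht
  rcases le_or_gt t h0 with hle | hlt
  · obtain ⟨a, b⟩ := h2 y hy hle
    exact ⟨a.trans (by gcongr), b.trans (by gcongr)⟩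
  · have ht0 : 0 < t := hh.trans hlt
    have g1 : 1 ≤ h0 ^ (-γ) * t ^ γ := by
      rw [Real.rpow_neg hh.le, inv_mul_eq_div, le_div_iff₀ (by positivity), one_mul]
      exact Real.rpow_le_rpow hh.le hlt.le hγ.le
    have g2 : 1 ≤ h0 ^ (-(1 + γ)) * t ^ (1 + γ) := by
      rw [Real.rpow_neg hh.le, inv_mul_eq_div, le_div_iff₀ (by positivity), one_mul]
      exact Real.rpow_le_rpow hh.le hlt.le (by linarith)
    have g3 : h0 ^ (-γ) ≤ h0 ^ (-(1 + γ)) := Real.rpow_le_rpow_of_exponent_ge hh hh1 (by linarith)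
    have g4 : t ≤ h0 ^ (-(1 + γ)) * t ^ (1 + γ) := by
      rw [Real.rpow_one_add' ht0.le (by linarith)]
      calc t = t * 1 := by ring
        _ ≤ t * (h0 ^ (-γ) * t ^ γ) := by gcongr
        _ ≤ t * (h0 ^ (-(1 + γ)) * t ^ γ) := by gcongr
        _ = _ := by ring
    constructor
    · calc ‖A x - A y‖ ≤ ‖A x‖ + ‖A y‖ := norm_sub_le _ _
        _ ≤ 3 * M * 1 := by linarith
        _ ≤ 3 * M * (h0 ^ (-γ) * t ^ γ) := by gcongr
        _ ≤ 3 * M * (h0 ^ (-(1 + γ)) * t ^ γ) := by gcongr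
        _ = _ := by ring
    · have h5 : ‖A y (x - y)‖ ≤ M * t := ((A y).le_opNorm _).trans (by gcongr)
      have h6 := norm_sub_le (f x - f y) (A y (x - y))
      have h7 := norm_sub_le (f x) (f y)
      calc _ ≤ 2 * M * 1 + M * t := by linarith
        _ ≤ 2 * M * (h0 ^ (-(1 + γ)) * t ^ (1 + γ)) + M * (h0 ^ (-(1 + γ)) * t ^ (1 + γ)) := by gcongr
        _ = _ := by ring
end wwbasic

theorem V_bound (d : ℕ) (hd : 2 ≤ d) (R0 : ℝ) (hR0 : 0 < R0) : ∃ C : ℝ, 0 < C ∧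
    ∀ (D : Set (EuclideanSpace ℝ (Fin d))) (c z : EuclideanSpace ℝ (Fin d)), MeasurableSet D → D ⊆ ball c R0 →
      ‖∫ w in D, gradN d (z - w)‖ ≤ C := by
  obtain ⟨C1, hC1, h1⟩ := lint_gradN_ball d hd
  obtain ⟨C0, hC0, hk, -⟩ := kernel_bounds d hd
  obtain ⟨Kb, hKb, hball⟩ := vol_ball_le d
  have hd1 : (2:ℝ) ≤ d := by exact_mod_cast hd
  refine ⟨C1 + C0 * (Kb * R0 ^ d), by positivity, ?_⟩
  intro D c z hD hDc
  apply norm_integral_le_of_lint (by positivity)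
  rw [← lintegral_inter_add_sdiff _ D (measurableSet_ball : MeasurableSet (ball z 1)),
    ENNReal.ofReal_add (by positivity) (by positivity)]
  refine add_le_add ?_ ?_
  · refine (lintegral_mono_set inter_subset_right).trans ?_
    simpa using h1 z 1 one_pos
  · calc _ ≤ ∫⁻ w in D \ ball z 1, ENNReal.ofReal C0 := by
          apply setLIntegral_mono measurable_const
          rintro w ⟨-, hw⟩
          apply ENNReal.ofReal_le_ofReal
          refine (hk _).trans ?_
          rw [mem_ball, dist_comm, dist_eq_norm, not_lt] at hw
          have : ‖z - w‖ ^ (-((d:ℝ) - 1)) ≤ 1 := Real.rpow_le_one_of_one_le_of_nonpos hw (by linarith)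
          nlinarith
      _ ≤ ENNReal.ofReal C0 * volume (ball c R0) := by
          rw [setLIntegral_const]; gcongr; exact sdiff_subset.trans hDc
      _ = _ := by rw [hball c R0 hR0, ← ENNReal.ofReal_mul hC0.le]

theorem V_far (d : ℕ) (hd : 2 ≤ d) : ∃ C : ℝ, 0 < C ∧
    ∀ (D : Set (EuclideanSpace ℝ (Fin d))) (c : EuclideanSpace ℝ (Fin d)) (R0 : ℝ), MeasurableSet D → 0 < R0 → D ⊆ ball c R0 →
    ∀ (x y : EuclideanSpace ℝ (Fin d)) (r : ℝ), 0 < r → (∀ w ∈ D, r ≤ ‖x - w‖) → ‖x - y‖ ≤ r / 2 →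
      ‖(∫ w in D, gradN d (x - w)) - ∫ w in D, gradN d (y - w)‖ ≤ C * R0 ^ d * r ^ (-(d:ℝ)) * ‖x - y‖ := by
  obtain ⟨C0, hC0, -, -, -, hk, -⟩ := kernel_bounds d hd
  obtain ⟨Kb, hKb, hball⟩ := vol_ball_le d
  refine ⟨C0 * Kb, by positivity, ?_⟩
  intro D c R0 hD hR0 hDc x y r hr hxr hxy
  have hDb : Bornology.IsBounded D := isBounded_ball.subset hDc
  rw [← integral_sub (integrableOn_gradN d hd x D hDb) (integrableOn_gradN d hd y D hDb)]
  apply norm_integral_le_of_lint (by positivity)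
  calc _ ≤ ∫⁻ w in D, ENNReal.ofReal (C0 * r ^ (-(d:ℝ)) * ‖x - y‖) := by
        apply setLIntegral_mono measurable_const
        intro w hw
        apply ENNReal.ofReal_le_ofReal
        have h1 := hxr w hw
        have hne : x - w ≠ 0 := by rw [← norm_pos_iff]; linarith
        have e : y - w - (x - w) = y - x := by abel
        have := hk (x - w) hne (y - w) (by rw [e, norm_sub_rev]; linarith)
        rw [e, norm_sub_rev, norm_sub_rev y x] at this
        refine this.trans ?_
        have : ‖x - w‖ ^ (-(d:ℝ)) ≤ r ^ (-(d:ℝ)) :=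
          Real.rpow_le_rpow_of_nonpos hr h1 (by simp)
        calc C0 * ‖x - y‖ * ‖x - w‖ ^ (-(d:ℝ)) ≤ C0 * ‖x - y‖ * r ^ (-(d:ℝ)) := by gcongr
          _ = _ := by ring
    _ ≤ ENNReal.ofReal (C0 * r ^ (-(d:ℝ)) * ‖x - y‖) * volume (ball c R0) := by
        rw [setLIntegral_const]; gcongr
    _ = _ := by
        rw [hball c R0 hR0, ← ENNReal.ofReal_mul (by positivity)]
        congr 1; ring

theorem V_cont (d : ℕ) (hd : 2 ≤ d) (D : Set (EuclideanSpace ℝ (Fin d))) (hD : MeasurableSet D)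
    (hb : Bornology.IsBounded D) : Continuous (fun z => ∫ w in D, gradN d (z - w)) := by
  obtain ⟨C1, hC1, h1⟩ := lint_gradN_ball d hd
  obtain ⟨C2, hC2, h2⟩ := V_far d hd
  obtain ⟨R0', hR0'⟩ := hb.subset_ball 0
  set R0 := max R0' 1
  have hR0 : D ⊆ ball 0 R0 := hR0'.trans (ball_subset_ball (le_max_left _ _))
  have hR0p : 0 < R0 := lt_of_lt_of_le one_pos (le_max_right _ _)
  rw [continuous_iff_continuousAt]
  intro x
  rw [Metric.continuousAt_iff]
  intro ε hε
  set r := ε / (8 * C1) with hr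
  have hr0 : 0 < r := by positivity
  set K := C2 * R0 ^ d * r ^ (-(d:ℝ)) with hK
  have hK0 : 0 < K := by positivity
  refine ⟨min (r / 2) (ε / (4 * K)), by positivity, ?_⟩
  intro y hy
  rw [dist_comm, dist_eq_norm] at hy ⊢
  have hy1 : ‖x - y‖ ≤ r / 2 := (hy.trans_le (min_le_left _ _)).le
  have hy2 : ‖x - y‖ ≤ ε / (4 * K) := (hy.trans_le (min_le_right _ _)).le
  have split : ∀ z, ∫ w in D, gradN d (z - w) = (∫ w in D ∩ ball x r, gradN d (z - w)) +
      ∫ w in D \ ball x r, gradN d (z - w) := fun z =>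
    (integral_inter_add_sdiff measurableSet_ball (integrableOn_gradN d hd z D hb)).symm
  have n1 : ‖∫ w in D ∩ ball x r, gradN d (x - w)‖ ≤ C1 * r :=
    norm_integral_le_of_lint (by positivity) ((lintegral_mono_set inter_subset_right).trans (h1 x r hr0))
  have n2 : ‖∫ w in D ∩ ball x r, gradN d (y - w)‖ ≤ C1 * (2 * r) := by
    apply norm_integral_le_of_lint (by positivity)
    refine (lintegral_mono_set (inter_subset_right.trans ?_)).trans (h1 y (2 * r) (by positivity))
    apply ball_subset_ball'
    rw [dist_eq_norm]; linarith
  have n3 := h2 (D \ ball x r) 0 R0 (hD.diff measurableSet_ball) hR0p (sdiff_subset.trans hR0) x y r hr0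
    (by rintro w ⟨-, hw⟩; rwa [mem_ball, dist_comm, dist_eq_norm, not_lt] at hw) hy1
  rw [← hK] at n3
  have n4 : K * ‖x - y‖ ≤ ε / 4 := by
    calc K * ‖x - y‖ ≤ K * (ε / (4 * K)) := by gcongr
      _ = ε / 4 := by field_simp
  have n5 : C1 * r = ε / 8 := by rw [hr]; field_simp
  rw [split x, split y]
  set a1 := ∫ w in D ∩ ball x r, gradN d (x - w)
  set a2 := ∫ w in D ∩ ball x r, gradN d (y - w)
  set b1 := ∫ w in D \ ball x r, gradN d (x - w)
  set b2 := ∫ w in D \ ball x r, gradN d (y - w)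
  calc ‖a1 + b1 - (a2 + b2)‖ = ‖(a1 - a2) + (b1 - b2)‖ := by congr 1; abel
    _ ≤ ‖a1 - a2‖ + ‖b1 - b2‖ := norm_add_le _ _
    _ ≤ (‖a1‖ + ‖a2‖) + ‖b1 - b2‖ := by gcongr; exact norm_sub_le _ _
    _ < ε := by linarith

end part8

section part9

theorem lip_closure {E F : Type*} [NormedAddCommGroup E] [NormedAddCommGroup F] {f : E → F} (hf : Continuous f)
    {S : Set E} {h L : ℝ} (H : ∀ x ∈ S, ∀ y ∈ S, ‖x - y‖ ≤ h → ‖f x - f y‖ ≤ L * ‖x - y‖) :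
    ∀ x ∈ closure S, ∀ y ∈ closure S, ‖x - y‖ < h → ‖f x - f y‖ ≤ L * ‖x - y‖ := by
  intro x hx y hy hxy
  have hc : IsClosed ({q : E × E | h ≤ ‖q.1 - q.2‖} ∪ {q : E × E | ‖f q.1 - f q.2‖ ≤ L * ‖q.1 - q.2‖}) := by
    apply IsClosed.union
    · exact isClosed_le continuous_const (by fun_prop)
    · exact isClosed_le (by fun_prop) (by fun_prop)
  have hsub : S ×ˢ S ⊆ ({q : E × E | h ≤ ‖q.1 - q.2‖} ∪ {q : E × E | ‖f q.1 - f q.2‖ ≤ L * ‖q.1 - q.2‖}) := by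
    rintro ⟨a, b⟩ ⟨ha, hb⟩
    rcases le_total h ‖a - b‖ with h1 | h1
    · left; exact h1
    · right; exact H a ha b hb h1
  have hm : (x, y) ∈ closure (S ×ˢ S) := by rw [closure_prod_eq]; exact ⟨hx, hy⟩
  rcases closure_minimal hsub hc hm with h1 | h1
  · exact absurd h1 (not_le.mpr hxy)
  · exact h1

theorem PN.compl_closure {E : Type*} [NormedAddCommGroup E] [InnerProductSpace ℝ E] {γ A : ℝ} {D : Set E} {n : E → E}
    (hγ : 0 < γ) (hD : PN γ A D n) : PN γ A (closure D)ᶜ (fun p => -n p) := by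
  intro p hp
  rw [frontier_compl] at hp
  obtain ⟨h1, h2⟩ := hD p (frontier_closure_subset hp)
  refine ⟨by simpa using h1, fun y => ⟨fun hy => ?_, fun hy hy' => ?_⟩⟩
  · rw [inner_neg_right] at hy
    have ho : IsOpen {z : E | A * ‖z - p‖ ^ (1 + γ) < ⟪z - p, n p⟫} := by
      apply isOpen_lt
      · exact continuous_const.mul ((continuous_id.sub continuous_const).norm.rpow_const (fun _ => Or.inr (by linarith)))
      · fun_prop
    have hs : D ⊆ {z : E | A * ‖z - p‖ ^ (1 + γ) < ⟪z - p, n p⟫}ᶜ := fun z hz hz' => (h2 z).2 hz' hz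
    intro hyc
    exact closure_minimal hs ho.isClosed_compl hyc (by simp only [mem_ofPred_eq]; linarith)
  · rw [inner_neg_right] at hy
    exact hy' (subset_closure ((h2 y).1 (by linarith)))

theorem exists_r0 (γ : ℝ) (hγ : 0 < γ) (A : ℝ) (hA : 0 ≤ A) : ∃ r0 : ℝ, 0 < r0 ∧ A * (17 * r0) ^ γ ≤ 1 / 6 := by
  refine ⟨(1 / (6 * (A + 1))) ^ (1 / γ) / 17, by positivity, ?_⟩
  have : 17 * ((1 / (6 * (A + 1))) ^ (1 / γ) / 17) = (1 / (6 * (A + 1))) ^ (1 / γ) := by ring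
  rw [this, ← Real.rpow_mul (by positivity), one_div_mul_cancel hγ.ne', Real.rpow_one]
  rw [mul_one_div, div_le_div_iff₀ (by positivity) (by norm_num)]
  linarith

theorem V_main (d : ℕ) (hd : 2 ≤ d) (γ : ℝ) (hγ : γ ∈ Ioo (0:ℝ) 1) (A : ℝ) (hA : 0 ≤ A) (R0 : ℝ) (hR0 : 0 < R0) :
    ∃ M : ℝ, 0 < M ∧ ∀ (D : Set (EuclideanSpace ℝ (Fin d))) (n : EuclideanSpace ℝ (Fin d) → EuclideanSpace ℝ (Fin d))
      (c : EuclideanSpace ℝ (Fin d)), IsOpen D → D.Nonempty → D ⊆ ball c R0 → PN γ A D n → volume (frontier D) = 0 →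
      (∀ z, ‖∫ w in D, gradN d (z - w)‖ ≤ M) ∧
      (∀ x y, ‖(∫ w in D, gradN d (x - w)) - ∫ w in D, gradN d (y - w)‖ ≤ M * ‖x - y‖) ∧
      ∃ A', WW γ M D (fun z => ∫ w in D, gradN d (z - w)) A' := by
  obtain ⟨M1, hM1, hintg⟩ := V_intReg d hd γ hγ A hA (R0 + 1) (by linarith)
  obtain ⟨C1, hC1, hbd⟩ := V_bound d hd R0 hR0
  obtain ⟨C2, hC2, hfar⟩ := V_far d hd
  obtain ⟨L, hL⟩ := newton_ball d hd
  obtain ⟨r0, hr0, hr0'⟩ := exists_r0 γ hγ.1 A hA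
  obtain ⟨h0, hh0, hh0a, hh0b⟩ : ∃ h0 : ℝ, 0 < h0 ∧ 13 * h0 ≤ r0 ∧ 9 * h0 ≤ 1 := by
    refine ⟨min (r0 / 13) (1 / 9), by positivity, ?_, ?_⟩
    · have := min_le_left (r0 / 13) (1 / 9); linarith
    · have := min_le_right (r0 / 13) (1 / 9); linarith
  have hθ := chain_const_pos hγ
  set K1 := C1 + M1 + 40 * M1 / (1 - (17 / 18 : ℝ) ^ γ) with hK1
  have hq : 0 < 40 * M1 / (1 - (17 / 18 : ℝ) ^ γ) := by positivity
  set L1 := 18 * M1 + ‖L‖ + C2 * R0 ^ d with hL1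
  have hL1p : 0 < L1 := by positivity
  set L2 := L1 + 2 * C1 / h0 with hL2
  refine ⟨C1 + L2 + 3 * K1 * h0 ^ (-(1 + γ)), by positivity, ?_⟩
  intro D n c hDo hDne hDc hPN hvol
  have hDm := hDo.measurableSet
  have hDb : Bornology.IsBounded D := isBounded_ball.subset hDc
  set V : EuclideanSpace ℝ (Fin d) → EuclideanSpace ℝ (Fin d) := fun z => ∫ w in D, gradN d (z - w) with hV
  have hVc : Continuous V := V_cont d hd D hDm hDb
  have hVb : ∀ z, ‖V z‖ ≤ C1 := fun z => hbd D c z hDm hDc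
  have hpow : 0 < h0 ^ (-(1 + γ)) := by positivity
  have hpow' : 0 < 3 * K1 * h0 ^ (-(1 + γ)) := by positivity
  have hd0 : (0:ℝ) < d := by exact_mod_cast (by omega : 0 < d)
  have : Nonempty (Fin d) := ⟨⟨0, by omega⟩⟩
  have hcD : closure D ⊆ closedBall c R0 := closure_minimal (hDc.trans ball_subset_closedBall) isClosed_closedBall
  have hcD' : closure D ⊆ ball c (R0 + 1) := hcD.trans (closedBall_subset_ball (by linarith))
  have hne2 : (closure D)ᶜ.Nonempty := by
    rw [nonempty_compl]
    intro h
    have : Bornology.IsBounded (univ : Set (EuclideanSpace ℝ (Fin d))) := by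
      rw [← h]; exact isBounded_closedBall.subset hcD
    exact NormedSpace.unbounded_univ ℝ (EuclideanSpace ℝ (Fin d)) this
  have hfr1 : (frontier D).Nonempty := by
    rw [nonempty_frontier_iff]
    refine ⟨hDne, fun h => ?_⟩
    rw [h, closure_univ, compl_univ] at hne2
    exact not_nonempty_empty hne2
  have hfr2 : (frontier (closure D)ᶜ).Nonempty := by
    rw [nonempty_frontier_iff]
    refine ⟨hne2, fun h => ?_⟩
    rw [compl_univ_iff] at h
    have := hDne.closure
    rw [h] at this
    exact not_nonempty_empty this
  -- inside
  have hW1 := hintg D n c hDo hfr1 hPN (frontier_subset_closure.trans hcD')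
  have hDeq : D ∩ ball c (R0 + 1 + 4) = D := inter_eq_left.mpr (hDc.trans (ball_subset_ball (by linarith)))
  rw [hDeq] at hW1
  have hin : ∀ x ∈ D, ∀ y ∈ D, ‖x - y‖ ≤ h0 → _ := fun x hx y hy hxy =>
    hW1.whitney hγ hM1.le hDo hfr1 hPN hA hr0' hh0a (by linarith) (R1 := R0 + 2) (by linarith)
      ⟨hx, ball_subset_ball (by linarith) (hDc hx)⟩ ⟨hy, ball_subset_ball (by linarith) (hDc hy)⟩ hxy
  -- outside
  set G2 := (closure D)ᶜ with hG2
  have hG2o : IsOpen G2 := isClosed_closure.isOpen_compl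
  have hPN2 := hPN.compl_closure hγ.1
  have hW2 := hintg G2 _ c hG2o hfr2 hPN2 (by
    rw [hG2, frontier_compl]; exact frontier_closure_subset.trans (frontier_subset_closure.trans hcD'))
  set V2 : EuclideanSpace ℝ (Fin d) → EuclideanSpace ℝ (Fin d) := fun z => ∫ w in G2 ∩ ball c (R0 + 1 + 4), gradN d (z - w) with hV2
  have hVV : ∀ z ∈ ball c (R0 + 1 + 4), V z = L (z - c) - V2 z := by
    intro z hz
    have hi : IntegrableOn (fun w => gradN d (z - w)) (ball c (R0 + 1 + 4)) := integrableOn_gradN d hd z _ isBounded_ball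
    have h1 := integral_inter_add_sdiff (μ := volume) (s := ball c (R0 + 1 + 4)) (t := closure D) isClosed_closure.measurableSet hi
    rw [hL c z _ hz] at h1
    have h2 : ball c (R0 + 1 + 4) ∩ closure D = closure D := inter_eq_right.mpr (hcD'.trans (ball_subset_ball (by linarith)))
    have h3 : ball c (R0 + 1 + 4) \ closure D = G2 ∩ ball c (R0 + 1 + 4) := by rw [hG2, sdiff_eq, inter_comm]
    rw [h2, h3] at h1
    have h4 : ∫ w in closure D, gradN d (z - w) = V z := by
      apply setIntegral_congr_set
      exact (closure_ae_eq_of_null_frontier hvol)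
    rw [h4] at h1
    rw [← h1]; simp [hV2]
  set S2 := G2 ∩ ball c (R0 + 2) with hS2
  have hout : ∀ x ∈ S2, ∀ y ∈ S2, ‖x - y‖ ≤ h0 → ‖V x - V y‖ ≤ L1 * ‖x - y‖ := by
    intro x hx y hy hxy
    obtain ⟨-, h2, -⟩ := hW2.whitney hγ hM1.le hG2o hfr2 hPN2 hA hr0' hh0a (by linarith) (R1 := R0 + 2) (by linarith) hx hy hxy
    rw [hVV x (ball_subset_ball (by linarith) hx.2), hVV y (ball_subset_ball (by linarith) hy.2)]
    have e : L (x - c) - V2 x - (L (y - c) - V2 y) = L (x - y) - (V2 x - V2 y) := by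
      have : L (x - y) = L (x - c) - L (y - c) := by rw [← map_sub]; congr 1; abel
      rw [this]; abel
    rw [e]
    have h5 := L.le_opNorm (x - y)
    have h6 : 0 ≤ C2 * R0 ^ d * ‖x - y‖ := by positivity
    calc _ ≤ ‖L (x - y)‖ + ‖V2 x - V2 y‖ := norm_sub_le _ _
      _ ≤ L1 * ‖x - y‖ := by rw [hL1]; linarith
  have hin' : ∀ x ∈ D, ∀ y ∈ D, ‖x - y‖ ≤ h0 → ‖V x - V y‖ ≤ L1 * ‖x - y‖ := by
    intro x hx y hy hxy
    refine (hin x hx y hy hxy).2.1.trans ?_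
    gcongr
    rw [hL1]
    have : 0 ≤ C2 * R0 ^ d := by positivity
    linarith [norm_nonneg L]
  have hin2 := lip_closure hVc hin'
  have hout2 := lip_closure hVc hout
  have hmix : ∀ x ∈ closure D, x ∈ ball c (R0 + 2) → ∀ y ∈ S2, ‖x - y‖ < h0 → ‖V x - V y‖ ≤ L1 * ‖x - y‖ := by
    intro x hx hxb y hy hxy
    obtain ⟨z, hz1, hz2⟩ := precon_frontier (s := segment ℝ x y) (G := closure D) (convex_segment x y).isPreconnected
      ⟨x, left_mem_segment ℝ x y, hx⟩ ⟨y, right_mem_segment ℝ x y, hy.1⟩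
    have hzD : z ∈ closure D := isClosed_closure.frontier_subset hz2
    have hzb : z ∈ ball c (R0 + 2) := (convex_ball c _).segment_subset hxb hy.2 hz1
    have hzS : z ∈ closure S2 := by
      rw [frontier_eq_closure_inter_closure] at hz2
      have := isOpen_ball.inter_closure ⟨hzb, hz2.2⟩
      rwa [inter_comm] at this
    have hdist := dist_add_dist_of_mem_segment hz1
    rw [dist_eq_norm, dist_eq_norm, dist_eq_norm] at hdist
    have a1 := hin2 x hx z hzD (by linarith [norm_nonneg (z - y)])
    have a2 := hout2 z hzS y (subset_closure hy) (by linarith [norm_nonneg (x - z)])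
    calc ‖V x - V y‖ = ‖(V x - V z) + (V z - V y)‖ := by congr 1; abel
      _ ≤ ‖V x - V z‖ + ‖V z - V y‖ := norm_add_le _ _
      _ ≤ L1 * (‖x - z‖ + ‖z - y‖) := by linarith
      _ = _ := by rw [hdist]
  have hfar' : ∀ x y, x ∉ ball c (R0 + 2) → ‖x - y‖ < h0 → ‖V x - V y‖ ≤ L1 * ‖x - y‖ := by
    intro x y hx hxy
    refine (hfar D c R0 hDm hR0 hDc x y 1 one_pos ?_ (by linarith)).trans ?_
    · intro w hw
      have h1 := hDc hw
      rw [mem_ball] at h1 hx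
      have h2 := dist_triangle x w c
      rw [dist_eq_norm x w] at h2
      linarith
    · rw [Real.one_rpow, mul_one]
      gcongr
      rw [hL1]
      linarith [norm_nonneg L]
  have hloc : ∀ x y, ‖x - y‖ < h0 → ‖V x - V y‖ ≤ L1 * ‖x - y‖ := by
    intro x y hxy
    have hyx : ‖y - x‖ < h0 := by rwa [norm_sub_rev]
    by_cases hx : x ∈ ball c (R0 + 2)
    swap
    · exact hfar' x y hx hxy
    by_cases hy : y ∈ ball c (R0 + 2)
    swap
    · rw [norm_sub_rev, norm_sub_rev x]; exact hfar' y x hy hyx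
    by_cases hxD : x ∈ closure D <;> by_cases hyD : y ∈ closure D
    · exact hin2 x hxD y hyD hxy
    · exact hmix x hxD hx y ⟨hyD, hy⟩ hxy
    · rw [norm_sub_rev, norm_sub_rev x]; exact hmix y hyD hy x ⟨hxD, hx⟩ hyx
    · exact hout x ⟨hxD, hx⟩ y ⟨hyD, hy⟩ hxy.le
  refine ⟨fun z => (hVb z).trans (by linarith [show 0 < L2 by positivity]), fun x y => ?_, fderiv ℝ V, ?_⟩
  · have h3 : ‖V x - V y‖ ≤ L2 * ‖x - y‖ := by
      rcases lt_or_ge ‖x - y‖ h0 with h | h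
      · refine (hloc x y h).trans ?_
        gcongr
        rw [hL2]; linarith [show 0 < 2 * C1 / h0 by positivity]
      · calc ‖V x - V y‖ ≤ ‖V x‖ + ‖V y‖ := norm_sub_le _ _
          _ ≤ 2 * C1 / h0 * h0 := by rw [div_mul_cancel₀ _ hh0.ne']; linarith [hVb x, hVb y]
          _ ≤ L2 * ‖x - y‖ := by
            rw [hL2]; gcongr; linarith
    refine h3.trans ?_
    gcongr
    linarith
  · have hw : WW γ (3 * K1 * h0 ^ (-(1 + γ))) D V (fderiv ℝ V) := by
      apply WW.of_local hγ.1 hh0 (by linarith)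
      intro x hx
      refine ⟨(hVb x).trans (by rw [hK1]; linarith), ?_, fun y hy hxy => ?_⟩
      · have := (hin x hx x hx (by simp [hh0.le])).1
        refine this.trans (by rw [hK1]; linarith)
      · obtain ⟨-, -, h1, h2⟩ := hin x hx y hy hxy
        have hle : 40 * M1 / (1 - (17 / 18 : ℝ) ^ γ) ≤ K1 := by rw [hK1]; linarith
        exact ⟨h1.trans (by gcongr), h2.trans (by gcongr)⟩
    intro x hx
    obtain ⟨h1, h2, h3⟩ := hw x hx
    have hle : 3 * K1 * h0 ^ (-(1 + γ)) ≤ C1 + L2 + 3 * K1 * h0 ^ (-(1 + γ)) := by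
      linarith [show 0 < L2 by positivity]
    refine ⟨h1.trans hle, h2.trans hle, fun y hy => ⟨(h3 y hy).1.trans (by gcongr), (h3 y hy).2.trans (by gcongr)⟩⟩

end part9

section part10

section wwcalc
open Filter Topology
variable {E F : Type*} [NormedAddCommGroup E] [NormedSpace ℝ E] [NormedAddCommGroup F] [NormedSpace ℝ F]

theorem ulim_exists {ι W : Type*} [NormedAddCommGroup W] [ProperSpace W] (U : Ultrafilter ι) {g : ι → W} {c : W} {M : ℝ}
    (h : ∀ᶠ i in (U : Filter ι), ‖g i - c‖ ≤ M) : ∃ a, Tendsto g U (𝓝 a) ∧ ‖a - c‖ ≤ M := by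
  have h1 : closedBall c M ∈ U.map g := by
    rw [Ultrafilter.mem_map]
    filter_upwards [h] with i hi
    rw [mem_preimage, mem_closedBall, dist_eq_norm]; exact hi
  obtain ⟨a, ha, hle⟩ := (isCompact_closedBall c M).ultrafilter_le_nhds' (U.map g) h1
  refine ⟨a, hle, ?_⟩
  rwa [mem_closedBall, dist_eq_norm] at ha

theorem tendsto_clm_app {ι : Type*} {l : Filter ι} {A : ι → E →L[ℝ] F} {a : E →L[ℝ] F} {v : ι → E} {w : E}
    (hA : Tendsto A l (𝓝 a)) (hv : Tendsto v l (𝓝 w)) : Tendsto (fun i => A i (v i)) l (𝓝 (a w)) :=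
  (isBoundedBilinearMap_apply.continuous.tendsto (a, w)).comp (hA.prodMk_nhds hv)

theorem WW.mono {γ M M' : ℝ} {S : Set E} {f : E → F} {A : E → E →L[ℝ] F} (h : WW γ M S f A) (hM : M ≤ M') :
    WW γ M' S f A := by
  intro x hx
  obtain ⟨h1, h2, h3⟩ := h x hx
  exact ⟨h1.trans hM, h2.trans hM, fun y hy => ⟨(h3 y hy).1.trans (by gcongr), (h3 y hy).2.trans (by gcongr)⟩⟩

theorem WW.closure [ProperSpace (E →L[ℝ] F)] {γ M : ℝ} (hγ : 0 < γ) {S : Set E} {f : E → F} {A : E → E →L[ℝ] F}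
    (h : WW γ M S f A) (hf : Continuous f) : ∃ A', WW γ M (closure S) f A' := by
  have hex : ∀ x ∈ _root_.closure S, ∃ u : Ultrafilter E, S ∈ u ∧ (u : Filter E) ≤ 𝓝 x ∧
      ∃ a, Tendsto A u (𝓝 a) ∧ ‖a - 0‖ ≤ M := by
    intro x hx
    obtain ⟨u, hu, hux⟩ := mem_closure_iff_ultrafilter.1 hx
    refine ⟨u, hu, hux, ulim_exists u ?_⟩
    filter_upwards [hu] with z hz
    rw [sub_zero]; exact (h z hz).2.1
  choose! u hu hux A' hA' hA'b using hex
  refine ⟨A', fun x hx => ⟨?_, by simpa using hA'b x hx, fun y hy => ?_⟩⟩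
  · exact closure_minimal (fun z hz => (h z hz).1) (isClosed_le (f := fun z => ‖f z‖) (by fun_prop) continuous_const) hx
  · set l := (u x : Filter E) ×ˢ (u y : Filter E)
    have t1 : Tendsto (fun q : E × E => q.1) l (𝓝 x) := tendsto_fst.mono_right (hux x hx)
    have t2 : Tendsto (fun q : E × E => q.2) l (𝓝 y) := tendsto_snd.mono_right (hux y hy)
    have a1 : Tendsto (fun q : E × E => A q.1) l (𝓝 (A' x)) := (hA' x hx).comp tendsto_fst
    have a2 : Tendsto (fun q : E × E => A q.2) l (𝓝 (A' y)) := (hA' y hy).comp tendsto_snd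
    have f1 : Tendsto (fun q : E × E => f q.1) l (𝓝 (f x)) := (hf.tendsto x).comp t1
    have f2 : Tendsto (fun q : E × E => f q.2) l (𝓝 (f y)) := (hf.tendsto y).comp t2
    have tn := (t1.sub t2).norm
    have hev : ∀ᶠ q in l, q.1 ∈ S ∧ q.2 ∈ S := Filter.prod_mem_prod (hu x hx) (hu y hy)
    constructor
    · refine le_of_tendsto_of_tendsto (a1.sub a2).norm ((tn.rpow_const (Or.inr hγ.le)).const_mul M) ?_
      filter_upwards [hev] with q hq
      exact ((h _ hq.1).2.2 _ hq.2).1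
    · refine le_of_tendsto_of_tendsto ((f1.sub f2).sub (tendsto_clm_app a2 (t1.sub t2))).norm
        ((tn.rpow_const (p := 1 + γ) (Or.inr (by linarith))).const_mul M) ?_
      filter_upwards [hev] with q hq
      exact ((h _ hq.1).2.2 _ hq.2).2

theorem WW.ulim [ProperSpace (E →L[ℝ] F)] {ι : Type*} (U : Ultrafilter ι) {γ M : ℝ} {S : Set E} {f : ι → E → F}
    {g : E → F} (h : ∀ᶠ i in (U : Filter ι), ∃ A, WW γ M S (f i) A)
    (hf : ∀ x ∈ S, Tendsto (fun i => f i x) U (𝓝 (g x))) : ∃ A', WW γ M S g A' := by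
  classical
  have hA : ∃ A : ι → E → E →L[ℝ] F, ∀ᶠ i in (U : Filter ι), WW γ M S (f i) (A i) := by
    refine ⟨fun i => if hi : ∃ A, WW γ M S (f i) A then hi.choose else 0, ?_⟩
    filter_upwards [h] with i hi
    rw [dif_pos hi]; exact hi.choose_spec
  obtain ⟨A, hA⟩ := hA
  have hex : ∀ x ∈ S, ∃ a, Tendsto (fun i => A i x) U (𝓝 a) ∧ ‖a - 0‖ ≤ M := by
    intro x hx
    apply ulim_exists
    filter_upwards [hA] with i hi
    rw [sub_zero]; exact (hi x hx).2.1
  choose! A' hA' hA'b using hex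
  refine ⟨A', fun x hx => ⟨?_, by simpa using hA'b x hx, fun y hy => ⟨?_, ?_⟩⟩⟩
  · refine le_of_tendsto (hf x hx).norm ?_
    filter_upwards [hA] with i hi using (hi x hx).1
  · refine le_of_tendsto ((hA' x hx).sub (hA' y hy)).norm ?_
    filter_upwards [hA] with i hi using ((hi x hx).2.2 y hy).1
  · refine le_of_tendsto (((hf x hx).sub (hf y hy)).sub (tendsto_clm_app (hA' y hy) tendsto_const_nhds)).norm ?_
    filter_upwards [hA] with i hi using ((hi x hx).2.2 y hy).2

theorem WW.add_smul {γ M N h : ℝ} {S : Set E} {f g : E → F} {A B : E → E →L[ℝ] F} (hf : WW γ M S f A)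
    (hg : WW γ N S g B) : WW γ (M + |h| * N) S (fun x => f x + h • g x) (fun x => A x + h • B x) := by
  have key : ∀ {W : Type _} [NormedAddCommGroup W] [NormedSpace ℝ W] (a b : W) (s t : ℝ), ‖a‖ ≤ s → ‖b‖ ≤ t →
      ‖a + h • b‖ ≤ s + |h| * t := by
    intro W _ _ a b s t ha hb
    refine (norm_add_le _ _).trans ?_
    rw [norm_smul, Real.norm_eq_abs]
    gcongr
  intro x hx
  obtain ⟨f1, f2, f3⟩ := hf x hx
  obtain ⟨g1, g2, g3⟩ := hg x hx
  refine ⟨?_, ?_, fun y hy => ⟨?_, ?_⟩⟩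
  · refine (norm_add_le _ _).trans ?_
    rw [norm_smul, Real.norm_eq_abs]
    gcongr
  · exact key _ _ _ _ f2 g2
  · rw [show A x + h • B x - (A y + h • B y) = (A x - A y) + h • (B x - B y) by rw [smul_sub]; abel]
    refine (key _ _ _ _ (f3 y hy).1 (g3 y hy).1).trans (le_of_eq (by ring))
  · have : f x + h • g x - (f y + h • g y) - (A y + h • B y) (x - y) = (f x - f y - A y (x - y)) + h • (g x - g y - B y (x - y)) := by
      simp only [_root_.add_apply, _root_.smul_apply, smul_sub]; abel
    rw [this]
    refine (norm_add_le _ _).trans ?_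
    rw [norm_smul, Real.norm_eq_abs]
    have := mul_le_mul_of_nonneg_left (g3 y hy).2 (abs_nonneg h)
    linarith [(f3 y hy).2]

theorem WW.comp {γ M ε : ℝ} (hγ : γ ∈ Ioo (0:ℝ) 1) {S T : Set E} {f : E → E} {g : E → F} {A : E → E →L[ℝ] E}
    {B : E → E →L[ℝ] F} (hf : WW γ ε S f A) (hε : ε ≤ 1) (hg : WW γ M T g B) (hST : ∀ x ∈ S, x + f x ∈ T) :
    WW γ (10 * M) S (fun x => g (x + f x)) (fun x => (B (x + f x)).comp (ContinuousLinearMap.id ℝ E + A x)) := by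
  have hI : ∀ x ∈ S, ‖ContinuousLinearMap.id ℝ E + A x‖ ≤ 2 := by
    intro x hx
    refine (norm_add_le _ _).trans ?_
    linarith [ContinuousLinearMap.norm_id_le (𝕜 := ℝ) (E := E), (hf x hx).2.1]
  intro x hx
  obtain ⟨f1, f2, f3⟩ := hf x hx
  obtain ⟨g1, g2, g3⟩ := hg _ (hST x hx)
  have hM : 0 ≤ M := (norm_nonneg _).trans g1
  have hε0 : 0 ≤ ε := (norm_nonneg _).trans f1
  refine ⟨by linarith, ?_, fun y hy => ?_⟩
  · refine (ContinuousLinearMap.opNorm_comp_le _ _).trans ?_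
    calc _ ≤ M * 2 := by gcongr; exact hI x hx
      _ ≤ _ := by linarith
  obtain ⟨k1, k2, -⟩ := hg _ (hST y hy)
  obtain ⟨g4, g5⟩ := g3 _ (hST y hy)
  obtain ⟨f4, f5⟩ := f3 y hy
  set r := ‖x - y‖ with hr
  have hr0 : 0 ≤ r := norm_nonneg _
  have hrγ : 0 ≤ r ^ γ := by positivity
  have hrγ1 : 0 ≤ r ^ (1 + γ) := by positivity
  have hlip : ‖x + f x - (y + f y)‖ ≤ 3 * r := by
    rw [show x + f x - (y + f y) = (x - y) + (f x - f y) by abel]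
    refine (norm_add_le _ _).trans ?_
    have := hf.lip hγ.1 hx hy
    have : 2 * ε * r ≤ 2 * 1 * r := by gcongr
    linarith
  have p1 : ‖x + f x - (y + f y)‖ ^ γ ≤ 3 * r ^ γ := by
    calc _ ≤ (3 * r) ^ γ := Real.rpow_le_rpow (norm_nonneg _) hlip hγ.1.le
      _ = 3 ^ γ * r ^ γ := Real.mul_rpow (by norm_num) hr0
      _ ≤ 3 * r ^ γ := by
        gcongr
        calc (3:ℝ) ^ γ ≤ 3 ^ (1:ℝ) := Real.rpow_le_rpow_of_exponent_le (by norm_num) hγ.2.le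
          _ = 3 := by simp
  have p2 : ‖x + f x - (y + f y)‖ ^ (1 + γ) ≤ 9 * r ^ (1 + γ) := by
    calc _ ≤ (3 * r) ^ (1 + γ) := Real.rpow_le_rpow (norm_nonneg _) hlip (by linarith [hγ.1])
      _ = 3 ^ (1 + γ) * r ^ (1 + γ) := Real.mul_rpow (by norm_num) hr0
      _ ≤ 9 * r ^ (1 + γ) := by
        gcongr
        calc (3:ℝ) ^ (1 + γ) ≤ 3 ^ (2:ℝ) := Real.rpow_le_rpow_of_exponent_le (by norm_num) (by linarith [hγ.2])
          _ = 9 := by norm_num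
  constructor
  · have e : (B (x + f x)).comp (ContinuousLinearMap.id ℝ E + A x) - (B (y + f y)).comp (ContinuousLinearMap.id ℝ E + A y)
        = (B (x + f x) - B (y + f y)).comp (ContinuousLinearMap.id ℝ E + A x) + (B (y + f y)).comp (A x - A y) := by
      ext v
      simp
      abel
    rw [e]
    calc _ ≤ ‖B (x + f x) - B (y + f y)‖ * ‖ContinuousLinearMap.id ℝ E + A x‖ + ‖B (y + f y)‖ * ‖A x - A y‖ :=
          (norm_add_le _ _).trans (add_le_add (ContinuousLinearMap.opNorm_comp_le _ _) (ContinuousLinearMap.opNorm_comp_le _ _))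
      _ ≤ (M * (3 * r ^ γ)) * 2 + M * (1 * r ^ γ) := by
        gcongr
        · exact g4.trans (by gcongr)
        · exact hI x hx
        · exact f4.trans (by gcongr)
      _ ≤ _ := by nlinarith [mul_nonneg hM hrγ]
  · have e : g (x + f x) - g (y + f y) - ((B (y + f y)).comp (ContinuousLinearMap.id ℝ E + A y)) (x - y)
        = (g (x + f x) - g (y + f y) - B (y + f y) (x + f x - (y + f y))) + B (y + f y) (f x - f y - A y (x - y)) := by
      simp only [ContinuousLinearMap.comp_apply, _root_.add_apply, ContinuousLinearMap.id_apply, map_add, map_sub]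
      abel
    rw [e]
    calc _ ≤ M * (9 * r ^ (1 + γ)) + M * (1 * r ^ (1 + γ)) := by
          refine (norm_add_le _ _).trans (add_le_add (g5.trans (by gcongr)) ?_)
          refine ((B (y + f y)).le_opNorm _).trans ?_
          gcongr
          exact f5.trans (by gcongr)
      _ = _ := by ring

end wwcalc

end part10

section part11

section pnimage
variable {E : Type*} [NormedAddCommGroup E] [InnerProductSpace ℝ E]

theorem PN.abs_frontier {γ A : ℝ} {D : Set E} {n : E → E} (hγ : 0 < γ) (hDo : IsOpen D) (hD : PN γ A D n)
    {p y : E} (hp : p ∈ frontier D) (hy : y ∈ frontier D) : |⟪y - p, n p⟫| ≤ A * ‖y - p‖ ^ (1 + γ) := by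
  obtain ⟨-, h2⟩ := hD p hp
  have hcont : Continuous (fun z : E => A * ‖z - p‖ ^ (1 + γ)) :=
    continuous_const.mul ((continuous_id.sub continuous_const).norm.rpow_const (fun _ => Or.inr (by linarith)))
  rw [abs_le]
  constructor
  · by_contra hc
    push Not at hc
    have := (h2 y).1 hc
    rw [frontier, hDo.interior_eq] at hy
    exact hy.2 this
  · have hcl : IsClosed {z : E | ⟪z - p, n p⟫ ≤ A * ‖z - p‖ ^ (1 + γ)} := isClosed_le (by fun_prop) hcont
    refine closure_minimal (fun z hz => ?_) hcl (frontier_subset_closure hy)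
    by_contra hc
    exact (h2 z).2 (not_le.mp hc) hz

theorem convex_cusp (γ A : ℝ) (hγ : 0 < γ) (hA : 0 ≤ A) (p n : E) :
    Convex ℝ {y : E | ⟪y - p, n⟫ < -(A * ‖y - p‖ ^ (1 + γ))} := by
  intro x hx y hy a b ha hb hab
  simp only [mem_ofPred_eq] at hx hy ⊢
  have e : a • x + b • y - p = a • (x - p) + b • (y - p) := by
    rw [smul_sub, smul_sub]
    have : p = a • p + b • p := by rw [← add_smul, hab, one_smul]
    nth_rewrite 1 [this]
    abel
  rw [e, inner_add_left, inner_smul_left, inner_smul_left]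
  simp only [conj_trivial]
  have h1 : ‖a • (x - p) + b • (y - p)‖ ≤ a * ‖x - p‖ + b * ‖y - p‖ := by
    refine (norm_add_le _ _).trans ?_
    rw [norm_smul, norm_smul, Real.norm_of_nonneg ha, Real.norm_of_nonneg hb]
  have h2 : ‖a • (x - p) + b • (y - p)‖ ^ (1 + γ) ≤ a * ‖x - p‖ ^ (1 + γ) + b * ‖y - p‖ ^ (1 + γ) := by
    refine (Real.rpow_le_rpow (norm_nonneg _) h1 (by linarith)).trans ?_
    have := (convexOn_rpow (p := 1 + γ) (by linarith)).2 (norm_nonneg (x - p)) (norm_nonneg (y - p)) ha hb hab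
    simpa only [smul_eq_mul] using this
  have h3 : A * ‖a • (x - p) + b • (y - p)‖ ^ (1 + γ) ≤ a * (A * ‖x - p‖ ^ (1 + γ)) + b * (A * ‖y - p‖ ^ (1 + γ)) := by
    calc _ ≤ A * (a * ‖x - p‖ ^ (1 + γ) + b * ‖y - p‖ ^ (1 + γ)) := by gcongr
      _ = _ := by ring
  rcases ha.eq_or_lt with h0 | h0
  · subst h0
    have : b = 1 := by linarith
    subst this
    linarith
  · have h4 := mul_lt_mul_of_pos_left hx h0
    have h5 := mul_le_mul_of_nonneg_left hy.le hb
    linarith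

theorem PN.image [CompleteSpace E] {γ Q ε : ℝ} {D : Set E} {n : E → E} (hγ : γ ∈ Ioo (0:ℝ) 1) (hQ : 0 ≤ Q) (hDo : IsOpen D)
    (hD : PN γ Q D n) (hε : ε ≤ 1 / 4) {f : E → E} {A : E → E →L[ℝ] E} (hf : WW γ ε (closure D) f A)
    (hlip : ∀ x y, ‖f x - f y‖ ≤ ε * ‖x - y‖) (X : E ≃ₜ E) (hX : ∀ x, X x = x + f x) :
    ∃ n', PN γ (3 * Q + 2) (X '' D) n' := by
  have key : ∀ p ∈ frontier (X '' D), ∃ m : E, ‖m‖ = 1 ∧ ∀ y, (⟪y - p, m⟫ < -((3 * Q + 2) * ‖y - p‖ ^ (1 + γ)) → y ∈ X '' D) ∧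
    ((3 * Q + 2) * ‖y - p‖ ^ (1 + γ) < ⟪y - p, m⟫ → y ∉ X '' D) := by
    intro p hp
    have hXo : IsOpen (X '' D) := X.isOpenMap D hDo
    have hpf := hp
    rw [← X.image_frontier] at hp
    obtain ⟨q, hq, rfl⟩ := hp
    obtain ⟨hn, hpn⟩ := hD q hq
    have hqc := frontier_subset_closure hq
    have hε0 : 0 ≤ ε := (norm_nonneg _).trans (hf q hqc).1
    set B := ContinuousLinearMap.adjoint (A q) with hB
    have hBn : ‖B‖ ≤ ε := by rw [hB, LinearIsometryEquiv.norm_map]; exact (hf q hqc).2.1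
    obtain ⟨m, hm⟩ : ∃ m : E, m + B m = n q := by
      have hlt : ‖-B‖ < 1 := by rw [norm_neg]; linarith
      refine ⟨(↑(Units.oneSub (-B) hlt)⁻¹ : E →L[ℝ] E) (n q), ?_⟩
      have := congrArg (fun T : E →L[ℝ] E => T (n q)) (Units.oneSub (-B) hlt).mul_inv
      simpa [Units.val_oneSub] using this
    have hBm : ‖B m‖ ≤ 1 / 4 * ‖m‖ := (B.le_opNorm m).trans (by gcongr; linarith)
    have hm1 : ‖m‖ ≤ 4 / 3 := by
      have : ‖m‖ ≤ ‖n q‖ + ‖B m‖ := by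
        calc ‖m‖ = ‖n q - B m‖ := by rw [← hm]; simp
          _ ≤ _ := norm_sub_le _ _
      linarith
    have hm2 : 4 / 5 ≤ ‖m‖ := by
      have : ‖n q‖ ≤ ‖m‖ + ‖B m‖ := by rw [← hm]; exact norm_add_le _ _
      linarith
    have hmn : 2 / 3 ≤ ⟪n q, m⟫ := by
      have h1 : m = n q - B m := by rw [← hm]; simp
      have h2 : ⟪n q, m⟫ = 1 - ⟪n q, B m⟫ := by
        nth_rewrite 1 [h1]
        rw [inner_sub_right, real_inner_self_eq_norm_sq, hn]; norm_num
      have h3 := real_inner_le_norm (n q) (B m)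
      rw [hn, one_mul] at h3
      linarith
    have hmpos : 0 < ‖m‖ := by linarith
    set n' := ‖m‖⁻¹ • m with hn'
    have hin : ∀ v, ⟪v, n'⟫ = ‖m‖⁻¹ * ⟪v, m⟫ := fun v => by rw [hn', inner_smul_right]
    have hinv1 : ‖m‖⁻¹ ≤ 5 / 4 := by
      rw [inv_le_comm₀ hmpos (by norm_num)]; linarith
    have hinv2 : 3 / 4 ≤ ‖m‖⁻¹ := by
      rw [le_inv_comm₀ (by norm_num) hmpos]; linarith
    have hXd : ∀ x y, X x - X y = (x - y) + (f x - f y) := fun x y => by rw [hX, hX]; abel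
    have hup : ∀ x y, ‖X x - X y‖ ≤ 2 * ‖x - y‖ := fun x y => by
      rw [hXd]
      have := mul_le_mul_of_nonneg_right hε (norm_nonneg (x - y))
      linarith [norm_add_le (x - y) (f x - f y), hlip x y, norm_nonneg (x - y)]
    have hlow : ∀ x y, ‖x - y‖ ≤ 4 / 3 * ‖X x - X y‖ := fun x y => by
      rw [hXd]
      have := mul_le_mul_of_nonneg_right hε (norm_nonneg (x - y))
      have h2 := norm_sub_le ((x - y) + (f x - f y)) (f x - f y)
      rw [add_sub_cancel_right] at h2
      linarith [hlip x y, norm_nonneg (x - y)]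
    -- frontier points
    have hfr : ∀ y ∈ frontier (X '' D), |⟪y - X q, n'⟫| ≤ (3 * Q + 2) * ‖y - X q‖ ^ (1 + γ) := by
      intro y hy
      rw [← X.image_frontier] at hy
      obtain ⟨q', hq', rfl⟩ := hy
      have h1 := hD.abs_frontier hγ.1 hDo hq hq'
      have h2 := ((hf q' (frontier_subset_closure hq')).2.2 q hqc).2
      set r := ‖q' - q‖ ^ (1 + γ) with hr
      have hr0 : 0 ≤ r := by positivity
      have e : ⟪X q' - X q, m⟫ = ⟪q' - q, n q⟫ + ⟪f q' - f q - A q (q' - q), m⟫ := by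
        rw [hXd, inner_add_left, inner_sub_left (f q' - f q), ← hm, inner_add_right, hB, ContinuousLinearMap.adjoint_inner_right]
        ring
      have h3 : |⟪f q' - f q - A q (q' - q), m⟫| ≤ 1 / 3 * r := by
        refine (abs_real_inner_le_norm _ _).trans ?_
        calc _ ≤ (1 / 4 * r) * (4 / 3) := by
              gcongr
              exact h2.trans (by gcongr)
          _ = _ := by ring
      have h4 : |⟪X q' - X q, m⟫| ≤ (Q + 1 / 3) * r := by
        rw [e]
        refine (abs_add_le _ _).trans ?_
        linarith
      have h5 : r ≤ 16 / 9 * ‖X q' - X q‖ ^ (1 + γ) := by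
        rw [hr]
        calc _ ≤ (4 / 3 * ‖X q' - X q‖) ^ (1 + γ) := Real.rpow_le_rpow (norm_nonneg _) (hlow _ _) (by linarith [hγ.1])
          _ = (4 / 3) ^ (1 + γ) * ‖X q' - X q‖ ^ (1 + γ) := Real.mul_rpow (by norm_num) (norm_nonneg _)
          _ ≤ _ := by
            gcongr
            calc (4 / 3 : ℝ) ^ (1 + γ) ≤ (4 / 3) ^ (2:ℝ) := Real.rpow_le_rpow_of_exponent_le (by norm_num) (by linarith [hγ.2])
              _ = 16 / 9 := by norm_num
      rw [hin, abs_mul, abs_of_pos (by positivity)]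
      set w := ‖X q' - X q‖ ^ (1 + γ)
      have hw : 0 ≤ w := by positivity
      calc _ ≤ 5 / 4 * ((Q + 1 / 3) * (16 / 9 * w)) := by
            gcongr
            exact h4.trans (by gcongr)
        _ ≤ _ := by nlinarith [mul_nonneg hQ hw]
    obtain ⟨s, hs, hs'⟩ := exists_r0 γ hγ.1 (2 * (3 * Q + 2 + Q)) (by positivity)
    have hs17 : (2 * s) ^ γ ≤ (17 * s) ^ γ := Real.rpow_le_rpow (by positivity) (by linarith) hγ.1.le
    have hs1 : s ^ γ ≤ (17 * s) ^ γ := Real.rpow_le_rpow (by positivity) (by linarith) hγ.1.le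
    have hpw : 0 < (17 * s) ^ γ := by positivity
    have hQs : Q * s ^ (1 + γ) < s := by
      rw [Real.rpow_one_add' hs.le (by linarith [hγ.1])]
      have : Q * s ^ γ ≤ Q * (17 * s) ^ γ := by gcongr
      have h3 : Q * s ^ γ < 1 := by nlinarith
      nlinarith
    have hAs : ∀ v : E, ‖v‖ ≤ 2 * s → (3 * Q + 2) * ‖v‖ ^ (1 + γ) < s / 4 := by
      intro v hv
      calc (3 * Q + 2) * ‖v‖ ^ (1 + γ) ≤ (3 * Q + 2) * (2 * s) ^ (1 + γ) := by
            gcongr; linarith [hγ.1]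
        _ = (2 * (3 * Q + 2) * (2 * s) ^ γ) * s := by
            rw [Real.rpow_one_add' (by positivity) (by linarith [hγ.1])]; ring
        _ ≤ (1 / 6) * s := by
            gcongr
            have : 2 * (3 * Q + 2) * (2 * s) ^ γ ≤ 2 * (3 * Q + 2) * (17 * s) ^ γ := by gcongr
            nlinarith [mul_nonneg hQ hpw.le]
        _ < s / 4 := by linarith
    have hns : ‖s • n q‖ = s := by rw [norm_smul, hn, Real.norm_of_nonneg hs.le, mul_one]
    have hfi : ∀ v, ‖v‖ ≤ ε * s → |⟪v, m⟫| ≤ s / 3 := by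
      intro v hv
      refine (abs_real_inner_le_norm _ _).trans ?_
      calc _ ≤ (1 / 4 * s) * (4 / 3) := by
            gcongr
            exact hv.trans (by gcongr)
        _ = _ := by ring
    have hmd : q - s • n q ∈ D := by
      apply (hpn _).1
      have e : q - s • n q - q = -(s • n q) := by abel
      rw [e, norm_neg, hns, inner_neg_left, inner_smul_left, real_inner_self_eq_norm_sq, hn]
      simp; linarith
    have hpd : q + s • n q ∉ D := by
      apply (hpn _).2
      have e : q + s • n q - q = s • n q := by abel
      rw [e, hns, inner_smul_left, real_inner_self_eq_norm_sq, hn]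
      simp; linarith
    have hsm : 2 / 3 * s ≤ s * ⟪n q, m⟫ := by nlinarith
    refine ⟨n', ?_, fun y => ⟨fun hy => ?_, fun hy hyD => ?_⟩⟩
    · rw [hn', norm_smul, norm_inv, norm_norm, inv_mul_cancel₀ hmpos.ne']
    · by_contra hyD
      have hc := convex_cusp γ (3 * Q + 2) hγ.1 (by positivity) (X q) n'
      obtain ⟨z, hz1, hz2⟩ := precon_frontier hc.isPreconnected (G := X '' D)
        ⟨X (q - s • n q), by
          simp only [mem_ofPred_eq]
          have hb := hup (q - s • n q) q
          have e : q - s • n q - q = -(s • n q) := by abel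
          have hfl := hlip (q - s • n q) q
          rw [e, norm_neg, hns] at hb hfl
          have h6 := hAs _ hb
          have h7 := abs_le.mp (hfi _ hfl)
          have h8 : ⟪X (q - s • n q) - X q, m⟫ ≤ -(s / 3) := by
            rw [hXd, e, inner_add_left, inner_neg_left, inner_smul_left, conj_trivial]
            linarith
          rw [hin]
          nlinarith, mem_image_of_mem X hmd⟩ ⟨y, hy, hyD⟩
      have := (abs_le.mp (hfr z hz2)).1
      simp only [mem_ofPred_eq] at hz1
      linarith
    · have hc := convex_cusp γ (3 * Q + 2) hγ.1 (by positivity) (X q) (-n')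
      obtain ⟨z, hz1, hz2⟩ := precon_frontier hc.isPreconnected (G := X '' D)
        ⟨y, by simp only [mem_ofPred_eq, inner_neg_right]; linarith, hyD⟩
        ⟨X (q + s • n q), by
          simp only [mem_ofPred_eq, inner_neg_right]
          have hb := hup (q + s • n q) q
          have e : q + s • n q - q = s • n q := by abel
          have hfl := hlip (q + s • n q) q
          rw [e, hns] at hb hfl
          have h6 := hAs _ hb
          have h7 := abs_le.mp (hfi _ hfl)
          have h8 : (s / 3) ≤ ⟪X (q + s • n q) - X q, m⟫ := by
            rw [hXd, e, inner_add_left, inner_smul_left, conj_trivial]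
            linarith
          rw [hin]
          nlinarith, by
          rintro ⟨z, hz, hze⟩
          rw [X.injective hze] at hz
          exact hpd hz⟩
      have := (abs_le.mp (hfr z hz2)).2
      simp only [mem_ofPred_eq, inner_neg_right] at hz1
      linarith
  choose! n' hn' using key
  exact ⟨n', fun p hp => hn' p hp⟩

end pnimage

end part11

section part12

theorem vol_zero_of_haus (d : ℕ) (S : Set (EuclideanSpace ℝ (Fin d))) (h : μH[(d:ℝ) - 1] S ≠ ⊤) : volume S = 0 := by
  have h1 : μH[(d:ℝ)] S = 0 := by
    rcases Measure.hausdorffMeasure_zero_or_top (show (d:ℝ) - 1 < d by linarith) S with h2 | h2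
    · exact h2
    · exact absurd h2 h
  have h3 : (μH[(d:ℝ)] : Measure (EuclideanSpace ℝ (Fin d))).IsAddHaarMeasure := by
    have := MeasureTheory.isAddHaarMeasure_hausdorffMeasure (E := EuclideanSpace ℝ (Fin d))
    rwa [finrank_euclideanSpace_fin] at this
  exact Measure.absolutelyContinuous_isAddHaarMeasure volume μH[(d:ℝ)] h1

theorem vol_zero_image (d : ℕ) (hd : 2 ≤ d) (S : Set (EuclideanSpace ℝ (Fin d))) (h : μH[(d:ℝ) - 1] S ≠ ⊤)
    (X : EuclideanSpace ℝ (Fin d) → EuclideanSpace ℝ (Fin d)) (K : NNReal) (hX : LipschitzWith K X) : volume (X '' S) = 0 := by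
  have hd1 : (2:ℝ) ≤ d := by exact_mod_cast hd
  apply vol_zero_of_haus
  have h1 := hX.hausdorffMeasure_image_le (show 0 ≤ (d:ℝ) - 1 by linarith) S
  refine ne_top_of_le_ne_top (ENNReal.mul_ne_top ?_ h) h1
  exact ENNReal.rpow_ne_top_of_nonneg (by linarith) ENNReal.coe_ne_top

theorem exists_homeo {E : Type*} [NormedAddCommGroup E] [NormedSpace ℝ E] [CompleteSpace E] {f : E → E} {ε : ℝ}
    (hε : ε ≤ 1 / 4) (hlip : ∀ x y, ‖f x - f y‖ ≤ ε * ‖x - y‖) : ∃ X : E ≃ₜ E, ∀ x, X x = x + f x := by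
  rcases subsingleton_or_nontrivial E with hs | hs
  · exact ⟨Homeomorph.refl E, fun x => Subsingleton.elim _ _⟩
  have ha : ApproximatesLinearOn (fun x => x + f x) ((ContinuousLinearEquiv.refl ℝ E : E ≃L[ℝ] E) : E →L[ℝ] E) univ (1/4 : NNReal) := by
    rw [ApproximatesLinearOn.approximatesLinearOn_iff_lipschitzOnWith, lipschitzOnWith_univ]
    apply LipschitzWith.of_dist_le_mul
    intro x y
    rw [dist_eq_norm, dist_eq_norm]
    have e : ((fun x => x + f x) - ⇑((ContinuousLinearEquiv.refl ℝ E : E ≃L[ℝ] E) : E →L[ℝ] E)) = f := by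
      ext z; simp
    rw [e]
    refine (hlip x y).trans ?_
    gcongr
    simpa using hε
  refine ⟨ha.toHomeomorph _ (Or.inr ?_), fun x => rfl⟩
  have : ‖((ContinuousLinearEquiv.refl ℝ E : E ≃L[ℝ] E).symm : E →L[ℝ] E)‖₊ = 1 := by
    ext
    simp
  rw [this]
  rw [← NNReal.coe_lt_coe]
  norm_num

theorem defining_PN {d : ℕ} {γ : ℝ} (hγ : 0 < γ) {D : Set (EuclideanSpace ℝ (Fin d))} {Φ : EuclideanSpace ℝ (Fin d) → ℝ}
    {K m Q : ℝ} (hQ : 0 ≤ Q) (hΦ : IsDefining d γ D Φ) (hK : ∀ x y, ‖gradient Φ x - gradient Φ y‖ ≤ K * ‖x - y‖ ^ γ)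
    (hm : 0 < m) (hmD : ∀ x ∈ frontier D, m ≤ ‖gradient Φ x‖) (hKQ : K ≤ Q * m) :
    PN γ Q D (fun p => ‖gradient Φ p‖⁻¹ • gradient Φ p) := by
  obtain ⟨hC, -, hD, hfr, -⟩ := hΦ
  have hdiff : Differentiable ℝ Φ := hC.differentiable (by norm_num)
  have hQm : 0 ≤ Q * m := by positivity
  intro p hp
  have hg := hmD p hp
  have hgp : 0 < ‖gradient Φ p‖ := by linarith
  have hp0 : Φ p = 0 := by rw [hfr] at hp; exact hp
  have taylor : ∀ y, |Φ y - ⟪y - p, gradient Φ p⟫| ≤ Q * m * ‖y - p‖ ^ (1 + γ) := by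
    intro y
    have h1 := Convex.norm_image_sub_le_of_norm_hasFDerivWithin_le (𝕜 := ℝ) (s := closedBall p ‖y - p‖)
      (f := fun z => Φ z - fderiv ℝ Φ p z) (f' := fun z => fderiv ℝ Φ z - fderiv ℝ Φ p) (C := Q * m * ‖y - p‖ ^ γ)
      (x := p) (y := y)
      (fun z hz => ((hdiff z).hasFDerivAt.sub (fderiv ℝ Φ p).hasFDerivAt).hasFDerivWithinAt)
      (fun z hz => by
        rw [← toDual_gradient, ← toDual_gradient, ← map_sub, LinearIsometryEquiv.norm_map]
        refine (hK z p).trans ?_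
        rw [mem_closedBall, dist_eq_norm] at hz
        gcongr)
      (convex_closedBall p _) (mem_closedBall_self (norm_nonneg _)) (by rw [mem_closedBall, dist_eq_norm])
    have e : Φ y - fderiv ℝ Φ p y - (Φ p - fderiv ℝ Φ p p) = Φ y - ⟪y - p, gradient Φ p⟫ := by
      rw [hp0, real_inner_comm, ← toDual_gradient]
      simp only [InnerProductSpace.toDual_apply_apply, inner_sub_right]
      ring
    rw [e, Real.norm_eq_abs] at h1
    refine h1.trans (le_of_eq ?_)
    rw [Real.rpow_one_add' (norm_nonneg _) (by linarith)]
    ring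
  refine ⟨by rw [norm_smul, norm_inv, norm_norm, inv_mul_cancel₀ hgp.ne'], fun y => ?_⟩
  have t := abs_le.mp (taylor y)
  have hr : 0 ≤ ‖y - p‖ ^ (1 + γ) := by positivity
  have hle : Q * m * ‖y - p‖ ^ (1 + γ) ≤ ‖gradient Φ p‖ * (Q * ‖y - p‖ ^ (1 + γ)) := by
    have : Q * m * ‖y - p‖ ^ (1 + γ) = m * (Q * ‖y - p‖ ^ (1 + γ)) := by ring
    rw [this]; gcongr
  rw [inner_smul_right]
  set a := ⟪y - p, gradient Φ p⟫
  have ea : a = ‖gradient Φ p‖ * (‖gradient Φ p‖⁻¹ * a) := by field_simp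
  constructor
  · intro hy
    rw [hD]
    have h1 := mul_lt_mul_of_pos_left hy hgp
    show Φ y < 0
    linarith
  · intro hy
    rw [hD]
    have h1 := mul_lt_mul_of_pos_left hy hgp
    show ¬ (Φ y < 0)
    linarith

end part12

section part13

/-- admissible displacement -/
def Adm {E : Type*} [NormedAddCommGroup E] [NormedSpace ℝ E] (γ ε : ℝ) (D : Set E) (f : E → E) : Prop :=
  (∀ x y, ‖f x - f y‖ ≤ ε * ‖x - y‖) ∧ ∃ A, WW γ ε (closure D) f A

noncomputable def Vel (d : ℕ) (D : Set (EuclideanSpace ℝ (Fin d))) (f : EuclideanSpace ℝ (Fin d) → EuclideanSpace ℝ (Fin d))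
    (z : EuclideanSpace ℝ (Fin d)) : EuclideanSpace ℝ (Fin d) :=
  ∫ w in (fun x => x + f x) '' D, gradN d (z - w)

/-- admissible initial domain -/
structure Dom (d : ℕ) (γ Q R : ℝ) (D : Set (EuclideanSpace ℝ (Fin d))) (n : EuclideanSpace ℝ (Fin d) → EuclideanSpace ℝ (Fin d))
    (c : EuclideanSpace ℝ (Fin d)) : Prop where
  isOpen : IsOpen D
  ne : D.Nonempty
  sub : D ⊆ ball c R
  pn : PN γ Q D n
  haus : μH[(d:ℝ) - 1] (frontier D) ≠ ⊤

theorem adm_image {d : ℕ} (hd : 2 ≤ d) {γ : ℝ} (hγ : γ ∈ Ioo (0:ℝ) 1) {Q : ℝ} (hQ : 0 ≤ Q) {R : ℝ}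
    {D : Set (EuclideanSpace ℝ (Fin d))} {n : EuclideanSpace ℝ (Fin d) → EuclideanSpace ℝ (Fin d)}
    {c : EuclideanSpace ℝ (Fin d)} (hD : Dom d γ Q R D n c) {f : EuclideanSpace ℝ (Fin d) → EuclideanSpace ℝ (Fin d)}
    (hf : Adm γ (1/4) D f) :
    ∃ X : EuclideanSpace ℝ (Fin d) ≃ₜ EuclideanSpace ℝ (Fin d), (∀ x, X x = x + f x) ∧
      (fun x => x + f x) '' D = X '' D ∧ IsOpen (X '' D) ∧ (X '' D) ⊆ ball c (R + 1) ∧ (∃ n', PN γ (3 * Q + 2) (X '' D) n') ∧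
      volume (frontier (X '' D)) = 0 := by
  obtain ⟨hlip, A, hA⟩ := hf
  obtain ⟨X, hX⟩ := exists_homeo le_rfl hlip
  have hXf : (fun x => x + f x) = X := funext fun x => (hX x).symm
  refine ⟨X, hX, by rw [hXf], X.isOpenMap D hD.isOpen, ?_, hD.pn.image hγ hQ hD.isOpen le_rfl hA hlip X hX, ?_⟩
  · rintro _ ⟨x, hx, rfl⟩
    have h1 := (hA x (subset_closure hx)).1
    have h2 := hD.sub hx
    rw [mem_ball, dist_eq_norm] at h2 ⊢
    rw [hX, show x + f x - c = (x - c) + f x by abel]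
    linarith [norm_add_le (x - c) (f x)]
  · rw [← X.image_frontier]
    apply vol_zero_image d hd _ hD.haus X 2
    apply LipschitzWith.of_dist_le_mul
    intro x y
    rw [dist_eq_norm, dist_eq_norm, hX, hX, show x + f x - (y + f y) = (x - y) + (f x - f y) by abel]
    have := hlip x y
    have h3 := norm_add_le (x - y) (f x - f y)
    simp only [NNReal.coe_ofNat]
    linarith [norm_nonneg (x - y)]

theorem vel_bounds (d : ℕ) (hd : 2 ≤ d) (γ : ℝ) (hγ : γ ∈ Ioo (0:ℝ) 1) (Q : ℝ) (hQ : 0 ≤ Q) (R : ℝ) (hR : 0 < R) :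
    ∃ M : ℝ, 0 < M ∧ ∀ D n c, Dom d γ Q R D n c → ∀ f, Adm γ (1/4) D f →
      (∀ z, ‖Vel d D f z‖ ≤ M) ∧ (∀ x y, ‖Vel d D f x - Vel d D f y‖ ≤ M * ‖x - y‖) ∧
      ∃ A', WW γ M (closure D) (fun x => Vel d D f (x + f x)) A' := by
  obtain ⟨M, hM, hmain⟩ := V_main d hd γ hγ (3 * Q + 2) (by positivity) (R + 1) (by positivity)
  refine ⟨10 * M, by positivity, ?_⟩
  intro D n c hD f hf
  obtain ⟨X, hX, him, ho, hsub, ⟨n', hn'⟩, hvol⟩ := adm_image hd hγ hQ hD hf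
  obtain ⟨h1, h2, A', h3⟩ := hmain (X '' D) n' c ho (hD.ne.image X) hsub hn' hvol
  have hV : ∀ z, Vel d D f z = ∫ w in X '' D, gradN d (z - w) := fun z => by rw [Vel, him]
  have hVf : Vel d D f = fun z => ∫ w in X '' D, gradN d (z - w) := funext hV
  refine ⟨fun z => by rw [hV]; linarith [h1 z], fun x y => ?_, ?_⟩
  · rw [hV, hV]
    refine (h2 x y).trans ?_
    gcongr
    linarith
  · obtain ⟨A2, hA2⟩ := h3.closure hγ.1 (by
      have := V_cont d hd (X '' D) ho.measurableSet (isBounded_ball.subset hsub)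
      exact this)
    obtain ⟨hlip, A, hA⟩ := hf
    rw [hVf]
    refine ⟨_, hA.comp hγ (by norm_num) hA2 ?_⟩
    intro x hx
    rw [← hX, ← X.image_closure]
    exact mem_image_of_mem X hx

theorem vel_seq {d : ℕ} (hd : 2 ≤ d) {γ : ℝ} (hγ : γ ∈ Ioo (0:ℝ) 1) {Q : ℝ} (hQ : 0 ≤ Q) {R : ℝ}
    {D : Set (EuclideanSpace ℝ (Fin d))} {n : EuclideanSpace ℝ (Fin d) → EuclideanSpace ℝ (Fin d)}
    {c : EuclideanSpace ℝ (Fin d)} (hD : Dom d γ Q R D n c) {f : EuclideanSpace ℝ (Fin d) → EuclideanSpace ℝ (Fin d)}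
    (hf : Adm γ (1/4) D f) {g : ℕ → EuclideanSpace ℝ (Fin d) → EuclideanSpace ℝ (Fin d)}
    (hg : ∀ k, Adm γ (1/4) D (g k)) (hgf : ∀ k, ∀ z ∈ D, ‖g k z - f z‖ ≤ 1 / ((k:ℝ) + 1)) (x : EuclideanSpace ℝ (Fin d)) :
    Filter.Tendsto (fun k => Vel d D (g k) x) Filter.atTop (nhds (Vel d D f x)) := by
  set B := ball c (R + 1) with hB
  have hrep : ∀ f, Adm γ (1/4) D f → Vel d D f x = ∫ w in B, indicator ((fun x => x + f x) '' D) (fun w => gradN d (x - w)) w := by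
    intro f hf
    obtain ⟨X, hX, him, ho, hsub, -, -⟩ := adm_image hd hγ hQ hD hf
    rw [Vel, him, setIntegral_indicator ho.measurableSet, inter_eq_right.mpr hsub]
  have hlow : ∀ f, Adm γ (1/4) D f → ∀ a b, ‖a - b‖ ≤ 2 * ‖(a + f a) - (b + f b)‖ := by
    intro f hf a b
    have h1 := hf.1 a b
    have h2 := norm_sub_le ((a - b) + (f a - f b)) (f a - f b)
    rw [add_sub_cancel_right] at h2
    rw [show (a + f a) - (b + f b) = (a - b) + (f a - f b) by abel]
    linarith [norm_nonneg (a - b)]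
  rw [hrep f hf]
  simp_rw [hrep _ (hg _)]
  have hmeas : Measurable (fun w : EuclideanSpace ℝ (Fin d) => gradN d (x - w)) :=
    (measurable_gradN d).comp (measurable_const.sub measurable_id)
  have hlim : Filter.Tendsto (fun k : ℕ => 1 / ((k:ℝ) + 1)) Filter.atTop (nhds 0) := tendsto_one_div_add_atTop_nhds_zero_nat
  apply tendsto_integral_of_dominated_convergence (fun w => ‖gradN d (x - w)‖)
  · intro k
    obtain ⟨X, hX, him, ho, -⟩ := adm_image hd hγ hQ hD (hg k)
    rw [him]
    exact (hmeas.indicator ho.measurableSet).aestronglyMeasurable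
  · exact (integrableOn_gradN d hd x _ isBounded_ball).norm
  · intro k
    exact Filter.Eventually.of_forall fun w => norm_indicator_le_norm_self _ _
  · obtain ⟨X, hX, him, ho, hsub, -, hvol⟩ := adm_image hd hγ hQ hD hf
    have hae : ∀ᵐ w ∂(volume.restrict B), w ∉ frontier (X '' D) := by
      apply ae_restrict_of_ae
      exact measure_eq_zero_iff_ae_notMem.mp hvol
    filter_upwards [hae] with w hw
    have hz := X.apply_symm_apply w
    set z := X.symm w with hzdef
    have hzf : z ∉ frontier D := by
      intro h; apply hw; rw [← X.image_frontier, ← hz]; exact mem_image_of_mem X h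
    apply tendsto_const_nhds.congr'
    by_cases hzD : z ∈ D
    · obtain ⟨r, hr, hball⟩ := Metric.isOpen_iff.mp hD.isOpen z hzD
      filter_upwards [hlim.eventually (gt_mem_nhds (show (0:ℝ) < r / 2 by positivity))] with k hk
      obtain ⟨Xk, hXk, himk, -⟩ := adm_image hd hγ hQ hD (hg k)
      have hzk := Xk.apply_symm_apply w
      have h1 := hlow _ (hg k) (Xk.symm w) z
      rw [← hXk, hzk] at h1
      have h2 : w - (z + g k z) = -(g k z - f z) := by rw [← hz, hX]; abel
      rw [h2, norm_neg] at h1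
      have h3 : Xk.symm w ∈ D := by
        apply hball; rw [mem_ball, dist_eq_norm]
        linarith [hgf k z hzD]
      rw [him, himk, indicator_of_mem, indicator_of_mem]
      · rw [← hzk]; exact mem_image_of_mem Xk h3
      · rw [← hz]; exact mem_image_of_mem X hzD
    · have hzc : z ∈ (closure D)ᶜ := by
        intro h; exact hzf ⟨h, by rwa [hD.isOpen.interior_eq]⟩
      obtain ⟨r, hr, hball⟩ := Metric.isOpen_iff.mp isClosed_closure.isOpen_compl z hzc
      filter_upwards [hlim.eventually (gt_mem_nhds (show (0:ℝ) < r / 2 by positivity))] with k hk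
      obtain ⟨Xk, hXk, himk, -⟩ := adm_image hd hγ hQ hD (hg k)
      rw [him, himk, indicator_of_notMem, indicator_of_notMem]
      · rintro ⟨y, hy, hyw⟩
        have h1 := hlow _ hf y z
        rw [← hX z, hz, ← hyw, hXk] at h1
        have h2 : y + f y - (y + g k y) = -(g k y - f y) := by abel
        rw [h2, norm_neg] at h1
        have h3 : y ∈ ball z r := by
          rw [mem_ball, dist_eq_norm]; linarith [hgf k y hy]
        exact hball h3 (subset_closure hy)
      · rintro ⟨y, hy, hyw⟩
        apply hzD; rw [hzdef, ← hyw, X.symm_apply_apply]; exact hy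

theorem vel_cont {d : ℕ} (hd : 2 ≤ d) {γ : ℝ} (hγ : γ ∈ Ioo (0:ℝ) 1) {Q : ℝ} (hQ : 0 ≤ Q) {R : ℝ} (hR : 0 < R)
    {D : Set (EuclideanSpace ℝ (Fin d))} {n : EuclideanSpace ℝ (Fin d) → EuclideanSpace ℝ (Fin d)}
    {c : EuclideanSpace ℝ (Fin d)} (hD : Dom d γ Q R D n c) {f : EuclideanSpace ℝ (Fin d) → EuclideanSpace ℝ (Fin d)}
    (hf : Adm γ (1/4) D f) (x : EuclideanSpace ℝ (Fin d)) {η : ℝ} (hη : 0 < η) :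
    ∃ δ > 0, ∀ g, Adm γ (1/4) D g → (∀ z ∈ D, ‖g z - f z‖ ≤ δ) → ∀ x', ‖x' - x‖ ≤ δ → ‖Vel d D g x' - Vel d D f x‖ ≤ η := by
  obtain ⟨M, hM, hvel⟩ := vel_bounds d hd γ hγ Q hQ R hR
  have h1 : ∃ δ > 0, ∀ g, Adm γ (1/4) D g → (∀ z ∈ D, ‖g z - f z‖ ≤ δ) → ‖Vel d D g x - Vel d D f x‖ ≤ η / 2 := by
    by_contra hcon
    push Not at hcon
    have := fun k : ℕ => hcon (1 / ((k:ℝ) + 1)) (by positivity)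
    choose g hg hgf hgv using this
    have ht := vel_seq hd hγ hQ hD hf hg hgf x
    have hev := (tendsto_iff_norm_sub_tendsto_zero.mp ht).eventually (gt_mem_nhds (show (0:ℝ) < η / 2 by positivity))
    obtain ⟨k, hk⟩ := hev.exists
    linarith [hgv k]
  obtain ⟨δ, hδ, h1⟩ := h1
  refine ⟨min δ (η / (2 * M)), by positivity, fun g hg hgf x' hx' => ?_⟩
  have h2 := h1 g hg (fun z hz => (hgf z hz).trans (min_le_left _ _))
  have h3 := (hvel D n c hD g hg).2.1 x' x
  have h4 : M * ‖x' - x‖ ≤ M * (η / (2 * M)) := by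
    gcongr; exact hx'.trans (min_le_right _ _)
  have h5 : M * (η / (2 * M)) = η / 2 := by field_simp
  calc _ = ‖(Vel d D g x' - Vel d D g x) + (Vel d D g x - Vel d D f x)‖ := by congr 1; abel
    _ ≤ _ := norm_add_le _ _
    _ ≤ η := by linarith

end part13

section part14

theorem Adm.mono {E : Type*} [NormedAddCommGroup E] [NormedSpace ℝ E] {γ ε ε' : ℝ} {D : Set E} {f : E → E}
    (h : Adm γ ε D f) (hε : ε ≤ ε') : Adm γ ε' D f := by
  obtain ⟨h1, A, h2⟩ := h
  exact ⟨fun x y => (h1 x y).trans (by gcongr), A, h2.mono hε⟩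

theorem Adm.zero {E : Type*} [NormedAddCommGroup E] [NormedSpace ℝ E] {γ ε : ℝ} (hε : 0 ≤ ε) {D : Set E} :
    Adm γ ε D (fun _ => (0:E)) := by
  refine ⟨fun x y => by simp; positivity, fun _ => 0, fun x hx => ⟨by simpa using hε, by simpa using hε, fun y hy => ⟨?_, ?_⟩⟩⟩
  · simp; positivity
  · simp; positivity

/-- Euler scheme -/
noncomputable def eul (d : ℕ) (D : Set (EuclideanSpace ℝ (Fin d))) (τ : ℝ) :
    ℕ → EuclideanSpace ℝ (Fin d) → EuclideanSpace ℝ (Fin d)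
  | 0 => fun _ => 0
  | k + 1 => fun x => eul d D τ k x + τ • Vel d D (eul d D τ k) (x + eul d D τ k x)

section euler
variable {d : ℕ} {γ M : ℝ} {D : Set (EuclideanSpace ℝ (Fin d))}

/-- the bounds on the velocity -/
def VB (d : ℕ) (γ M : ℝ) (D : Set (EuclideanSpace ℝ (Fin d))) : Prop := ∀ f, Adm γ (1/4) D f →
      (∀ z, ‖Vel d D f z‖ ≤ M) ∧ (∀ x y, ‖Vel d D f x - Vel d D f y‖ ≤ M * ‖x - y‖) ∧
      ∃ A', WW γ M (closure D) (fun x => Vel d D f (x + f x)) A'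

theorem eul_adm (hM : 0 < M) (hV : VB d γ M D) {τ : ℝ} (k : ℕ) (hk : k * |τ| ≤ 1 / (8 * M)) :
    Adm γ (2 * M * (k * |τ|)) D (eul d D τ k) ∧ Adm γ (1/4) D (eul d D τ k) := by
  have hle : 2 * M * (k * |τ|) ≤ 1 / 4 := by
    calc _ ≤ 2 * M * (1 / (8 * M)) := by gcongr
      _ = 1 / 4 := by field_simp; norm_num
  refine (fun h => ⟨h, h.mono hle⟩) ?_
  induction k with
  | zero => simpa [eul] using Adm.zero le_rfl
  | succ k ih =>
    have hk' : k * |τ| ≤ 1 / (8 * M) := by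
      refine le_trans ?_ hk; push_cast; nlinarith [abs_nonneg τ]
    have hle' : 2 * M * (k * |τ|) ≤ 1 / 4 := by
      refine le_trans ?_ hle; push_cast; nlinarith [abs_nonneg τ, mul_nonneg hM.le (abs_nonneg τ)]
    have h1 := ih hk' hle'
    obtain ⟨v1, v2, A', v3⟩ := hV _ (h1.mono hle')
    obtain ⟨l, A, hA⟩ := h1
    have hp := mul_nonneg hM.le (abs_nonneg τ)
    refine ⟨fun x y => ?_, _, ((hA.add_smul (h := τ) v3).mono ?_)⟩
    · have e : eul d D τ (k + 1) x - eul d D τ (k + 1) y = (eul d D τ k x - eul d D τ k y) +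
          τ • (Vel d D (eul d D τ k) (x + eul d D τ k x) - Vel d D (eul d D τ k) (y + eul d D τ k y)) := by
        simp only [eul, smul_sub]; abel
      rw [e]
      refine (norm_add_le _ _).trans ?_
      rw [norm_smul, Real.norm_eq_abs]
      have h2 := v2 (x + eul d D τ k x) (y + eul d D τ k y)
      have h3 : ‖(x + eul d D τ k x) - (y + eul d D τ k y)‖ ≤ 2 * ‖x - y‖ := by
        rw [show (x + eul d D τ k x) - (y + eul d D τ k y) = (x - y) + (eul d D τ k x - eul d D τ k y) by abel]
        have := mul_le_mul_of_nonneg_right hle' (norm_nonneg (x - y))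
        linarith [norm_add_le (x - y) (eul d D τ k x - eul d D τ k y), l x y, norm_nonneg (x - y)]
      have h4 := mul_le_mul_of_nonneg_left (h2.trans (mul_le_mul_of_nonneg_left h3 hM.le)) (abs_nonneg τ)
      push_cast
      linarith [l x y]
    · push_cast; linarith

theorem eul_step (hM : 0 < M) (hV : VB d γ M D) {τ : ℝ} {j k : ℕ} (hjk : j ≤ k) (hk : k * |τ| ≤ 1 / (8 * M)) (x) :
    ‖eul d D τ k x - eul d D τ j x‖ ≤ M * (((k:ℝ) - j) * |τ|) := by
  induction k, hjk using Nat.le_induction with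
  | base => simp
  | succ k hjk ih =>
    have hk' : k * |τ| ≤ 1 / (8 * M) := by
      refine le_trans ?_ hk; push_cast; nlinarith [abs_nonneg τ]
    have h1 := ih hk'
    have h2 := (hV _ (eul_adm hM hV k hk').2).1 (x + eul d D τ k x)
    have e : eul d D τ (k + 1) x - eul d D τ j x = (eul d D τ k x - eul d D τ j x) + τ • Vel d D (eul d D τ k) (x + eul d D τ k x) := by
      simp only [eul]; abel
    rw [e]
    refine (norm_add_le _ _).trans ?_
    rw [norm_smul, Real.norm_eq_abs]
    have h4 := mul_le_mul_of_nonneg_left h2 (abs_nonneg τ)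
    push_cast
    linarith

theorem eul_step_abs (hM : 0 < M) (hV : VB d γ M D) {τ : ℝ} {j k : ℕ} (hj : j * |τ| ≤ 1 / (8 * M))
    (hk : k * |τ| ≤ 1 / (8 * M)) (x) :
    ‖eul d D τ k x - eul d D τ j x‖ ≤ M * abs (k * |τ| - j * |τ|) := by
  have hp := abs_nonneg τ
  rcases le_total j k with h | h
  · refine (eul_step hM hV h hk x).trans ?_
    gcongr
    rw [← sub_mul]; exact le_abs_self _
  · rw [norm_sub_rev, abs_sub_comm]
    refine (eul_step hM hV h hj x).trans ?_
    gcongr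
    rw [← sub_mul]; exact le_abs_self _

theorem eul_taylor {τ η : ℝ} {x V0} {j k : ℕ} (hjk : j ≤ k)
    (hv : ∀ i, j ≤ i → i < k → ‖Vel d D (eul d D τ i) (x + eul d D τ i x) - V0‖ ≤ η) :
    ‖eul d D τ k x - eul d D τ j x - (((k:ℝ) - j) * τ) • V0‖ ≤ ((k:ℝ) - j) * |τ| * η := by
  induction k, hjk using Nat.le_induction with
  | base => simp
  | succ k hjk ih =>
    have h1 := ih (fun i h1 h2 => hv i h1 (by omega))
    have h2 := hv k hjk (by omega)
    have e : eul d D τ (k + 1) x - eul d D τ j x - (((k + 1 : ℕ):ℝ) - j) • τ • V0 =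
        (eul d D τ k x - eul d D τ j x - (((k:ℝ) - j) * τ) • V0) + τ • (Vel d D (eul d D τ k) (x + eul d D τ k x) - V0) := by
      simp only [eul]; push_cast; module
    rw [mul_smul, e]
    refine (norm_add_le _ _).trans ?_
    rw [norm_smul, Real.norm_eq_abs]
    have h4 := mul_le_mul_of_nonneg_left h2 (abs_nonneg τ)
    push_cast
    linarith

theorem flow_half (hd : 2 ≤ d) (hγ : γ ∈ Ioo (0:ℝ) 1) {Q : ℝ} (hQ : 0 ≤ Q) {R : ℝ} (hR : 0 < R)
    {n : EuclideanSpace ℝ (Fin d) → EuclideanSpace ℝ (Fin d)} {c : EuclideanSpace ℝ (Fin d)} (hD : Dom d γ Q R D n c)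
    (hM : 0 < M) (hV : VB d γ M D) {s : ℝ} (hs : |s| = 1) :
    ∃ g : ℝ → EuclideanSpace ℝ (Fin d) → EuclideanSpace ℝ (Fin d), (∀ x, g 0 x = 0) ∧
      ∀ t ∈ Icc 0 (1 / (8 * M)), Adm γ (1/4) D (g t) ∧ ∀ x,
        HasDerivWithinAt (fun t => g t x) (s • Vel d D (g t) (x + g t x)) (Icc 0 (1 / (8 * M))) t := by
  set T := 1 / (8 * M) with hT
  have hTp : 0 < T := by positivity
  set U : Ultrafilter ℕ := Filter.hyperfilter ℕ with hU
  set h : ℕ → ℝ := fun n => 1 / ((n:ℝ) + 1) with hh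
  have hhp : ∀ n, 0 < h n := fun n => by rw [hh]; positivity
  have hhlim : Filter.Tendsto h U (nhds 0) := tendsto_one_div_add_atTop_nhds_zero_nat.mono_left Nat.hyperfilter_le_atTop
  have habs : ∀ n, |s * h n| = h n := fun n => by rw [abs_mul, hs, one_mul, abs_of_pos (hhp n)]
  set idx : ℕ → ℝ → ℕ := fun n t => ⌊t * (n + 1)⌋₊ with hidx
  have hi1 : ∀ n t, 0 ≤ t → idx n t * h n ≤ t := by
    intro n t ht
    have h1 : ((idx n t : ℕ) : ℝ) ≤ t * (n + 1) := Nat.floor_le (by positivity)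
    rw [hh]; simp only; rw [mul_one_div, div_le_iff₀ (by positivity)]; exact h1
  have hi2 : ∀ n t, t ≤ idx n t * h n + h n := by
    intro n t
    have h1 : t * (n + 1) < (idx n t : ℕ) + 1 := Nat.lt_floor_add_one _
    rw [hh]; simp only; rw [← add_one_mul, mul_one_div, le_div_iff₀ (by positivity)]; exact h1.le
  have hiT : ∀ n, ∀ t ∈ Icc 0 T, idx n t * |s * h n| ≤ T := fun n t ht => by
    rw [habs]; exact (hi1 n t ht.1).trans ht.2
  have himono : ∀ n {t t'}, t ≤ t' → idx n t ≤ idx n t' := fun n t t' htt => Nat.floor_mono (by gcongr)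
  set F : ℕ → ℝ → EuclideanSpace ℝ (Fin d) → EuclideanSpace ℝ (Fin d) := fun n t => eul d D (s * h n) (idx n t) with hF
  have hlimit : ∀ t ∈ Icc 0 T, ∀ x, ∃ a, Filter.Tendsto (fun n => F n t x) U (nhds a) ∧ ‖a - 0‖ ≤ M * T := by
    intro t ht x
    apply ulim_exists
    refine Filter.Eventually.of_forall fun n => ?_
    have h1 := eul_step hM hV (Nat.zero_le (idx n t)) (hiT n t ht) x
    have h2 := hiT n t ht
    simp only [eul, Nat.cast_zero, sub_zero] at h1 ⊢
    exact h1.trans (by gcongr)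
  choose! g hg _hgb using hlimit
  have hFadm : ∀ t ∈ Icc 0 T, ∀ n, Adm γ (1/4) D (F n t) := fun t ht n => (eul_adm hM hV _ (hiT n t ht)).2
  have hgadm : ∀ t ∈ Icc 0 T, Adm γ (1/4) D (g t) := by
    intro t ht
    refine ⟨fun x y => ?_, WW.ulim U (f := fun n => F n t) (Filter.Eventually.of_forall fun n => (hFadm t ht n).2) fun x _ => hg t ht x⟩
    exact le_of_tendsto ((hg t ht x).sub (hg t ht y)).norm (Filter.Eventually.of_forall fun n => (hFadm t ht n).1 x y)
  refine ⟨g, fun x => ?_, fun t0 ht0 => ⟨hgadm t0 ht0, fun x => ?_⟩⟩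
  · have h1 := hg 0 ⟨le_rfl, hTp.le⟩ x
    have h2 : (fun n => F n 0 x) = fun _ => 0 := by
      funext n; simp [hF, hidx, eul]
    rw [h2] at h1
    exact tendsto_nhds_unique h1 tendsto_const_nhds
  · set V0 := Vel d D (g t0) (x + g t0 x) with hV0
    rw [hasDerivWithinAt_iff_isLittleO, Asymptotics.isLittleO_iff]
    intro η hη
    obtain ⟨δ, hδ, hcont⟩ := vel_cont hd hγ hQ hR hD (hgadm t0 ht0) (x + g t0 x) hη
    -- uniform closeness on D
    have hnet : ∀ᶠ n in (U : Filter ℕ), ∀ z ∈ D, ‖F n t0 z - g t0 z‖ ≤ δ / 2 := by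
      have htb : TotallyBounded D := (isCompact_closedBall c R).totallyBounded.subset (hD.sub.trans ball_subset_closedBall)
      obtain ⟨N, hN, hcov⟩ := Metric.totallyBounded_iff.mp htb (δ / 2) (by positivity)
      have hev : ∀ᶠ n in (U : Filter ℕ), ∀ y ∈ N, ‖F n t0 y - g t0 y‖ < δ / 4 := by
        rw [Filter.eventually_all_finite hN]
        intro y _
        exact (tendsto_iff_norm_sub_tendsto_zero.mp (hg t0 ht0 y)).eventually (gt_mem_nhds (by positivity))
      filter_upwards [hev] with n hn z hz
      obtain ⟨y, hy, hzy⟩ := mem_iUnion₂.mp (hcov hz)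
      rw [mem_ball, dist_eq_norm] at hzy
      have a1 := (hFadm t0 ht0 n).1 z y
      have a2 := (hgadm t0 ht0).1 y z
      rw [norm_sub_rev y z] at a2
      have a3 := hn y hy
      calc ‖F n t0 z - g t0 z‖ = ‖(F n t0 z - F n t0 y) + (F n t0 y - g t0 y) + (g t0 y - g t0 z)‖ := by congr 1; abel
        _ ≤ ‖F n t0 z - F n t0 y‖ + ‖F n t0 y - g t0 y‖ + ‖g t0 y - g t0 z‖ := norm_add₃_le
        _ ≤ δ / 2 := by linarith
    have hxn : ∀ᶠ n in (U : Filter ℕ), ‖F n t0 x - g t0 x‖ < δ / 2 :=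
      (tendsto_iff_norm_sub_tendsto_zero.mp (hg t0 ht0 x)).eventually (gt_mem_nhds (by positivity))
    have hhn : ∀ᶠ n in (U : Filter ℕ), h n < δ / (4 * M) := hhlim.eventually (gt_mem_nhds (by positivity))
    have hball : ball t0 (δ / (4 * M)) ∈ nhdsWithin t0 (Icc 0 T) := mem_nhdsWithin_of_mem_nhds (ball_mem_nhds _ (by positivity))
    filter_upwards [hball, self_mem_nhdsWithin] with t htb ht
    rw [mem_ball, Real.dist_eq] at htb
    -- limit
    have hik : ∀ t ∈ Icc 0 T, Filter.Tendsto (fun n => (idx n t : ℝ) * h n) U (nhds t) := by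
      intro t ht
      have : Filter.Tendsto (fun n => t - h n) U (nhds t) := by simpa using hhlim.const_sub t
      exact tendsto_of_tendsto_of_tendsto_of_le_of_le this tendsto_const_nhds (fun n => by simp only; linarith [hi2 n t]) (fun n => hi1 n t ht.1)
    have hl1 : Filter.Tendsto (fun n => ‖F n t x - F n t0 x - (s * (idx n t * h n - idx n t0 * h n)) • V0‖) U
        (nhds ‖g t x - g t0 x - (s * (t - t0)) • V0‖) :=
      (((hg t ht x).sub (hg t0 ht0 x)).sub ((((hik t ht).sub (hik t0 ht0)).const_mul s).smul_const V0)).norm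
    have hl2 : Filter.Tendsto (fun n => |idx n t * h n - idx n t0 * h n| * η) U (nhds (|t - t0| * η)) :=
      (((hik t ht).sub (hik t0 ht0)).abs).mul_const η
    have hfin : ‖g t x - g t0 x - (s * (t - t0)) • V0‖ ≤ |t - t0| * η := by
      refine le_of_tendsto_of_tendsto hl1 hl2 ?_
      filter_upwards [hnet, hxn, hhn] with n e1 e2 e3
      -- velocities close
      have hvel : ∀ i, (idx n t ≤ i ∧ i ≤ idx n t0) ∨ (idx n t0 ≤ i ∧ i ≤ idx n t) →
          ‖Vel d D (eul d D (s * h n) i) (x + eul d D (s * h n) i x) - V0‖ ≤ η := by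
        intro i hi
        have hiT' : i * |s * h n| ≤ T := by
          rcases hi with hi | hi
          · refine le_trans ?_ (hiT n t0 ht0)
            gcongr; exact hi.2
          · refine le_trans ?_ (hiT n t ht)
            gcongr; exact hi.2
        have hdist : ∀ z, ‖eul d D (s * h n) i z - F n t0 z‖ ≤ δ / 2 := by
          intro z
          refine (eul_step_abs hM hV (hiT n t0 ht0) hiT' z).trans ?_
          rw [habs]
          have b1 : |(i:ℝ) * h n - idx n t0 * h n| ≤ |t - t0| + h n := by
            have c1 := hi1 n t ht.1
            have c2 := hi2 n t
            have c3 := hi1 n t0 ht0.1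
            have c4 := hi2 n t0
            have c5 := abs_le.mp (le_refl |t - t0|)
            have c6 := hhp n
            rcases hi with hi | hi
            · have d1 : (idx n t : ℝ) * h n ≤ i * h n := by gcongr; exact hi.1
              have d2 : (i : ℝ) * h n ≤ idx n t0 * h n := by gcongr; exact hi.2
              rw [abs_le]; constructor <;> linarith
            · have d1 : (idx n t0 : ℝ) * h n ≤ i * h n := by gcongr; exact hi.1
              have d2 : (i : ℝ) * h n ≤ idx n t * h n := by gcongr; exact hi.2
              rw [abs_le]; constructor <;> linarith
          calc _ ≤ M * (δ / (4 * M) + δ / (4 * M)) := by gcongr; linarith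
            _ = δ / 2 := by field_simp; norm_num
        apply hcont _ (eul_adm hM hV i hiT').2
        · intro z hz
          calc _ = ‖(eul d D (s * h n) i z - F n t0 z) + (F n t0 z - g t0 z)‖ := by congr 1; abel
            _ ≤ _ := norm_add_le _ _
            _ ≤ δ := by linarith [hdist z, e1 z hz]
        · calc _ = ‖(eul d D (s * h n) i x - F n t0 x) + (F n t0 x - g t0 x)‖ := by congr 1; abel
            _ ≤ _ := norm_add_le _ _
            _ ≤ δ := by linarith [hdist x]
      rcases le_total t0 t with htt | htt
      · have h1 := eul_taylor (himono n htt) (fun i i1 i2 => hvel i (Or.inr ⟨i1, i2.le⟩))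
        have e : ((idx n t : ℝ) - idx n t0) * (s * h n) = s * (idx n t * h n - idx n t0 * h n) := by ring
        rw [e, habs] at h1
        refine h1.trans ?_
        gcongr
        rw [← sub_mul]; exact le_abs_self _
      · have h1 := eul_taylor (himono n htt) (fun i i1 i2 => hvel i (Or.inl ⟨i1, i2.le⟩))
        have e : ((idx n t0 : ℝ) - idx n t) * (s * h n) = -(s * (idx n t * h n - idx n t0 * h n)) := by ring
        rw [e, habs, ← norm_neg] at h1
        have e4 : -(eul d D (s * h n) (idx n t0) x - eul d D (s * h n) (idx n t) x - -(s * (↑(idx n t) * h n - ↑(idx n t0) * h n)) • V0)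
          = F n t x - F n t0 x - (s * (idx n t * h n - idx n t0 * h n)) • V0 := by
          simp only [hF, neg_smul]; abel
        rw [e4] at h1
        refine h1.trans ?_
        gcongr
        rw [abs_sub_comm, ← sub_mul]; exact le_abs_self _
    rw [Real.norm_eq_abs, smul_smul, mul_comm (t - t0) s, mul_comm η]
    exact hfin

end euler

end part14

section part15

def WF {d : ℕ} (γ : ℝ) (F : EuclideanSpace ℝ (Fin d) → ℝ) (G : EuclideanSpace ℝ (Fin d) → EuclideanSpace ℝ (Fin d)) : Prop :=
  ∃ C, 0 ≤ C ∧ ∀ x y, |F y - F x - ⟪G x, y - x⟫| ≤ C * ‖y - x‖ ^ (1 + γ)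

variable {d : ℕ} {γ : ℝ} {F F' : EuclideanSpace ℝ (Fin d) → ℝ} {G G' : EuclideanSpace ℝ (Fin d) → EuclideanSpace ℝ (Fin d)}

theorem WF.add (h : WF γ F G) (h' : WF γ F' G') : WF γ (fun x => F x + F' x) (fun x => G x + G' x) := by
  obtain ⟨C, hC, h⟩ := h
  obtain ⟨C', hC', h'⟩ := h'
  refine ⟨C + C', by positivity, fun x y => ?_⟩
  have e : F y + F' y - (F x + F' x) - ⟪G x + G' x, y - x⟫ = (F y - F x - ⟪G x, y - x⟫) + (F' y - F' x - ⟪G' x, y - x⟫) := by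
    rw [inner_add_left]; ring
  rw [e, add_mul]
  exact (abs_add_le _ _).trans (add_le_add (h x y) (h' x y))

theorem WF.neg (h : WF γ F G) : WF γ (fun x => - F x) (fun x => - G x) := by
  obtain ⟨C, hC, h⟩ := h
  refine ⟨C, hC, fun x y => ?_⟩
  have e : - F y - - F x - ⟪- G x, y - x⟫ = -(F y - F x - ⟪G x, y - x⟫) := by
    rw [inner_neg_left]; ring
  rw [e, abs_neg]; exact h x y

theorem WF.const (c : ℝ) : WF (d := d) γ (fun _ => c) (fun _ => 0) := ⟨0, le_rfl, fun x y => by simp⟩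

theorem WF.hasGradientAt (hγ : 0 < γ) (h : WF γ F G) (x) : HasGradientAt F (G x) x := by
  obtain ⟨C, hC, h⟩ := h
  rw [hasGradientAt_iff_isLittleO]
  have h1 : (fun y => F y - F x - ⟪G x, y - x⟫) =O[nhds x] fun y => ‖y - x‖ ^ (1 + γ) := by
    refine Asymptotics.IsBigO.of_bound C (Filter.Eventually.of_forall fun y => ?_)
    rw [Real.norm_eq_abs, Real.norm_of_nonneg (by positivity)]; exact h x y
  refine h1.trans_isLittleO ?_
  have h2 : (fun y => ‖y - x‖ ^ (1 + γ)) = fun y => ‖y - x‖ ^ γ * ‖y - x‖ := by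
    funext y
    rw [add_comm, Real.rpow_add_one' (by positivity) (by positivity)]
  rw [h2]
  have h3 : Filter.Tendsto (fun y => ‖y - x‖ ^ γ) (nhds x) (nhds 0) := by
    have : Continuous (fun y => ‖y - x‖ ^ γ) := by
      refine Continuous.rpow_const (by fun_prop) (fun _ => Or.inr hγ.le)
    have h4 := this.tendsto x
    simpa [Real.zero_rpow hγ.ne'] using h4
  have h4 : (fun y => ‖y - x‖ ^ γ) =o[nhds x] fun _ => (1:ℝ) := (Asymptotics.isLittleO_one_iff ℝ).mpr h3
  have := h4.mul_isBigO (Asymptotics.isBigO_refl (fun y => ‖y - x‖) (nhds x))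
  simp only [one_mul] at this
  exact this.of_norm_right

theorem WF.holder (hγ : 0 < γ) (h : WF γ F G) : ∃ K, 0 ≤ K ∧ ∀ x y, ‖G x - G y‖ ≤ K * ‖x - y‖ ^ γ := by
  obtain ⟨C, hC, h⟩ := h
  refine ⟨C * 2 ^ (1 + γ) + 2 * C, by positivity, fun x y => ?_⟩
  rcases eq_or_ne (G x) (G y) with h0 | h0
  · rw [h0, sub_self, norm_zero]; positivity
  rcases eq_or_ne x y with h0' | h0'
  · exact absurd (by rw [h0']) h0
  set v := G x - G y with hv
  have hvp : 0 < ‖v‖ := norm_pos_iff.mpr (sub_ne_zero.mpr h0)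
  set r := ‖x - y‖ with hr
  have hrp : 0 < r := norm_pos_iff.mpr (sub_ne_zero.mpr h0')
  set z := y + (r / ‖v‖) • v with hz
  have hzy : z - y = (r / ‖v‖) • v := by rw [hz]; abel
  have hzyn : ‖z - y‖ = r := by
    rw [hzy, norm_smul, Real.norm_of_nonneg (by positivity)]; field_simp
  have hzx : ‖z - x‖ ≤ 2 * r := by
    calc ‖z - x‖ = ‖(z - y) - (x - y)‖ := by congr 1; abel
      _ ≤ ‖z - y‖ + ‖x - y‖ := norm_sub_le _ _
      _ = 2 * r := by rw [hzyn]; ring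
  have e1 := h x z
  have e2 := h y z
  have e3 := h x y
  rw [hzyn] at e2
  rw [norm_sub_rev, ← hr] at e3
  have e1' : |F z - F x - ⟪G x, z - x⟫| ≤ C * (2 ^ (1 + γ) * r ^ (1 + γ)) := by
    refine e1.trans ?_
    rw [← Real.mul_rpow (by norm_num) hrp.le]
    gcongr
  have e4 : ⟪v, z - y⟫ = (F z - F y - ⟪G y, z - y⟫) - (F z - F x - ⟪G x, z - x⟫) + (F y - F x - ⟪G x, y - x⟫) := by
    have : z - x = (z - y) + (y - x) := by abel
    rw [hv, this, inner_add_right, inner_sub_left]; ring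
  have e5 : ⟪v, z - y⟫ = r * ‖v‖ := by
    rw [hzy, inner_smul_right, real_inner_self_eq_norm_sq]; field_simp
  have e6 : r * ‖v‖ ≤ (C * 2 ^ (1 + γ) + 2 * C) * r ^ (1 + γ) := by
    rw [← e5, e4]
    rw [abs_le] at e1' e2 e3
    linarith
  have e7 : r ^ (1 + γ) = r * r ^ γ := by rw [Real.rpow_add hrp, Real.rpow_one]
  rw [e7] at e6
  have : r * ‖v‖ ≤ r * ((C * 2 ^ (1 + γ) + 2 * C) * r ^ γ) := by linarith
  exact le_of_mul_le_mul_left this hrp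

theorem WF.contDiff (hγ : 0 < γ) (h : WF γ F G) : ContDiff ℝ 1 F := by
  have hg := h.hasGradientAt hγ
  obtain ⟨K, hK, hh⟩ := h.holder hγ
  have hc : Continuous G := by
    rw [continuous_iff_continuousAt]
    intro x
    rw [ContinuousAt, tendsto_iff_norm_sub_tendsto_zero]
    have : Continuous (fun y => K * ‖y - x‖ ^ γ) :=
      continuous_const.mul (Continuous.rpow_const (by fun_prop) (fun _ => Or.inr hγ.le))
    have h4 := this.tendsto x
    simp only [sub_self, norm_zero, Real.zero_rpow hγ.ne', mul_zero] at h4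
    exact squeeze_zero (fun _ => norm_nonneg _) (fun y => hh y x) h4
  rw [contDiff_one_iff_fderiv]
  refine ⟨fun x => (hg x).differentiableAt, ?_⟩
  have : fderiv ℝ F = fun x => InnerProductSpace.toDual ℝ _ (G x) := by
    funext x; exact (hg x).hasFDerivAt.fderiv
  rw [this]
  exact (LinearIsometryEquiv.continuous _).comp hc

theorem WF.of_local (hγ : 0 < γ) {B δ C : ℝ} (hδ : 0 < δ) (hC : 0 ≤ C) (hF : ∀ x, |F x| ≤ B) (hG : ∀ x, ‖G x‖ ≤ B)
    (h : ∀ x y, ‖y - x‖ < δ → |F y - F x - ⟪G x, y - x⟫| ≤ C * ‖y - x‖ ^ (1 + γ)) : WF γ F G := by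
  have hB : 0 ≤ B := (norm_nonneg _).trans (hG 0)
  refine ⟨C + (2 * B / δ ^ (1 + γ) + B / δ ^ γ), by positivity, fun x y => ?_⟩
  rcases lt_or_ge ‖y - x‖ δ with h1 | h1
  · refine (h x y h1).trans ?_
    gcongr
    linarith [show 0 ≤ 2 * B / δ ^ (1 + γ) + B / δ ^ γ by positivity]
  · set r := ‖y - x‖ with hr
    have hrp : 0 < r := hδ.trans_le h1
    have a1 : |⟪G x, y - x⟫| ≤ B * r := (abs_real_inner_le_norm _ _).trans (by gcongr; exact hG x)
    have a2 : |F y - F x - ⟪G x, y - x⟫| ≤ 2 * B + B * r := by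
      have b1 := abs_le.mp (hF y); have b2 := abs_le.mp (hF x); have b3 := abs_le.mp a1
      rw [abs_le]; constructor <;> linarith
    refine a2.trans ?_
    have b1 : 1 ≤ r ^ (1 + γ) / δ ^ (1 + γ) := by
      rw [one_le_div (by positivity)]; gcongr
    have b2 : r ≤ r ^ (1 + γ) / δ ^ γ := by
      rw [le_div_iff₀ (by positivity), Real.rpow_add hrp, Real.rpow_one]; gcongr
    have b3 : 0 ≤ C * r ^ (1 + γ) := by positivity
    calc 2 * B + B * r ≤ 2 * B * (r ^ (1 + γ) / δ ^ (1 + γ)) + B * (r ^ (1 + γ) / δ ^ γ) := by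
          have := mul_le_mul_of_nonneg_left b1 (show 0 ≤ 2 * B by positivity)
          have := mul_le_mul_of_nonneg_left b2 hB
          linarith
      _ = (2 * B / δ ^ (1 + γ) + B / δ ^ γ) * r ^ (1 + γ) := by ring
      _ ≤ _ := by linarith

/-- bounds for a compactly supported smooth function -/
theorem smooth_bounds {χ : EuclideanSpace ℝ (Fin d) → ℝ} (hχ : ContDiff ℝ 2 χ) (hs : HasCompactSupport χ) :
    ∃ B, 0 ≤ B ∧ (∀ x, |χ x| ≤ B) ∧ (∀ x, ‖gradient χ x‖ ≤ B) ∧ ∀ x y, |χ y - χ x - ⟪gradient χ x, y - x⟫| ≤ B * ‖y - x‖ ^ 2 := by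
  have hng : ∀ x, ‖gradient χ x‖ = ‖fderiv ℝ χ x‖ := fun x => by rw [gradient]; simp
  obtain ⟨B1, h1⟩ := hs.exists_bound_of_continuous hχ.continuous
  have hfd : ContDiff ℝ 1 (fderiv ℝ χ) := hχ.fderiv_right (by norm_num)
  have hfs : HasCompactSupport (fderiv ℝ χ) := hs.fderiv ℝ
  obtain ⟨B2, h2⟩ := hfs.exists_bound_of_continuous hfd.continuous
  obtain ⟨B3, h3⟩ := ContDiff.lipschitzWith_of_hasCompactSupport hfs hfd (by norm_num)
  have p1 : 0 ≤ B1 := (norm_nonneg _).trans (h1 0)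
  have p2 : 0 ≤ B2 := (norm_nonneg _).trans (h2 0)
  refine ⟨B1 + B2 + B3, by positivity, fun x => ?_, fun x => ?_, fun x y => ?_⟩
  · have := h1 x; rw [Real.norm_eq_abs] at this; linarith [B3.2]
  · rw [hng]; linarith [h2 x, B3.2]
  · have e : ⟪gradient χ x, y - x⟫ = fderiv ℝ χ x (y - x) := by
      rw [gradient, InnerProductSpace.toDual_symm_apply]
    rw [e]
    have hd : ∀ z ∈ segment ℝ x y, HasFDerivWithinAt χ (fderiv ℝ χ z) (segment ℝ x y) z := fun z _ =>
      ((hχ.differentiable (by norm_num)) z).hasFDerivAt.hasFDerivWithinAt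
    have := Convex.norm_image_sub_le_of_norm_hasFDerivWithin_le' (C := B3 * ‖y - x‖) (φ := fderiv ℝ χ x) hd (fun z hz => ?_)
      (convex_segment x y) (left_mem_segment ℝ x y) (right_mem_segment ℝ x y)
    · rw [Real.norm_eq_abs] at this
      refine this.trans ?_
      rw [mul_assoc, ← sq]
      gcongr
      linarith
    · refine (h3.norm_sub_le z x).trans ?_
      gcongr
      exact norm_sub_le_of_mem_segment hz

theorem sq_le_rpow (hγ1 : γ < 1) {δ : ℝ} {r : ℝ} (hr : 0 ≤ r) (hrδ : r ≤ δ) (hγ : 0 < γ) : r ^ 2 ≤ δ ^ (1 - γ) * r ^ (1 + γ) := by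
  rcases hr.eq_or_lt with h | h
  · rw [← h]; simp; rw [Real.zero_rpow (by positivity)]; simp
  · have : r ^ 2 = r ^ (1 - γ) * r ^ (1 + γ) := by
      rw [← Real.rpow_add h, ← Real.rpow_natCast]; congr 1; push_cast; ring
    rw [this]
    gcongr

theorem WF.smooth (hγ : 0 < γ) (hγ1 : γ < 1) {χ : EuclideanSpace ℝ (Fin d) → ℝ} (hχ : ContDiff ℝ 2 χ) (hs : HasCompactSupport χ) :
    WF γ χ (gradient χ) := by
  obtain ⟨B, hB, h1, h2, h3⟩ := smooth_bounds hχ hs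
  refine WF.of_local hγ one_pos hB h1 h2 fun x y hxy => (h3 x y).trans ?_
  have := sq_le_rpow hγ1 (norm_nonneg (y - x)) hxy.le hγ
  rw [Real.one_rpow, one_mul] at this
  gcongr

/-- product of a cutoff with a locally `C^{1,γ}` function -/
theorem WF.mul_local (hγ : 0 < γ) (hγ1 : γ < 1) {χ f : EuclideanSpace ℝ (Fin d) → ℝ} {a : EuclideanSpace ℝ (Fin d) → EuclideanSpace ℝ (Fin d)}
    {p : EuclideanSpace ℝ (Fin d)} {ρ B C : ℝ} (hρ : 0 < ρ) (hC : 0 ≤ C) (hχ : ContDiff ℝ 2 χ)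
    (hs : ∀ x, ρ / 2 < ‖x - p‖ → χ x = 0 ∧ gradient χ x = 0) (hcs : HasCompactSupport χ)
    (hfB : ∀ x ∈ ball p ρ, |f x| ≤ B) (haB : ∀ x ∈ ball p ρ, ‖a x‖ ≤ B)
    (hf : ∀ x ∈ ball p ρ, ∀ y ∈ ball p ρ, |f y - f x - ⟪a x, y - x⟫| ≤ C * ‖y - x‖ ^ (1 + γ)) :
    WF γ (fun x => χ x * f x) (fun x => χ x • a x + f x • gradient χ x) := by
  obtain ⟨M, hM, h1, h2, h3⟩ := smooth_bounds hχ hcs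
  have hB : 0 ≤ B := (norm_nonneg _).trans (haB p (mem_ball_self hρ))
  have hlip : ∀ x y, |χ y - χ x| ≤ M * ‖y - x‖ := by
    intro x y
    have := Convex.norm_image_sub_le_of_norm_fderiv_le (f := χ) (C := M) (𝕜 := ℝ) (fun z _ => (hχ.differentiable (by norm_num)) z)
      (fun z _ => by
        have : ‖gradient χ z‖ = ‖fderiv ℝ χ z‖ := by rw [gradient]; simp
        rw [← this]; exact h2 z) convex_univ (mem_univ x) (mem_univ y)
    rwa [Real.norm_eq_abs] at this
  refine WF.of_local hγ (B := M * B + B * M) (δ := ρ / 2) (C := M * C + (M * B + B * M) * (ρ / 2) ^ (1 - γ)) (by positivity) (by positivity) (fun x => ?_) (fun x => ?_) (fun x y hxy => ?_)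
  · by_cases hx : ρ / 2 < ‖x - p‖
    · rw [(hs x hx).1]; simp; positivity
    · have hx' : x ∈ ball p ρ := by rw [mem_ball, dist_eq_norm]; linarith
      rw [abs_mul]
      have := mul_le_mul (h1 x) (hfB x hx') (abs_nonneg _) hM
      linarith [mul_nonneg hB hM]
  · by_cases hx : ρ / 2 < ‖x - p‖
    · rw [(hs x hx).1, (hs x hx).2]; simp; positivity
    · have hx' : x ∈ ball p ρ := by rw [mem_ball, dist_eq_norm]; linarith
      refine (norm_add_le _ _).trans ?_
      rw [norm_smul, norm_smul, Real.norm_eq_abs, Real.norm_eq_abs]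
      exact add_le_add (mul_le_mul (h1 x) (haB x hx') (norm_nonneg _) hM) (mul_le_mul (hfB x hx') (h2 x) (norm_nonneg _) hB)
  · by_cases hxy2 : ρ / 2 < ‖x - p‖ ∧ ρ / 2 < ‖y - p‖
    · rw [(hs x hxy2.1).1, (hs x hxy2.1).2, (hs y hxy2.2).1]; simp; positivity
    · have hb : x ∈ ball p ρ ∧ y ∈ ball p ρ := by
        rw [mem_ball, mem_ball, dist_eq_norm, dist_eq_norm]
        have t1 := norm_sub_le_norm_sub_add_norm_sub x y p
        have t2 := norm_sub_le_norm_sub_add_norm_sub y x p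
        rw [norm_sub_rev x y] at t1
        by_contra hcon
        apply hxy2
        by_cases c1 : ‖x - p‖ < ρ
        · have : ρ ≤ ‖y - p‖ := not_lt.mp fun c2 => hcon ⟨c1, c2⟩
          constructor <;> linarith
        · constructor <;> linarith
      obtain ⟨hx, hy⟩ := hb
      have e : χ y * f y - χ x * f x - ⟪χ x • a x + f x • gradient χ x, y - x⟫ =
          χ y * (f y - f x - ⟪a x, y - x⟫) + (χ y - χ x) * ⟪a x, y - x⟫ + f x * (χ y - χ x - ⟪gradient χ x, y - x⟫) := by
        rw [inner_add_left, real_inner_smul_left, real_inner_smul_left]; ring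
      rw [e]
      refine (abs_add_three _ _ _).trans ?_
      rw [abs_mul, abs_mul, abs_mul]
      have i1 := mul_le_mul (h1 y) (hf x hx y hy) (abs_nonneg _) hM
      have i2 : |χ y - χ x| * |⟪a x, y - x⟫| ≤ (M * ‖y - x‖) * (B * ‖y - x‖) :=
        mul_le_mul (hlip x y) ((abs_real_inner_le_norm _ _).trans (by gcongr; exact haB x hx)) (abs_nonneg _) (by positivity)
      have i3 := mul_le_mul (hfB x hx) (h3 x y) (abs_nonneg _) hB
      have i4 := mul_le_mul_of_nonneg_left (sq_le_rpow hγ1 (norm_nonneg (y - x)) hxy.le hγ) (show 0 ≤ M * B + B * M by positivity)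
      nlinarith

end part15

section part16

structure Piece {d : ℕ} (γ : ℝ) (D : Set (EuclideanSpace ℝ (Fin d))) (n : EuclideanSpace ℝ (Fin d) → EuclideanSpace ℝ (Fin d))
    (F : EuclideanSpace ℝ (Fin d) → ℝ) (G : EuclideanSpace ℝ (Fin d) → EuclideanSpace ℝ (Fin d)) : Prop where
  wf : WF γ F G
  neg : ∀ x ∈ D, F x ≤ 0
  zero : ∀ x ∈ frontier D, F x = 0
  pos : ∀ x ∉ D, 0 ≤ F x
  inn : ∀ x ∈ frontier D, 0 ≤ ⟪G x, n x⟫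

/-- strictness of a piece at a point -/
def PStr {d : ℕ} (D : Set (EuclideanSpace ℝ (Fin d))) (n : EuclideanSpace ℝ (Fin d) → EuclideanSpace ℝ (Fin d))
    (F : EuclideanSpace ℝ (Fin d) → ℝ) (G : EuclideanSpace ℝ (Fin d) → EuclideanSpace ℝ (Fin d)) (x : EuclideanSpace ℝ (Fin d)) : Prop :=
  (x ∈ D → F x < 0) ∧ (x ∉ closure D → 0 < F x) ∧ (x ∈ frontier D → 0 < ⟪G x, n x⟫)

variable {d : ℕ} {γ : ℝ} {D : Set (EuclideanSpace ℝ (Fin d))} {n : EuclideanSpace ℝ (Fin d) → EuclideanSpace ℝ (Fin d)}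
 {F F' : EuclideanSpace ℝ (Fin d) → ℝ} {G G' : EuclideanSpace ℝ (Fin d) → EuclideanSpace ℝ (Fin d)}

theorem Piece.add (h : Piece γ D n F G) (h' : Piece γ D n F' G') : Piece γ D n (fun x => F x + F' x) (fun x => G x + G' x) where
  wf := h.wf.add h'.wf
  neg x hx := by linarith [h.neg x hx, h'.neg x hx]
  zero x hx := by rw [h.zero x hx, h'.zero x hx, add_zero]
  pos x hx := by linarith [h.pos x hx, h'.pos x hx]
  inn x hx := by rw [inner_add_left]; linarith [h.inn x hx, h'.inn x hx]

theorem Piece.sum_str (h : Piece γ D n F G) (h' : Piece γ D n F' G') {x}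
    (hx : PStr D n F G x ∨ PStr D n F' G' x) : PStr D n (fun x => F x + F' x) (fun x => G x + G' x) x := by
  refine ⟨fun hD => ?_, fun hD => ?_, fun hD => ?_⟩
  · have a := h.neg x hD; have b := h'.neg x hD
    rcases hx with hx | hx <;> have := hx.1 hD <;> linarith
  · have a := h.pos x (fun c => hD (subset_closure c)); have b := h'.pos x (fun c => hD (subset_closure c))
    rcases hx with hx | hx <;> have := hx.2.1 hD <;> linarith
  · have a := h.inn x hD; have b := h'.inn x hD
    rw [inner_add_left]
    rcases hx with hx | hx <;> have := hx.2.2 hD <;> linarith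

theorem Piece.zero_piece : Piece γ D n (fun _ => 0) (fun _ => 0) where
  wf := WF.const 0
  neg x hx := le_rfl
  zero x hx := rfl
  pos x hx := le_rfl
  inn x hx := by simp

theorem piece_cover (h : ∀ p : EuclideanSpace ℝ (Fin d), ∃ F G, ∃ r > 0, Piece γ D n F G ∧ ∀ x ∈ ball p r, PStr D n F G x)
    {K : Set (EuclideanSpace ℝ (Fin d))} (hK : IsCompact K) : ∃ F G, Piece γ D n F G ∧ ∀ x ∈ K, PStr D n F G x := by
  refine hK.induction_on (p := fun K => ∃ F G, Piece γ D n F G ∧ ∀ x ∈ K, PStr D n F G x) ?_ ?_ ?_ ?_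
  · exact ⟨_, _, Piece.zero_piece, by simp⟩
  · rintro s t hst ⟨F, G, h1, h2⟩; exact ⟨F, G, h1, fun x hx => h2 x (hst hx)⟩
  · rintro s t ⟨F, G, h1, h2⟩ ⟨F', G', h1', h2'⟩
    refine ⟨_, _, h1.add h1', fun x hx => Piece.sum_str h1 h1' ?_⟩
    exact hx.imp (h2 x) (h2' x)
  · intro p _
    obtain ⟨F, G, r, hr, h1, h2⟩ := h p
    exact ⟨_, mem_nhdsWithin_of_mem_nhds (ball_mem_nhds p hr), F, G, h1, h2⟩

theorem bump_facts {p : EuclideanSpace ℝ (Fin d)} {r : ℝ} (hr : 0 < r) : ∃ χ : EuclideanSpace ℝ (Fin d) → ℝ, ContDiff ℝ 2 χ ∧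
    HasCompactSupport χ ∧ (∀ x, 0 ≤ χ x) ∧ (∀ x ∈ ball p r, 0 < χ x) ∧ (∀ x ∈ closedBall p (r / 2), χ x = 1) ∧
    ∀ x, r < ‖x - p‖ → χ x = 0 ∧ gradient χ x = 0 := by
  let b : ContDiffBump p := ⟨r / 2, r, by positivity, by linarith⟩
  have hz : ∀ x, r < ‖x - p‖ → b x = 0 := fun x hx => b.zero_of_le_dist (by rw [dist_eq_norm]; exact hx.le)
  refine ⟨b, b.contDiff, b.hasCompactSupport, fun x => b.nonneg, fun x hx => b.pos_of_mem_ball hx, fun x hx => b.one_of_mem_closedBall hx, fun x hx => ⟨hz x hx, ?_⟩⟩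
  have : (fun x => b x) =ᶠ[nhds x] fun _ => (0:ℝ) := by
    have : {x | r < ‖x - p‖} ∈ nhds x := (isOpen_lt continuous_const (by fun_prop)).mem_nhds hx
    filter_upwards [this] with y hy using hz y hy
  have e : gradient b x = gradient (fun _ => (0:ℝ)) x := by
    rw [gradient, gradient, this.fderiv_eq]
  rw [e]; exact gradient_fun_const x 0

theorem piece_out (hγ : γ ∈ Ioo (0:ℝ) 1) (hb : Bornology.IsBounded D) : ∃ F G, ∃ K : Set (EuclideanSpace ℝ (Fin d)), IsCompact K ∧ Piece γ D n F G ∧ ∀ x ∉ K, PStr D n F G x := by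
  obtain ⟨R, hR⟩ := hb.subset_ball 0
  set R' := max R 1 with hR'
  have hRp : 0 < R' := lt_of_lt_of_le one_pos (le_max_right _ _)
  have hcl : closure D ⊆ closedBall 0 R' := closure_minimal (hR.trans (ball_subset_closedBall.trans (closedBall_subset_closedBall (le_max_left _ _)))) isClosed_closedBall
  let b : ContDiffBump (0 : EuclideanSpace ℝ (Fin d)) := ⟨2 * R', 3 * R', by positivity, by linarith⟩
  have h1 : ∀ x ∈ closure D, b x = 1 := fun x hx => b.one_of_mem_closedBall (closedBall_subset_closedBall (by change R' ≤ 2 * R'; linarith) (hcl hx))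
  have hw := ((WF.smooth hγ.1 hγ.2 (b.contDiff (n := 2)) b.hasCompactSupport).neg).add (WF.const (d := d) (γ := γ) 1)
  refine ⟨_, _, closedBall 0 (3 * R'), isCompact_closedBall _ _, ⟨hw, fun x hx => ?_, fun x hx => ?_, fun x hx => ?_, fun x hx => ?_⟩, fun x hx => ⟨fun h => ?_, fun h => ?_, fun h => ?_⟩⟩
  · rw [h1 x (subset_closure hx)]; simp
  · rw [h1 x (frontier_subset_closure hx)]; simp
  · have : b x ≤ 1 := b.le_one
    linarith
  · have : (fun x => b x) =ᶠ[nhds x] fun _ => (1:ℝ) := by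
      have hm : ball (0 : EuclideanSpace ℝ (Fin d)) (2 * R') ∈ nhds x := isOpen_ball.mem_nhds (by
        have := hcl (frontier_subset_closure hx)
        rw [mem_closedBall] at this; rw [mem_ball]; linarith)
      filter_upwards [hm] with y hy using b.one_of_mem_closedBall (ball_subset_closedBall hy)
    have e : gradient b x = gradient (fun _ => (1:ℝ)) x := by
      rw [gradient, gradient, this.fderiv_eq]
    rw [e, gradient_fun_const]; simp
  · exact absurd (closedBall_subset_closedBall (by linarith) (hcl (subset_closure h))) hx
  · have : b x = 0 := b.zero_of_le_dist (by rw [mem_closedBall, not_le] at hx; exact hx.le)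
    simp only [this]; norm_num
  · exact absurd (closedBall_subset_closedBall (by linarith) (hcl (frontier_subset_closure h))) hx

theorem piece_in (hγ : γ ∈ Ioo (0:ℝ) 1) (hDo : IsOpen D) {p} (hp : p ∈ D) : ∃ F G, ∃ r > 0, Piece γ D n F G ∧ ∀ x ∈ ball p r, PStr D n F G x := by
  obtain ⟨r, hr, hrD⟩ := Metric.isOpen_iff.mp hDo p hp
  obtain ⟨χ, h1, h2, h3, h4, -, h5⟩ := bump_facts (p := p) (r := r / 2) (by positivity)
  have hout : ∀ x ∉ D, χ x = 0 ∧ gradient χ x = 0 := fun x hx => h5 x (by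
    by_contra hc; apply hx; apply hrD; rw [mem_ball, dist_eq_norm]; linarith)
  have hfr : ∀ x ∈ frontier D, x ∉ D := fun x hx h => by
    rw [hDo.frontier_eq] at hx; exact hx.2 h
  refine ⟨_, _, r / 2, by positivity, ⟨(WF.smooth hγ.1 hγ.2 h1 h2).neg, fun x hx => ?_, fun x hx => ?_, fun x hx => ?_, fun x hx => ?_⟩, fun x hx => ⟨fun h => ?_, fun h => ?_, fun h => ?_⟩⟩
  · linarith [h3 x]
  · rw [(hout x (hfr x hx)).1, neg_zero]
  · rw [(hout x hx).1, neg_zero]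
  · rw [(hout x (hfr x hx)).2]; simp
  · linarith [h4 x hx]
  · exact absurd (subset_closure (hrD (ball_subset_ball (by linarith) hx))) h
  · exact absurd (hrD (ball_subset_ball (by linarith) hx)) (hfr x h)

theorem piece_ext (hγ : γ ∈ Ioo (0:ℝ) 1) {p} (hp : p ∉ closure D) : ∃ F G, ∃ r > 0, Piece γ D n F G ∧ ∀ x ∈ ball p r, PStr D n F G x := by
  obtain ⟨r, hr, hrD⟩ := Metric.isOpen_iff.mp (isClosed_closure (s := D)).isOpen_compl p hp
  obtain ⟨χ, h1, h2, h3, h4, -, h5⟩ := bump_facts (p := p) (r := r / 2) (by positivity)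
  have hout : ∀ x ∈ closure D, χ x = 0 ∧ gradient χ x = 0 := fun x hx => h5 x (by
    by_contra hc
    exact hrD (show x ∈ ball p r by rw [mem_ball, dist_eq_norm]; linarith) hx)
  refine ⟨_, _, r / 2, by positivity, ⟨(WF.smooth hγ.1 hγ.2 h1 h2), fun x hx => ?_, fun x hx => ?_, fun x hx => ?_, fun x hx => ?_⟩, fun x hx => ⟨fun h => ?_, fun h => ?_, fun h => ?_⟩⟩
  · rw [(hout x (subset_closure hx)).1]
  · rw [(hout x (frontier_subset_closure hx)).1]
  · exact h3 x
  · rw [(hout x (frontier_subset_closure hx)).2]; simp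
  · exact absurd (subset_closure h) (hrD (ball_subset_ball (by linarith) hx))
  · exact h4 x hx
  · exact absurd (frontier_subset_closure h) (hrD (ball_subset_ball (by linarith) hx))

theorem piece_final (hγ : γ ∈ Ioo (0:ℝ) 1) (hDo : IsOpen D) (hb : Bornology.IsBounded D)
    (h : ∀ p ∈ frontier D, ∃ F G, ∃ r > 0, Piece γ D n F G ∧ ∀ x ∈ ball p r, PStr D n F G x) : IsC1Domain d γ D := by
  have hall : ∀ p : EuclideanSpace ℝ (Fin d), ∃ F G, ∃ r > 0, Piece γ D n F G ∧ ∀ x ∈ ball p r, PStr D n F G x := by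
    intro p
    by_cases h1 : p ∈ closure D
    · by_cases h2 : p ∈ D
      · exact piece_in hγ hDo h2
      · exact h p (by rw [hDo.frontier_eq]; exact ⟨h1, h2⟩)
    · exact piece_ext hγ h1
  obtain ⟨F1, G1, K, hK, a1, a2⟩ := piece_out (n := n) hγ hb
  obtain ⟨F2, G2, b1, b2⟩ := piece_cover hall hK
  have c1 := a1.add b1
  have c2 : ∀ x, PStr D n _ _ x := fun x => Piece.sum_str a1 b1 (by
    by_cases hx : x ∈ K
    · exact Or.inr (b2 x hx)
    · exact Or.inl (a2 x hx))
  have hgr : ∀ x, gradient (fun x => F1 x + F2 x) x = G1 x + G2 x := fun x => (c1.wf.hasGradientAt hγ.1 x).gradient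
  refine ⟨hDo, hb, fun x => F1 x + F2 x, c1.wf.contDiff hγ.1, ?_, ?_, ?_, ?_⟩
  · obtain ⟨K, -, hh⟩ := c1.wf.holder hγ.1
    refine ⟨K, fun x y => ?_⟩
    rw [hgr, hgr]; exact hh x y
  · ext x
    refine ⟨fun hx => (c2 x).1 hx, fun hx => ?_⟩
    by_contra hc
    exact absurd hx (not_lt.mpr (c1.pos x hc))
  · ext x
    refine ⟨fun hx => c1.zero x hx, fun hx => ?_⟩
    change F1 x + F2 x = 0 at hx
    rw [hDo.frontier_eq]
    refine ⟨?_, fun hc => ?_⟩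
    · by_contra hc
      have := (c2 x).2.1 hc
      linarith
    · have := (c2 x).1 hc
      linarith
  · intro x hx h0
    have := (c2 x).2.2 hx
    rw [hgr] at h0
    simp only [h0, inner_zero_left, lt_self_iff_false] at this

end part16

section part17

variable {d : ℕ} {γ : ℝ} {D : Set (EuclideanSpace ℝ (Fin d))} {n : EuclideanSpace ℝ (Fin d) → EuclideanSpace ℝ (Fin d)}

theorem piece_frontier (hγ : γ ∈ Ioo (0:ℝ) 1) {A : ℝ} (hA : 0 ≤ A) (hDo : IsOpen D) (hD : PN γ A D n) {p} (hp : p ∈ frontier D) :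
    ∃ F G, ∃ r > 0, Piece γ D n F G ∧ ∀ x ∈ ball p r, PStr D n F G x := by
  obtain ⟨r0, hr0, hr0A⟩ := exists_r0 γ hγ.1 A hA
  set e := n p with he
  have hen : ‖e‖ = 1 := (hD p hp).1
  set ρ := r0 / 5 with hρ
  have hρp : 0 < ρ := by positivity
  have hsmall : ∀ s, 0 ≤ s → s ≤ 17 * r0 → A * s ^ (1 + γ) ≤ s / 6 := by
    intro s hs hs'
    rw [Real.rpow_one_add' hs (by linarith [hγ.1])]
    have : A * s ^ γ ≤ A * (17 * r0) ^ γ := mul_le_mul_of_nonneg_left (Real.rpow_le_rpow hs hs' hγ.1.le) hA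
    nlinarith
  have hfrD : ∀ x ∈ frontier D, x ∉ D := fun x hx h => by
    rw [hDo.frontier_eq] at hx; exact hx.2 h
  -- transversality
  have htr : ∀ q ∈ frontier D, ‖q - p‖ ≤ r0 → 1 / 2 ≤ ⟪e, n q⟫ := fun q hq hqp =>
    hD.normals_close hγ.1 hA hr0A hp hq (by rwa [norm_sub_rev])
  have hline : ∀ q ∈ frontier D, ‖q - p‖ ≤ r0 → ∀ s : ℝ, |s| ≤ 17 * r0 →
      (s < 0 → q + s • e ∈ D) ∧ (0 < s → q + s • e ∉ closure D) := by
    intro q hq hqp s hs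
    have h1 := htr q hq hqp
    have h2 := hsmall |s| (abs_nonneg s) hs
    have h3 : ‖q + s • e - q‖ = |s| := by rw [add_sub_cancel_left, norm_smul, hen, mul_one, Real.norm_eq_abs]
    have h4 : ⟪q + s • e - q, n q⟫ = s * ⟪e, n q⟫ := by rw [add_sub_cancel_left, real_inner_smul_left]
    refine ⟨fun hs0 => ?_, fun hs0 hc => ?_⟩
    · refine ((hD q hq).2 _).1 ?_
      rw [h3, h4]
      rw [abs_of_neg hs0] at h2 ⊢
      nlinarith
    · rw [abs_of_pos hs0] at h2 h3
      have hnD : q + s • e ∉ D := by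
        refine ((hD q hq).2 _).2 ?_
        rw [h3, h4]; nlinarith
      have hf : q + s • e ∈ frontier D := by rw [hDo.frontier_eq]; exact ⟨hc, hnD⟩
      have := hD.abs_frontier hγ.1 hDo hq hf
      rw [h3, h4, abs_of_pos (by positivity)] at this
      nlinarith
  -- existence
  have hex : ∀ x ∈ ball p ρ, ∃ s : ℝ, |s| ≤ 4 * ρ ∧ x - s • e ∈ frontier D := by
    intro x hx
    rw [mem_ball, dist_eq_norm] at hx
    have hin := abs_le.mp ((abs_real_inner_le_norm (x - p) e).trans (by rw [hen, mul_one]))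
    have key : ∀ s : ℝ, |s| = 4 * ρ → A * ‖x - s • e - p‖ ^ (1 + γ) ≤ 5 * ρ / 6 := by
      intro s hs
      have h1 : ‖x - s • e - p‖ ≤ 5 * ρ := by
        calc ‖x - s • e - p‖ = ‖(x - p) - s • e‖ := by congr 1; abel
          _ ≤ ‖x - p‖ + ‖s • e‖ := norm_sub_le _ _
          _ ≤ _ := by rw [norm_smul, hen, mul_one, Real.norm_eq_abs, hs]; linarith
      refine (hsmall _ (norm_nonneg _) (by linarith)).trans ?_
      linarith
    have hinner : ∀ s : ℝ, ⟪x - s • e - p, e⟫ = ⟪x - p, e⟫ - s := by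
      intro s
      have : x - s • e - p = (x - p) - s • e := by abel
      rw [this, inner_sub_left, real_inner_smul_left, real_inner_self_eq_norm_sq, hen]; ring
    have hcont : Continuous (fun s : ℝ => x - s • e) := by fun_prop
    have hpre : IsPreconnected ((fun s : ℝ => x - s • e) '' Icc (-(4 * ρ)) (4 * ρ)) := isPreconnected_Icc.image _ hcont.continuousOn
    obtain ⟨z, ⟨s, hs, rfl⟩, hz⟩ := precon_frontier hpre (G := D)
      ⟨x - (4 * ρ) • e, ⟨4 * ρ, ⟨by linarith, le_rfl⟩, rfl⟩, ((hD p hp).2 _).1 (by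
        rw [← he, hinner]
        have := key (4 * ρ) (abs_of_pos (by positivity))
        linarith)⟩
      ⟨x - (-(4 * ρ)) • e, ⟨-(4 * ρ), ⟨le_rfl, by linarith⟩, rfl⟩, ((hD p hp).2 _).2 (by
        rw [← he, hinner]
        have := key (-(4 * ρ)) (by rw [abs_neg]; exact abs_of_pos (by positivity))
        linarith)⟩
    exact ⟨s, abs_le.mpr hs, hz⟩
  choose! f hf1 hf2 using hex
  set q : EuclideanSpace ℝ (Fin d) → EuclideanSpace ℝ (Fin d) := fun x => x - f x • e with hq
  have hqp : ∀ x ∈ ball p ρ, ‖q x - p‖ ≤ r0 := by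
    intro x hx
    have h1 := hf1 x hx
    rw [mem_ball, dist_eq_norm] at hx
    calc ‖x - f x • e - p‖ = ‖(x - p) - f x • e‖ := by congr 1; abel
      _ ≤ ‖x - p‖ + ‖f x • e‖ := norm_sub_le _ _
      _ ≤ _ := by rw [norm_smul, hen, mul_one, Real.norm_eq_abs]; linarith
  have hxq : ∀ x, q x + f x • e = x := fun x => by rw [hq]; simp
  -- signs
  have hsg : ∀ x ∈ ball p ρ, (f x < 0 → x ∈ D) ∧ (0 < f x → x ∉ closure D) ∧ (f x = 0 → x ∈ frontier D) := by
    intro x hx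
    have h := hline (q x) (hf2 x hx) (hqp x hx) (f x) ((hf1 x hx).trans (by linarith))
    rw [hxq] at h
    refine ⟨h.1, h.2, fun h0 => ?_⟩
    have := hf2 x hx
    rwa [h0, zero_smul, sub_zero] at this
  have hsD : ∀ x ∈ ball p ρ, x ∈ D → f x < 0 := by
    intro x hx hxD
    rcases lt_trichotomy (f x) 0 with h | h | h
    · exact h
    · exact absurd hxD (hfrD x ((hsg x hx).2.2 h))
    · exact absurd (subset_closure hxD) ((hsg x hx).2.1 h)
  have hsE : ∀ x ∈ ball p ρ, x ∉ closure D → 0 < f x := by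
    intro x hx hxD
    rcases lt_trichotomy (f x) 0 with h | h | h
    · exact absurd (subset_closure ((hsg x hx).1 h)) hxD
    · exact absurd (frontier_subset_closure ((hsg x hx).2.2 h)) hxD
    · exact h
  have hsF : ∀ x ∈ ball p ρ, x ∈ frontier D → f x = 0 := by
    intro x hx hxD
    rcases lt_trichotomy (f x) 0 with h | h | h
    · exact absurd ((hsg x hx).1 h) (hfrD x hxD)
    · exact h
    · exact absurd (frontier_subset_closure hxD) ((hsg x hx).2.1 h)
  -- Taylor estimate
  set a : EuclideanSpace ℝ (Fin d) → EuclideanSpace ℝ (Fin d) := fun x => (⟪e, n (q x)⟫)⁻¹ • n (q x) with ha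
  have hab : ∀ x ∈ ball p ρ, ‖a x‖ ≤ 2 := by
    intro x hx
    have h1 := htr _ (hf2 x hx) (hqp x hx)
    rw [ha]; simp only
    rw [norm_smul, (hD _ (hf2 x hx)).1, mul_one, norm_inv, Real.norm_of_nonneg (by linarith), inv_le_comm₀ (by linarith) (by norm_num)]
    linarith
  have htay : ∀ x ∈ ball p ρ, ∀ y ∈ ball p ρ, |f y - f x - ⟪a x, y - x⟫| ≤ (2 * A * 5 ^ (1 + γ)) * ‖y - x‖ ^ (1 + γ) := by
    intro x hx y hy
    have h1 := htr _ (hf2 x hx) (hqp x hx)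
    have h2 := hD.abs_frontier hγ.1 hDo (hf2 x hx) (hf2 y hy)
    change |⟪q y - q x, n (q x)⟫| ≤ A * ‖q y - q x‖ ^ (1 + γ) at h2
    set m := n (q x) with hm
    have hmn : ‖m‖ = 1 := (hD _ (hf2 x hx)).1
    set c := ⟪e, m⟫ with hc
    have hqq : q y - q x = (y - x) - (f y - f x) • e := by rw [hq]; simp only; module
    have hin : ⟪q y - q x, m⟫ = ⟪m, y - x⟫ - (f y - f x) * c := by
      rw [hqq, inner_sub_left, real_inner_smul_left, real_inner_comm]
    have hnq : ‖q y - q x‖ ≤ ‖y - x‖ + |f y - f x| := by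
      rw [hqq]
      refine (norm_sub_le _ _).trans ?_
      rw [norm_smul, hen, mul_one, Real.norm_eq_abs]
    have hbd : ‖q y - q x‖ ≤ 17 * r0 := by
      calc ‖q y - q x‖ = ‖(q y - p) - (q x - p)‖ := by congr 1; abel
        _ ≤ ‖q y - p‖ + ‖q x - p‖ := norm_sub_le _ _
        _ ≤ _ := by linarith [hqp x hx, hqp y hy]
    have h3 := hsmall _ (norm_nonneg _) hbd
    have h4 : |⟪m, y - x⟫| ≤ ‖y - x‖ := (abs_real_inner_le_norm _ _).trans (by rw [hmn, one_mul])
    have h5 : |f y - f x| ≤ 4 * ‖y - x‖ := by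
      have b : |f y - f x| * c ≤ ‖y - x‖ + (‖y - x‖ + |f y - f x|) / 6 := by
        rw [← abs_of_pos (show 0 < c by linarith), ← abs_mul]
        have : (f y - f x) * c = ⟪m, y - x⟫ - ⟪q y - q x, m⟫ := by rw [hin]; ring
        rw [this]
        refine (abs_sub _ _).trans ?_
        linarith
      nlinarith [abs_nonneg (f y - f x)]
    have h6 : ‖q y - q x‖ ≤ 5 * ‖y - x‖ := by linarith
    have h7 : f y - f x - ⟪a x, y - x⟫ = - (c⁻¹ * ⟪q y - q x, m⟫) := by
      rw [ha]; simp only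
      rw [real_inner_smul_left, hin, ← hm, ← hc]
      have : c ≠ 0 := by linarith
      field_simp
      ring
    rw [h7, abs_neg, abs_mul, abs_inv, abs_of_pos (show 0 < c by linarith)]
    have h8 : c⁻¹ ≤ 2 := by rw [inv_le_comm₀ (by linarith) (by norm_num)]; linarith
    have h9 : A * ‖q y - q x‖ ^ (1 + γ) ≤ A * (5 ^ (1 + γ) * ‖y - x‖ ^ (1 + γ)) := by
      rw [← Real.mul_rpow (by norm_num) (norm_nonneg _)]
      have := hγ.1
      gcongr
    have h10 := mul_le_mul h8 (h2.trans h9) (abs_nonneg _) (by norm_num)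
    linarith
  obtain ⟨χ, c1, c2, c3, c4, -, c5⟩ := bump_facts (p := p) (r := ρ / 2) (by positivity)
  have hwf : WF γ (fun x => χ x * f x) (fun x => χ x • a x + f x • gradient χ x) :=
    WF.mul_local hγ.1 hγ.2 (p := p) (ρ := ρ) (B := 4 * ρ + 2) (C := 2 * A * 5 ^ (1 + γ)) hρp (by positivity) c1 c5 c2
      (fun x hx => by linarith [hf1 x hx]) (fun x hx => by linarith [hab x hx]) htay
  have hout : ∀ x ∉ ball p ρ, χ x = 0 ∧ gradient χ x = 0 := fun x hx => c5 x (by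
    rw [mem_ball, dist_eq_norm, not_lt] at hx; linarith)
  have hinn : ∀ x ∈ ball p ρ, x ∈ frontier D → ∃ c > 0, ⟪χ x • a x + f x • gradient χ x, n x⟫ = χ x * c := by
    intro x hx hxf
    have h0 := hsF x hx hxf
    have hqx : q x = x := by rw [hq]; simp [h0]
    have h1 := htr _ (hf2 x hx) (hqp x hx)
    change 1 / 2 ≤ ⟪e, n (q x)⟫ at h1
    refine ⟨(⟪e, n (q x)⟫)⁻¹, inv_pos.mpr (by linarith), ?_⟩
    rw [h0, zero_smul, add_zero, ha]; simp only
    rw [hqx, real_inner_smul_left, real_inner_smul_left, real_inner_self_eq_norm_sq, (hD x hxf).1]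
    ring
  refine ⟨_, _, ρ / 2, by positivity, ⟨hwf, fun x hx => ?_, fun x hx => ?_, fun x hx => ?_, fun x hx => ?_⟩, fun x hx => ?_⟩
  · by_cases hb : x ∈ ball p ρ
    · exact mul_nonpos_of_nonneg_of_nonpos (c3 x) (hsD x hb hx).le
    · rw [(hout x hb).1]; simp
  · by_cases hb : x ∈ ball p ρ
    · rw [hsF x hb hx, mul_zero]
    · rw [(hout x hb).1]; simp
  · by_cases hb : x ∈ ball p ρ
    · refine mul_nonneg (c3 x) ?_
      by_contra hc
      exact hx ((hsg x hb).1 (not_le.mp hc))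
    · rw [(hout x hb).1]; simp
  · by_cases hb : x ∈ ball p ρ
    · obtain ⟨c, hc, h⟩ := hinn x hb hx
      rw [h]; exact mul_nonneg (c3 x) hc.le
    · rw [(hout x hb).1, (hout x hb).2]; simp
  · have hb : x ∈ ball p ρ := ball_subset_ball (by linarith) hx
    refine ⟨fun h => mul_neg_of_pos_of_neg (c4 x hx) (hsD x hb h), fun h => mul_pos (c4 x hx) (hsE x hb h), fun h => ?_⟩
    obtain ⟨c, hc, h⟩ := hinn x hb h
    rw [h]; exact mul_pos (c4 x hx) hc

theorem PN.isC1Domain (hγ : γ ∈ Ioo (0:ℝ) 1) {A : ℝ} (hA : 0 ≤ A) (hDo : IsOpen D) (hb : Bornology.IsBounded D)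
    (hD : PN γ A D n) : IsC1Domain d γ D :=
  piece_final hγ hDo hb fun _ hp => piece_frontier hγ hA hDo hD hp

end part17

/-- Theorem 2.1: local existence with a time of existence depending only on
`d`, `q(D₀)`, `σ(∂D₀)` and `diam D₀`. -/
theorem local_existence_quantified
    (d : ℕ) (hd : 2 ≤ d) (γ : ℝ) (hγ : γ ∈ Set.Ioo (0:ℝ) 1)
    (Q S R : ℝ) (hQ : 0 < Q) (hS : 0 < S) (hR : 0 < R) :
    ∃ t₀ > (0:ℝ),
      ∀ (D₀ : Set (EuclideanSpace ℝ (Fin d))) (Φ₀ : EuclideanSpace ℝ (Fin d) → ℝ)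
        (K m : ℝ),
        IsOpen D₀ → Bornology.IsBounded D₀ → IsDefining d γ D₀ Φ₀ →
        (∀ x y, ‖gradient Φ₀ x - gradient Φ₀ y‖ ≤ K * ‖x - y‖ ^ γ) →
        0 < m → (∀ x ∈ frontier D₀, m ≤ ‖gradient Φ₀ x‖) →
        K ≤ Q * m →
        μH[(d:ℝ) - 1] (frontier D₀) ≤ ENNReal.ofReal S →
        Metric.diam D₀ ≤ R →
        ∃ X : EuclideanSpace ℝ (Fin d) → ℝ → EuclideanSpace ℝ (Fin d),
          (∀ α, X α 0 = α) ∧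
          (∀ t ∈ Set.Ioo (-t₀) t₀,
            (∃ h : EuclideanSpace ℝ (Fin d) ≃ₜ EuclideanSpace ℝ (Fin d),
                ∀ α, h α = X α t) ∧
            IsC1Domain d γ ((fun α => X α t) '' D₀)) ∧
          (∀ α : EuclideanSpace ℝ (Fin d), ∀ t ∈ Set.Ioo (-t₀) t₀,
            HasDerivAt (fun s => X α s)
              (-(∫ y in (fun α => X α t) '' D₀, gradN d (X α t - y))) t) := by
  obtain ⟨M, hM, hVB⟩ := vel_bounds d hd γ hγ Q hQ.le (R + 1) (by positivity)
  refine ⟨1 / (8 * M), by positivity, ?_⟩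
  intro D Φ K m hDo hDb hΦ hK hm hmD hKQ hH hdiam
  rcases D.eq_empty_or_nonempty with he | ⟨c, hc⟩
  · subst he
    refine ⟨fun α _ => α, fun α => rfl, fun t _ => ⟨⟨Homeomorph.refl _, fun α => rfl⟩, ?_⟩, fun α t _ => ?_⟩
    · rw [image_empty]; exact ⟨hDo, hDb, Φ, hΦ⟩
    · rw [image_empty]; simpa using hasDerivAt_const t α
  have hDom : Dom d γ Q (R + 1) D (fun p => ‖gradient Φ p‖⁻¹ • gradient Φ p) c := by
    refine ⟨hDo, ⟨c, hc⟩, fun x hx => ?_, defining_PN hγ.1 hQ.le hΦ hK hm hmD hKQ, ne_top_of_le_ne_top ENNReal.ofReal_ne_top hH⟩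
    rw [mem_ball]
    have := dist_le_diam_of_mem hDb hx hc
    linarith
  have hV : VB d γ M D := hVB D _ c hDom
  obtain ⟨g, hg0, hg⟩ := flow_half hd hγ hQ.le (by positivity) hDom hM hV (s := -1) (by simp)
  obtain ⟨g', hg0', hg'⟩ := flow_half hd hγ hQ.le (by positivity) hDom hM hV (s := 1) (by simp)
  set T := 1 / (8 * M) with hT
  set G : ℝ → EuclideanSpace ℝ (Fin d) → EuclideanSpace ℝ (Fin d) := fun t => if 0 ≤ t then g t else g' (-t) with hG
  have hGp : ∀ t, 0 ≤ t → G t = g t := fun t ht => by rw [hG]; simp [ht]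
  have hGn : ∀ t, t ≤ 0 → G t = g' (-t) := fun t ht => by
    rcases ht.eq_or_lt with h | h
    · rw [hGp t h.ge, h, neg_zero]; funext x; rw [hg0, hg0']
    · rw [hG]; simp [not_le.mpr h]
  have hadm : ∀ t ∈ Ioo (-T) T, Adm γ (1/4) D (G t) := by
    intro t ht
    rcases le_total 0 t with h | h
    · rw [hGp t h]; exact (hg t ⟨h, ht.2.le⟩).1
    · rw [hGn t h]; exact (hg' (-t) ⟨by linarith, by linarith [ht.1]⟩).1
  have hright : ∀ α, ∀ t ∈ Ico 0 T, HasDerivWithinAt (fun s => G s α) (-Vel d D (G t) (α + G t α)) (Ici 0) t := by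
    intro α t ht
    have h1 := (hg t ⟨ht.1, ht.2.le⟩).2 α
    rw [neg_one_smul] at h1
    have h2 : HasDerivWithinAt (fun s => g s α) (-Vel d D (g t) (α + g t α)) (Ici 0) t := by
      refine h1.mono_of_mem_nhdsWithin ?_
      rw [← Ici_inter_Iic]
      exact Filter.inter_mem self_mem_nhdsWithin (mem_nhdsWithin_of_mem_nhds (Iic_mem_nhds ht.2))
    rw [hGp t ht.1]
    exact h2.congr (fun s hs => by rw [hGp s hs]) (by rw [hGp t ht.1])
  have hleft : ∀ α, ∀ t ∈ Ioc (-T) 0, HasDerivWithinAt (fun s => G s α) (-Vel d D (G t) (α + G t α)) (Iic 0) t := by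
    intro α t ht
    have h1 := (hg' (-t) ⟨by linarith [ht.2], by linarith [ht.1]⟩).2 α
    rw [one_smul] at h1
    have h2 : HasDerivWithinAt (fun s => g' (-s) α) (-Vel d D (g' (-t)) (α + g' (-t) α)) (Iic 0) t := by
      have h3 : HasDerivWithinAt (fun s : ℝ => -s) (-1) (Icc (-T) 0) t := (hasDerivAt_neg t).hasDerivWithinAt
      have h4 := HasDerivWithinAt.scomp t h1 h3 (fun s hs => ⟨by linarith [hs.2], by linarith [hs.1]⟩)
      rw [neg_one_smul] at h4
      refine HasDerivWithinAt.mono_of_mem_nhdsWithin (t := Icc (-T) 0) h4 ?_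
      rw [← Ici_inter_Iic]
      exact Filter.inter_mem (mem_nhdsWithin_of_mem_nhds (Ici_mem_nhds ht.1)) self_mem_nhdsWithin
    rw [hGn t ht.2]
    exact h2.congr (fun s hs => by rw [hGn s hs]) (by rw [hGn t ht.2])
  have hder : ∀ α, ∀ t ∈ Ioo (-T) T, HasDerivAt (fun s => G s α) (-Vel d D (G t) (α + G t α)) t := by
    intro α t ht
    rcases lt_trichotomy t 0 with h | h | h
    · exact (hleft α t ⟨ht.1, h.le⟩).hasDerivAt (Iic_mem_nhds h)
    · have h1 := (hleft α t ⟨ht.1, h.le⟩).union (hright α t ⟨h.ge, ht.2⟩)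
      rw [Iic_union_Ici] at h1
      exact hasDerivWithinAt_univ.mp h1
    · exact (hright α t ⟨h.le, ht.2⟩).hasDerivAt (Ici_mem_nhds h)
  refine ⟨fun α t => α + G t α, fun α => ?_, fun t ht => ?_, fun α t ht => ?_⟩
  · change α + G 0 α = α
    rw [hGp 0 le_rfl, hg0, add_zero]
  · obtain ⟨X, hX, him, ho, hsub, ⟨n', hn'⟩, -⟩ := adm_image hd hγ hQ.le hDom (hadm t ht)
    refine ⟨⟨X, hX⟩, ?_⟩
    rw [him]
    exact PN.isC1Domain hγ (by positivity) ho (isBounded_ball.subset hsub) hn'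
  · exact (hder α t ht).const_add α
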